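/- Suppose m, n are natural numbers and x_1, …, x_m, y_1, …, y_n are positive real numbers such that P_Λ(t) · ∏_{j=1}^n (1 − y_j t) = ∏_{i=1}^m (1 + x_i t) as formal power series over ℝ. Then the multiset {x_1, …, x_m} is equal to the multiset {x_1^{−1}, …, x_m^{−1}}, and the multiset {y_1, …, y_n} is equal to the multiset {y_1^{−1}, …, y_n^{−1}}. -/

import Mathlib

open TensorProduct Polynomial

noncomputable section

/-- The linear map `V ⊗ V → T(V)` sending `v ⊗ w` to `ι v * ι w`. -/
def mulTwo (K : Type) [Field K] (V : Type) [AddCommGroup V] [Module K V] :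
    V ⊗[K] V →ₗ[K] TensorAlgebra K V :=
  TensorProduct.lift
    ((LinearMap.mul K (TensorAlgebra K V)).compl₁₂ (TensorAlgebra.ι K) (TensorAlgebra.ι K))

/-- `R : V ⊗ V → V ⊗ V` is a Hecke symmetry with parameter `q`:
it is invertible, satisfies the braid relation, the Hecke relation
`(R + 1)(R - q) = 0`, and its half adjoint `R♯ : V* ⊗ V → V ⊗ V*`,
characterized by `⟨R♯(ξ ⊗ v), w⟩ = ⟨ξ, R(v ⊗ w)⟩`, is invertible. -/
def IsHeckeSymmetry (K : Type) [Field K] (V : Type) [AddCommGroup V] [Module K V]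
    (q : K) (R : V ⊗[K] V →ₗ[K] V ⊗[K] V) : Prop :=
  Function.Bijective R ∧
  (TensorProduct.map R LinearMap.id ∘ₗ
      ((TensorProduct.assoc K V V V).symm.toLinearMap ∘ₗ
        TensorProduct.map LinearMap.id R ∘ₗ (TensorProduct.assoc K V V V).toLinearMap) ∘ₗ
      TensorProduct.map R LinearMap.id =
    ((TensorProduct.assoc K V V V).symm.toLinearMap ∘ₗ
        TensorProduct.map LinearMap.id R ∘ₗ (TensorProduct.assoc K V V V).toLinearMap) ∘ₗ
      TensorProduct.map R LinearMap.id ∘ₗ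
      ((TensorProduct.assoc K V V V).symm.toLinearMap ∘ₗ
        TensorProduct.map LinearMap.id R ∘ₗ (TensorProduct.assoc K V V V).toLinearMap)) ∧
  ((R + LinearMap.id) ∘ₗ (R - q • LinearMap.id) = 0) ∧
  (∃ Rs : Module.Dual K V ⊗[K] V →ₗ[K] V ⊗[K] Module.Dual K V,
    Function.Bijective Rs ∧
    ∀ (ξ : Module.Dual K V) (v w : V),
      dualTensorHom K V V ((TensorProduct.comm K V (Module.Dual K V)) (Rs (ξ ⊗ₜ[K] v))) w =
        TensorProduct.lid K V (TensorProduct.map ξ LinearMap.id (R (v ⊗ₜ[K] w))))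

/-- The relation on `T(V)` whose closure cuts out the exterior algebra `Λ` of `R`:
all elements of the image of `R + 1` in degree two are set to zero. -/
def lambdaRel (K : Type) [Field K] (V : Type) [AddCommGroup V] [Module K V]
    (R : V ⊗[K] V →ₗ[K] V ⊗[K] V) :
    TensorAlgebra K V → TensorAlgebra K V → Prop :=
  fun a b => b = 0 ∧ ∃ u : V ⊗[K] V, a = mulTwo K V ((R + (LinearMap.id : V ⊗[K] V →ₗ[K] V ⊗[K] V)) u)

/-- The `l`-th homogeneous component of the exterior algebra `Λ = T(V)/(im(R+1))`,
as the image of the `l`-th graded piece of the tensor algebra. -/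
def lambdaGrade (K : Type) [Field K] (V : Type) [AddCommGroup V] [Module K V]
    (R : V ⊗[K] V →ₗ[K] V ⊗[K] V) (l : ℕ) :
    Submodule K (RingQuot (lambdaRel K V R)) :=
  Submodule.map (RingQuot.mkAlgHom K (lambdaRel K V R)).toLinearMap
    (LinearMap.range (TensorAlgebra.ι K : V →ₗ[K] TensorAlgebra K V) ^ l)

/-- The Poincaré series `P_Λ(t) = ∑ (dim Λ_l) t^l` of the exterior algebra,
as a formal power series over `ℝ`. -/
def poincareLambda (K : Type) [Field K] (V : Type) [AddCommGroup V] [Module K V]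
    (R : V ⊗[K] V →ₗ[K] V ⊗[K] V) : PowerSeries ℝ :=
  PowerSeries.mk fun l => (Module.finrank K (lambdaGrade K V R l) : ℝ)

namespace HS

section hsmain

open TensorProduct Polynomial Matrix
open scoped Kronecker
set_option linter.unusedVariables false
set_option linter.unusedSectionVars false

structure HTower (L : Type) [Field L] (q : L) (A : ℕ → Type) [∀ n, Ring (A n)]
    [∀ n, Algebra L (A n)] where
  s : ∀ n, A n →ₐ[L] A (n+1)
  T : ∀ n, A (n+2)
  comm : ∀ n (a : A n), T n * s _ (s _ a) = s _ (s _ a) * T n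
  quad : ∀ n, T n * T n = (q-1) • T n + q • (1 : A (n+2))
  braid : ∀ n, T (n+1) * s _ (T n) * T (n+1) = s _ (T n) * T (n+1) * s _ (T n)

namespace HTower
variable {L : Type} [Field L] {q : L} {A : ℕ → Type} [∀ n, Ring (A n)]
    [∀ n, Algebra L (A n)] (t : HTower L q A)

def H : ∀ n, Subalgebra L (A n)
  | 0 => ⊥
  | 1 => ⊥
  | n+2 => Algebra.adjoin L ((t.s (n+1)) '' (H (n+1)) ∪ {t.T n})

def Q (n : ℕ) : Submodule L (A (n+2)) :=
  Submodule.span L {x | ∃ a ∈ t.H (n+1), ∃ b ∈ t.H (n+1), x = t.s _ a * t.T n * t.s _ b}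

theorem T_mem (n : ℕ) : t.T n ∈ t.H (n+2) :=
  Algebra.subset_adjoin (Or.inr rfl)

theorem s_mem : ∀ (n : ℕ) {a : A n}, a ∈ t.H n → t.s n a ∈ t.H (n+1)
  | 0, a, ha => by
      obtain ⟨c, rfl⟩ := Algebra.mem_bot.1 ha
      rw [AlgHom.commutes]; exact Subalgebra.algebraMap_mem _ _
  | n+1, a, ha => Algebra.subset_adjoin (Or.inl ⟨a, ha, rfl⟩)

theorem mem_Q {n : ℕ} {a b : A (n+1)} (ha : a ∈ t.H (n+1)) (hb : b ∈ t.H (n+1)) :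
    t.s _ a * t.T n * t.s _ b ∈ t.Q n :=
  Submodule.subset_span ⟨a, ha, b, hb, rfl⟩

theorem Q_le (n : ℕ) {p : A (n+2)} (hp : p ∈ t.Q n) : p ∈ t.H (n+2) := by
  have : t.Q n ≤ Subalgebra.toSubmodule (t.H (n+2)) := by
    apply Submodule.span_le.2
    rintro x ⟨a, ha, b, hb, rfl⟩
    exact (t.H _).mul_mem ((t.H _).mul_mem (t.s_mem _ ha) (t.T_mem n)) (t.s_mem _ hb)
  exact this hp

theorem Q_mul {n : ℕ} {p : A (n+2)} (hp : p ∈ t.Q n) {c : A (n+1)} (hc : c ∈ t.H (n+1)) :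
    p * t.s _ c ∈ t.Q n := by
  induction hp using Submodule.span_induction with
  | mem x hx =>
    obtain ⟨a, ha, b, hb, rfl⟩ := hx
    rw [mul_assoc, ← map_mul]; exact t.mem_Q ha (mul_mem hb hc)
  | zero => simp
  | add x y _ _ hx hy => rw [add_mul]; exact add_mem hx hy
  | smul r x _ hx => rw [smul_mul_assoc]; exact Submodule.smul_mem _ _ hx

theorem mul_Q {n : ℕ} {p : A (n+2)} (hp : p ∈ t.Q n) {c : A (n+1)} (hc : c ∈ t.H (n+1)) :
    t.s _ c * p ∈ t.Q n := by
  induction hp using Submodule.span_induction with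
  | mem x hx =>
    obtain ⟨a, ha, b, hb, rfl⟩ := hx
    rw [← mul_assoc, ← mul_assoc, ← map_mul]; exact t.mem_Q (mul_mem hc ha) hb
  | zero => simp
  | add x y _ _ hx hy => rw [mul_add]; exact add_mem hx hy
  | smul r x _ hx => rw [mul_smul_comm]; exact Submodule.smul_mem _ _ hx

theorem T_Q {n : ℕ} : t.T n ∈ t.Q n := by
  simpa using t.mem_Q (one_mem (t.H (n+1))) (one_mem (t.H (n+1)))

/-- `T s(c) T` for `c` in the lower `Q`. -/
theorem TpT {n : ℕ} {p : A (n+2)} (hp : p ∈ t.Q n) :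
    t.T (n+1) * t.s _ p * t.T (n+1) ∈ t.Q (n+1) := by
  induction hp using Submodule.span_induction with
  | mem x hx =>
    obtain ⟨a, ha, b, hb, rfl⟩ := hx
    have : t.T (n+1) * t.s _ (t.s _ a * t.T n * t.s _ b) * t.T (n+1)
        = t.s _ (t.s _ a * t.T n) * t.T (n+1) * t.s _ (t.T n * t.s _ b) := by
      simp only [map_mul]
      calc _ = (t.T (n+1) * t.s _ (t.s _ a)) * t.s _ (t.T n) * (t.s _ (t.s _ b) * t.T (n+1)) := by
            simp only [mul_assoc]
        _ = t.s _ (t.s _ a) * (t.T (n+1) * t.s _ (t.T n) * t.T (n+1)) * t.s _ (t.s _ b) := by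
            rw [t.comm, ← t.comm _ b]; simp only [mul_assoc]
        _ = _ := by rw [t.braid]; simp only [mul_assoc]
    rw [this]
    exact t.mem_Q (mul_mem (t.s_mem _ ha) (t.T_mem n)) (mul_mem (t.T_mem n) (t.s_mem _ hb))
  | zero => simp
  | add x y _ _ hx hy => rw [map_add, mul_add, add_mul]; exact add_mem hx hy
  | smul r x _ hx =>
    rw [map_smul, mul_smul_comm, smul_mul_assoc]; exact Submodule.smul_mem _ _ hx

theorem TsT {n : ℕ} {a : A n} : t.T n * t.s _ (t.s _ a) * t.T n =
    q • t.s _ (t.s _ a) + (q-1) • (t.s _ (t.s _ a) * t.T n) := by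
  rw [t.comm, mul_assoc, t.quad, mul_add, mul_smul_comm, mul_smul_comm, mul_one]; exact add_comm _ _


def SS (n : ℕ) : Submodule L (A (n+2)) :=
  (Subalgebra.toSubmodule (t.H (n+1))).map (t.s (n+1)).toLinearMap ⊔ t.Q n

theorem mem_SS {n : ℕ} {h : A (n+2)} :
    h ∈ t.SS n ↔ ∃ a ∈ t.H (n+1), ∃ p ∈ t.Q n, h = t.s _ a + p := by
  constructor
  · intro h
    obtain ⟨_, ⟨a, ha, rfl⟩, p, hp, rfl⟩ := Submodule.mem_sup.1 h
    exact ⟨a, ha, p, hp, rfl⟩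
  · rintro ⟨a, ha, p, hp, rfl⟩
    exact Submodule.add_mem_sup ⟨a, ha, rfl⟩ hp

theorem decomp_aux (n : ℕ) (hT : ∀ b ∈ t.H (n+1), t.T n * t.s _ b * t.T n ∈ t.SS n)
    {h : A (n+2)} (hh : h ∈ t.H (n+2)) : h ∈ t.SS n := by
  have key : ∀ x ∈ t.H (n+2), ∀ y ∈ t.SS n, y * x ∈ t.SS n := by
    intro x hx
    induction hx using Algebra.adjoin_induction with
    | mem x hx =>
      intro y hy
      obtain ⟨a, ha, p, hp, rfl⟩ := t.mem_SS.1 hy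
      rcases hx with ⟨c, hc, rfl⟩ | hx
      · rw [add_mul]
        exact t.mem_SS.2 ⟨a * c, (t.H _).mul_mem ha hc, _, t.Q_mul hp hc, by simp⟩
      · rw [Set.mem_singleton_iff.1 hx, add_mul]
        refine add_mem (Submodule.mem_sup_right ?_) ?_
        · simpa using t.mem_Q ha ((t.H (n+1)).one_mem)
        · clear hy
          induction hp using Submodule.span_induction with
          | mem x hx =>
            obtain ⟨a, ha, b, hb, rfl⟩ := hx
            obtain ⟨c, hc, p, hp, h⟩ := t.mem_SS.1 (hT b hb)
            rw [mul_assoc, mul_assoc, ← mul_assoc (t.T _), h, mul_add, ← map_mul]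
            exact t.mem_SS.2 ⟨_, (t.H _).mul_mem ha hc, _, t.mul_Q hp ha, rfl⟩
          | zero => simp
          | add x y _ _ hx hy => rw [add_mul]; exact add_mem hx hy
          | smul r x _ hx => rw [smul_mul_assoc]; exact Submodule.smul_mem _ _ hx
    | algebraMap r =>
      intro y hy; rw [← Algebra.commutes, ← Algebra.smul_def]; exact Submodule.smul_mem _ _ hy
    | add x z _ _ hx hz => intro y hy; rw [mul_add]; exact add_mem (hx y hy) (hz y hy)
    | mul x z _ _ hx hz => intro y hy; rw [← mul_assoc]; exact hz _ (hx y hy)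
  have := key h hh 1 (t.mem_SS.2 ⟨1, (t.H _).one_mem, 0, zero_mem _, by simp⟩)
  rwa [one_mul] at this

theorem TsT_mem {n : ℕ} {a : A n} (ha : a ∈ t.H n) :
    t.T n * t.s _ (t.s _ a) * t.T n ∈ t.SS n := by
  rw [t.TsT]
  refine add_mem (Submodule.smul_mem _ _ ?_) (Submodule.smul_mem _ _ ?_)
  · exact t.mem_SS.2 ⟨_, t.s_mem _ ha, 0, zero_mem _, by simp⟩
  · refine Submodule.mem_sup_right ?_
    simpa using t.mem_Q (t.s_mem _ ha) ((t.H (n+1)).one_mem)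

theorem decomp : ∀ (n : ℕ) {h : A (n+2)}, h ∈ t.H (n+2) →
    ∃ a ∈ t.H (n+1), ∃ p ∈ t.Q n, h = t.s _ a + p := by
  intro n
  induction n with
  | zero =>
    intro h hh
    refine t.mem_SS.1 (t.decomp_aux 0 ?_ hh)
    intro b hb
    obtain ⟨c, rfl⟩ := Algebra.mem_bot.1 hb
    have := t.TsT_mem (n := 0) (a := algebraMap L _ c) ((t.H 0).algebraMap_mem c)
    rwa [AlgHom.commutes (t.s 0)] at this
  | succ n ih =>
    intro h hh
    refine t.mem_SS.1 (t.decomp_aux _ ?_ hh)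
    intro b hb
    obtain ⟨c, hc, p, hp, rfl⟩ := ih hb
    rw [map_add, mul_add, add_mul]
    exact add_mem (t.TsT_mem hc) (Submodule.mem_sup_right (t.TpT hp))

theorem H_zero {a : A 0} (h : a ∈ t.H 0) : ∃ c, a = algebraMap L _ c := by
  obtain ⟨c, rfl⟩ := Algebra.mem_bot.1 h; exact ⟨c, rfl⟩
theorem H_one {a : A 1} (h : a ∈ t.H 1) : ∃ c, a = algebraMap L _ c := by
  obtain ⟨c, rfl⟩ := Algebra.mem_bot.1 h; exact ⟨c, rfl⟩

/-- Induction principle for elements of `H (n+2)`. -/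
theorem H_ind {n : ℕ} {P : A (n+2) → Prop} {h : A (n+2)} (hh : h ∈ t.H (n+2))
    (hs : ∀ a ∈ t.H (n+1), P (t.s _ a))
    (hT : ∀ a ∈ t.H (n+1), ∀ b ∈ t.H (n+1), P (t.s _ a * t.T n * t.s _ b))
    (hadd : ∀ x y, P x → P y → P (x + y)) (hsmul : ∀ (c : L) x, P x → P (c • x)) : P h := by
  obtain ⟨a, ha, p, hp, rfl⟩ := t.decomp n hh
  refine hadd _ _ (hs a ha) ?_
  clear hh
  induction hp using Submodule.span_induction with
  | mem x hx => obtain ⟨a, ha, b, hb, rfl⟩ := hx; exact hT a ha b hb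
  | zero => simpa using hs 0 (zero_mem _)
  | add x y _ _ hx hy => exact hadd _ _ hx hy
  | smul r x _ hx => exact hsmul _ _ hx

end HTower

namespace HTower
variable {L : Type} [Field L] {q : L} {A : ℕ → Type} [∀ n, Ring (A n)]
    [∀ n, Algebra L (A n)] (t : HTower L q A)

def Q' : ∀ n, Submodule L (A (n+1))
  | 0 => ⊥
  | n+1 => t.Q n

theorem TpT' : ∀ {n : ℕ} {p : A (n+1)}, p ∈ t.Q' n → t.T n * t.s _ p * t.T n ∈ t.Q n
  | 0, p, hp => by
      rw [(Submodule.mem_bot L).1 hp]; simp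
  | n+1, p, hp => t.TpT hp

theorem Q'_mul : ∀ {n : ℕ} {p : A (n+1)}, p ∈ t.Q' n → ∀ {c : A n}, c ∈ t.H n → p * t.s _ c ∈ t.Q' n
  | 0, p, hp, c, _ => by
      rw [(Submodule.mem_bot L).1 hp]; simp
  | n+1, p, hp, c, hc => t.Q_mul hp hc

theorem mul_Q' : ∀ {n : ℕ} {p : A (n+1)}, p ∈ t.Q' n → ∀ {c : A n}, c ∈ t.H n → t.s _ c * p ∈ t.Q' n
  | 0, p, hp, c, _ => by
      rw [(Submodule.mem_bot L).1 hp]; simp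
  | n+1, p, hp, c, hc => t.mul_Q hp hc

def D : ∀ n : ℕ, ℕ → A (n+1)
  | _, 0 => 1
  | 0, _+1 => 0
  | n+1, k+1 => t.T n * t.s _ (D n k)

def Ds : ∀ n : ℕ, ℕ → A (n+1)
  | _, 0 => 1
  | 0, _+1 => 0
  | n+1, k+1 => t.s _ (Ds n k) * t.T n

theorem D_zero (n : ℕ) : t.D n 0 = 1 := by cases n <;> rfl
theorem Ds_zero (n : ℕ) : t.Ds n 0 = 1 := by cases n <;> rfl

theorem D_mem : ∀ n k, t.D n k ∈ t.H (n+1)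
  | 0, 0 => (t.H _).one_mem
  | 0, k+1 => zero_mem _
  | n+1, 0 => (t.H _).one_mem
  | n+1, k+1 => (t.H _).mul_mem (t.T_mem n) (t.s_mem _ (D_mem n k))

theorem Ds_mem : ∀ n k, t.Ds n k ∈ t.H (n+1)
  | 0, 0 => (t.H _).one_mem
  | 0, k+1 => zero_mem _
  | n+1, 0 => (t.H _).one_mem
  | n+1, k+1 => (t.H _).mul_mem (t.s_mem _ (Ds_mem n k)) (t.T_mem n)

theorem expand : ∀ n {h : A (n+1)}, h ∈ t.H (n+1) →
    ∃ f : ℕ → A n, (∀ k, f k ∈ t.H n) ∧ h = ∑ k ∈ Finset.range (n+1), t.s _ (f k) * t.D n k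
  | 0, h, hh => by
      obtain ⟨c, rfl⟩ := t.H_one hh
      refine ⟨fun _ => algebraMap L _ c, fun _ => (t.H _).algebraMap_mem _, ?_⟩
      simp [D_zero]
  | n+1, h, hh => by
      refine t.H_ind (P := fun h => ∃ f : ℕ → A (n+1), (∀ k, f k ∈ t.H (n+1)) ∧
        h = ∑ k ∈ Finset.range (n+2), t.s _ (f k) * t.D (n+1) k) hh ?_ ?_ ?_ ?_
      · intro a ha
        refine ⟨fun k => if k = 0 then a else 0, fun k => ?_, ?_⟩
        · dsimp only; split_ifs; exacts [ha, zero_mem _]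
        · rw [Finset.sum_range_succ']; simp [D_zero]
      · intro a ha b hb
        obtain ⟨f, hf, rfl⟩ := expand n hb
        refine ⟨fun k => Nat.casesOn k 0 (fun k => a * t.s _ (f k)), fun k => ?_, ?_⟩
        · cases k with
          | zero => exact zero_mem _
          | succ k => exact (t.H _).mul_mem ha (t.s_mem _ (hf k))
        · rw [map_sum, Finset.mul_sum, Finset.sum_range_succ' _ (n+1)]
          have h0 : t.s (n+1) (0 : A (n+1)) * t.D (n+1) 0 = 0 := by rw [map_zero, zero_mul]
          refine Eq.trans ?_ (add_zero _).symm |>.trans (congrArg _ h0.symm)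
          refine Finset.sum_congr rfl fun k _ => ?_
          show t.s _ a * t.T n * t.s _ (t.s _ (f k) * t.D n k) =
            t.s _ (a * t.s _ (f k)) * (t.T n * t.s _ (t.D n k))
          rw [map_mul, map_mul]
          rw [mul_assoc, ← mul_assoc (t.T n), t.comm]; simp only [mul_assoc]
      · rintro x y ⟨f, hf, rfl⟩ ⟨g, hg, rfl⟩
        refine ⟨fun k => f k + g k, fun k => add_mem (hf k) (hg k), ?_⟩
        simp [add_mul, Finset.sum_add_distrib]
      · rintro c x ⟨f, hf, rfl⟩
        refine ⟨fun k => c • f k, fun k => (t.H _).smul_mem (hf k) c, ?_⟩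
        simp [Finset.smul_sum]

theorem D_Ds : ∀ n j k, j ≤ n → k ≤ n →
    ∃ p ∈ t.Q' n, t.D n j * t.Ds n k = (if j = k then q ^ j else 0) • (1 : A (n+1)) + p
  | 0, 0, 0, _, _ => ⟨0, zero_mem _, by simp [D, Ds]⟩
  | 0, 0, k+1, _, h => absurd h (by omega)
  | 0, j+1, k, h, _ => absurd h (by omega)
  | n+1, 0, 0, _, _ => ⟨0, zero_mem _, by simp [D, Ds]⟩
  | n+1, 0, k+1, _, _ => ⟨t.s _ (t.Ds n k) * t.T n, by
      show _ ∈ t.Q n; simpa using t.mem_Q (t.Ds_mem n k) (t.H (n+1)).one_mem, by simp [D, Ds]⟩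
  | n+1, j+1, 0, _, _ => ⟨t.T n * t.s _ (t.D n j), by
      show _ ∈ t.Q n; simpa using t.mem_Q (t.H (n+1)).one_mem (t.D_mem n j), by simp [D, Ds]⟩
  | n+1, j+1, k+1, hj, hk => by
      obtain ⟨p, hp, h⟩ := D_Ds n j k (by omega) (by omega)
      have : t.D (n+1) (j+1) * t.Ds (n+1) (k+1) = t.T n * t.s _ (t.D n j * t.Ds n k) * t.T n := by
        simp [D, Ds, mul_assoc]
      rw [this, h]
      refine ⟨((if j = k then q ^ j else 0) * (q-1)) • t.T n + t.T n * t.s _ p * t.T n,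
        add_mem (Submodule.smul_mem _ _ t.T_Q) (t.TpT' hp), ?_⟩
      rw [map_add, map_smul, map_one, mul_add, add_mul, mul_smul_comm, smul_mul_assoc, mul_one,
        t.quad, smul_add, smul_smul, smul_smul, ← add_assoc]
      congr 1
      refine (add_comm _ _).trans ?_
      congr 2
      simp only [add_left_inj]
      split_ifs <;> simp [pow_succ]

section tau
variable (τ : ∀ n, A n →ₗ[L] L) (r : ℕ)
  (τs : ∀ n, n + 1 ≤ r → ∀ a ∈ t.H n, τ _ (t.s _ a) = τ _ a)
  (τQ : ∀ n, n + 1 ≤ r → ∀ p ∈ t.Q' n, τ _ p = 0)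
include τs τQ

theorem L45 (hq : q ≠ 0) (n : ℕ) (hn : n + 1 ≤ r)
    (nd : ∀ h ∈ t.H n, (∀ h' ∈ t.H n, τ _ (h * h') = 0) → h = 0)
    (f : ℕ → A n) (hf : ∀ k, f k ∈ t.H n)
    (h0 : ∀ h' ∈ t.H (n+1), τ _ ((∑ k ∈ Finset.range (n+1), t.s _ (f k) * t.D n k) * h') = 0) :
    ∀ k ≤ n, f k = 0 := by
  intro k hk
  apply nd _ (hf k)
  intro x hx
  have := h0 _ ((t.H _).mul_mem (t.Ds_mem n k) (t.s_mem _ hx))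
  rw [Finset.sum_mul, map_sum] at this
  have h2 : ∀ j ∈ Finset.range (n+1), τ _ (t.s _ (f j) * t.D n j * (t.Ds n k * t.s _ x)) =
      if j = k then q ^ k * τ _ (f k * x) else 0 := by
    intro j hj
    obtain ⟨p, hp, h⟩ := t.D_Ds n j k (by simpa [Nat.lt_succ_iff] using hj) hk
    have : t.s _ (f j) * t.D n j * (t.Ds n k * t.s _ x) =
      t.s _ (f j) * (t.D n j * t.Ds n k) * t.s _ x := by simp only [mul_assoc]
    rw [this, h, mul_add, add_mul, map_add,
      τQ n hn _ (t.Q'_mul (t.mul_Q' hp (hf j)) hx), add_zero, mul_smul_comm, mul_one,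
      smul_mul_assoc, ← map_mul, map_smul, τs n hn _ ((t.H _).mul_mem (hf j) hx)]
    split_ifs with h1
    · subst h1; simp
    · simp
  rw [Finset.sum_congr rfl h2, Finset.sum_ite_eq' , if_pos (by simp; omega)] at this
  exact (mul_eq_zero.1 this).resolve_left (pow_ne_zero _ hq)

theorem nondeg (hq : q ≠ 0) (τ1 : τ 0 1 = 1) : ∀ (n : ℕ), n ≤ r → 
    ∀ h ∈ t.H n, (∀ h' ∈ t.H n, τ _ (h * h') = 0) → h = 0
  | 0, _, h, hh, h0 => by
      obtain ⟨c, rfl⟩ := t.H_zero hh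
      have := h0 1 (t.H _).one_mem
      rw [mul_one, Algebra.algebraMap_eq_smul_one, map_smul, τ1] at this
      simp at this; simp [this]
  | n+1, hn, h, hh, h0 => by
      obtain ⟨f, hf, rfl⟩ := t.expand n hh
      have := t.L45 τ r τs τQ hq n hn (nondeg hq τ1 n (by omega)) f hf h0
      apply Finset.sum_eq_zero
      intro k hk
      rw [this k (by simpa [Nat.lt_succ_iff] using hk)]; simp

theorem big (hq : q ≠ 0) (τ1 : τ 0 1 = 1) : ∀ (n : ℕ), n ≤ r → 
    ∃ g : (Fin (n.factorial) → L) →ₗ[L] A n, Function.Injective g ∧ ∀ x, g x ∈ t.H n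
  | 0, _ => by
    refine ⟨(Algebra.linearMap L (A 0)).comp (LinearMap.proj ⟨0, by simp⟩), ?_, fun x => (t.H _).algebraMap_mem _⟩
    rw [← LinearMap.ker_eq_bot, LinearMap.ker_eq_bot']
    intro x hx
    have h2 : τ 0 (algebraMap L (A 0) (x ⟨0, by simp⟩)) = 0 := by
      have : algebraMap L (A 0) (x ⟨0, by simp⟩) = 0 := hx
      rw [this, map_zero]
    rw [Algebra.algebraMap_eq_smul_one, map_smul, τ1] at h2
    funext i
    have : i = ⟨0, by simp⟩ := by apply Fin.ext; have := i.2; simp at this; simpa using this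
    rw [this]; simpa using h2
  | n+1, hn => by
    obtain ⟨g, gi, gm⟩ := big hq τ1 n (by omega)
    have hfac : (n+1) * n.factorial = (n+1).factorial := (Nat.factorial_succ n).symm
    let e : Fin (n+1) × Fin n.factorial ≃ Fin (n+1).factorial :=
      finProdFinEquiv.trans (finCongr hfac)
    let G : (Fin ((n+1).factorial) → L) →ₗ[L] A (n+1) :=
      ∑ k : Fin (n+1), (LinearMap.mulRight L (t.D n k)) ∘ₗ (t.s n).toLinearMap ∘ₗ g ∘ₗ
        (LinearMap.funLeft L L (fun i => e (k, i)))
    have hG : ∀ x, G x = ∑ k ∈ Finset.range (n+1), t.s _ (if h : k < n+1 then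
        g (fun i => x (e (⟨k, h⟩, i))) else 0) * t.D n k := by
      intro x
      rw [Finset.sum_range]
      simp only [G, LinearMap.sum_apply, LinearMap.comp_apply]
      refine Finset.sum_congr rfl fun k _ => ?_
      rw [dif_pos k.2]; rfl
    have hf : ∀ x : Fin ((n+1).factorial) → L, ∀ k, (if h : k < n+1 then
        g (fun i => x (e (⟨k, h⟩, i))) else 0) ∈ t.H n := by
      intro x k; split_ifs; exacts [gm _, zero_mem _]
    refine ⟨G, ?_, fun x => ?_⟩
    · rw [← LinearMap.ker_eq_bot, LinearMap.ker_eq_bot']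
      intro x hx
      have := t.L45 τ r τs τQ hq n hn (t.nondeg τ r τs τQ hq τ1 n (by omega)) _ (hf x)
        (by intro h' _; rw [← hG, hx]; simp)
      funext i
      obtain ⟨⟨k, i⟩, rfl⟩ := e.surjective i
      have h1 := this k (by omega)
      rw [dif_pos k.2] at h1
      exact congrFun (gi (h1.trans (map_zero g).symm)) i
    · rw [hG]
      exact sum_mem fun k _ => (t.H _).mul_mem (t.s_mem _ (hf x k)) (t.D_mem _ _)
end tau
end HTower

section mats
variable {L : Type} [Field L] {ι κ : Type} [Fintype ι] [DecidableEq ι] [Fintype κ] [DecidableEq κ]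

abbrev M (ι : Type) (L : Type) := Matrix ι ι L

def sM : M κ L →ₐ[L] M (ι × κ) L where
  toFun h := (1 : M ι L) ⊗ₖ h
  map_one' := by simp
  map_mul' x y := by simp [← mul_kronecker_mul]
  map_zero' := by simp
  map_add' x y := by simp [kronecker_add]
  commutes' c := by
    simp [Algebra.algebraMap_eq_smul_one, kronecker_smul]

theorem sM_def (h : M κ L) : (sM h : M (ι × κ) L) = (1 : M ι L) ⊗ₖ h := rfl

variable (κ) in
def F (R : M (ι × ι) L) : M (ι × ι × κ) L :=
  Matrix.reindexAlgEquiv L L (Equiv.prodAssoc ι ι κ) (R ⊗ₖ (1 : M κ L))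

theorem F_apply (R : M (ι × ι) L) (a b a' b' : ι) (k k' : κ) :
    F κ R (a, b, k) (a', b', k') = R (a, b) (a', b') * (1 : M κ L) k k' := rfl

theorem F_one : F κ (1 : M (ι × ι) L) = 1 := by simp [F]
theorem F_mul (R R' : M (ι × ι) L) : F κ (R * R') = F κ R * F κ R' := by
  simp only [F, ← map_mul, ← mul_kronecker_mul, one_mul]
theorem F_add (R R' : M (ι × ι) L) : F κ (R + R') = F κ R + F κ R' := by
  simp only [F, ← map_add, add_kronecker]
theorem F_smul (c : L) (R : M (ι × ι) L) : F κ (c • R) = c • F κ R := by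
  simp only [F, ← map_smul, smul_kronecker]

theorem kron_assoc {α β γ : Type} [Fintype α] [DecidableEq α] [Fintype β] [DecidableEq β] [Fintype γ]
    [DecidableEq γ] (a : M α L) (b : M β L) (c : M γ L) : a ⊗ₖ (b ⊗ₖ c) =
    Matrix.reindexAlgEquiv L L (Equiv.prodAssoc α β γ) ((a ⊗ₖ b) ⊗ₖ c) := by
  ext ⟨i, j, k⟩ ⟨i', j', k'⟩; simp [mul_assoc]

theorem F_kron_comm (R : M (ι × ι) L) (g : M ι L) (hg : R * (g ⊗ₖ g) = (g ⊗ₖ g) * R) (a : M κ L) :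
    F κ R * (g ⊗ₖ (g ⊗ₖ a)) = (g ⊗ₖ (g ⊗ₖ a)) * F κ R := by
  rw [kron_assoc, F, ← map_mul, ← map_mul, ← mul_kronecker_mul, ← mul_kronecker_mul, hg]; simp

theorem F_comm (R : M (ι × ι) L) (a : M κ L) : F κ R * sM (sM a) = sM (sM a) * F κ R := by
  rw [sM_def, sM_def]; exact F_kron_comm R 1 (by simp) a

theorem F_braid (R : M (ι × ι) L) (hR : F ι R * sM R * F ι R = sM R * F ι R * sM R) :
    F (ι × κ) R * sM (F κ R) * F (ι × κ) R = sM (F κ R) * F (ι × κ) R * sM (F κ R) := by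
  let e : (ι × ι × ι) × κ ≃ ι × ι × ι × κ :=
    (Equiv.prodAssoc ι (ι × ι) κ).trans (Equiv.prodCongr (Equiv.refl _) (Equiv.prodAssoc ι ι κ))
  have h1 : F (ι × κ) R = Matrix.reindexAlgEquiv L L e (F ι R ⊗ₖ (1 : M κ L)) := by
    ext ⟨i, j, k, l⟩ ⟨i', j', k', l'⟩
    simp [F_apply, e, Matrix.one_apply, ite_and]
    split_ifs <;> rfl
  have h2 : (sM (F κ R) : M (ι × ι × ι × κ) L) = Matrix.reindexAlgEquiv L L e ((sM R) ⊗ₖ (1 : M κ L)) := by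
    ext ⟨i, j, k, l⟩ ⟨i', j', k', l'⟩
    simp [F_apply, e, Matrix.one_apply, sM_def]
  rw [h1, h2]
  simp only [← map_mul, ← mul_kronecker_mul, hR, one_mul]

/-- partial trace on the first factor against `Λ`. -/
def ptr (Λ : M ι L) : M (ι × κ) L →ₗ[L] M κ L where
  toFun X := Matrix.of fun k k' => ∑ i, ∑ j, Λ i j * X (j, k) (i, k')
  map_add' X Y := by ext; simp [mul_add, Finset.sum_add_distrib]
  map_smul' c X := by ext; simp [Finset.mul_sum, mul_left_comm]

def hat (R : M (ι × ι) L) : M ι L →ₗ[L] M ι L where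
  toFun Z := ptr Z R
  map_add' X Y := by ext; simp [ptr, add_mul, Finset.sum_add_distrib]
  map_smul' c X := by ext; simp [ptr, Finset.mul_sum, mul_assoc]

theorem ptr_apply (Λ : M ι L) (X : M (ι × κ) L) (k k' : κ) :
    ptr Λ X k k' = ∑ i, ∑ j, Λ i j * X (j, k) (i, k') := rfl

theorem hat_def (R : M (ι × ι) L) (Z : M ι L) : hat R Z = ptr Z R := rfl

theorem ptr_kron (Λ Y : M ι L) (X : M κ L) : ptr Λ (Y ⊗ₖ X) = (Λ * Y).trace • X := by
  ext k k'
  simp [ptr_apply, Matrix.trace, Matrix.mul_apply, Finset.sum_mul, mul_assoc]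

theorem ptr_sM (Λ : M ι L) (X : M κ L) : ptr Λ (sM X : M (ι × κ) L) = Λ.trace • X := by
  rw [sM_def, ptr_kron, mul_one]

theorem kron_ind {P : M (ι × κ) L → Prop} (h : ∀ Y X, P (Y ⊗ₖ X)) (hadd : ∀ x y, P x → P y → P (x + y))
    (Z : M (ι × κ) L) : P Z := by
  have h0 : P 0 := by simpa using h 0 0
  have : Z = ∑ p : ι × κ, ∑ p' : ι × κ, (Matrix.single p.1 p'.1 (1:L)) ⊗ₖ (Matrix.single p.2 p'.2 (Z p p')) := by
    conv_lhs => rw [matrix_eq_sum_single Z]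
    refine Finset.sum_congr rfl fun p _ => Finset.sum_congr rfl fun p' _ => ?_
    rw [single_kronecker_single, one_mul]
  rw [this]
  refine Finset.sum_induction _ P hadd h0 fun p _ => Finset.sum_induction _ P hadd h0 fun p' _ => h _ _

theorem ptr_sMul (Λ : M ι L) (a : M κ L) (X : M (ι × κ) L) : ptr Λ (sM a * X) = a * ptr Λ X := by
  induction X using kron_ind with
  | h Y X => rw [sM_def, ← mul_kronecker_mul, one_mul, ptr_kron, ptr_kron, mul_smul_comm]
  | hadd x y hx hy => rw [mul_add, map_add, map_add, hx, hy, mul_add]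

theorem ptr_mul_s (Λ : M ι L) (a : M κ L) (X : M (ι × κ) L) : ptr Λ (X * sM a) = ptr Λ X * a := by
  induction X using kron_ind with
  | h Y X => rw [sM_def, ← mul_kronecker_mul, mul_one, ptr_kron, ptr_kron, smul_mul_assoc]
  | hadd x y hx hy => rw [add_mul, map_add, map_add, hx, hy, add_mul]

theorem ptr_F (Λ : M ι L) (R : M (ι × ι) L) : ptr Λ (F κ R) = hat R Λ ⊗ₖ (1 : M κ L) := by
  ext ⟨b, k⟩ ⟨b', k'⟩
  simp [ptr_apply, hat_def, F_apply, Finset.sum_mul, mul_assoc]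

theorem trace_kron_mul (Λ : M ι L) (Y : M κ L) (X : M (ι × κ) L) :
    ((Λ ⊗ₖ Y) * X).trace = (Y * ptr Λ X).trace := by
  induction X using kron_ind with
  | h Z X => rw [← mul_kronecker_mul, ptr_kron, trace_kronecker, mul_smul_comm, trace_smul, smul_eq_mul]
  | hadd x y hx hy => rw [mul_add, map_add, mul_add, trace_add, trace_add, hx, hy]

theorem key_ptr (Λ : M ι L) (R : M (ι × ι) L) (Y a b : M (ι × κ) L) :
    ((Λ ⊗ₖ Y) * (sM a * F κ R * sM b)).trace = (Y * (a * (hat R Λ ⊗ₖ (1 : M κ L)) * b)).trace := by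
  rw [trace_kron_mul, ptr_mul_s, ptr_sMul, ptr_F]

end mats

def I (ι : Type) : ℕ → Type
  | 0 => Unit
  | n+1 => ι × I ι n

instance (ι : Type) [Fintype ι] : ∀ n, Fintype (I ι n)
  | 0 => inferInstanceAs (Fintype Unit)
  | n+1 => @instFintypeProd ι (I ι n) _ (instFintypeI ι n)

instance (ι : Type) [DecidableEq ι] : ∀ n, DecidableEq (I ι n)
  | 0 => inferInstanceAs (DecidableEq Unit)
  | n+1 => @instDecidableEqProd ι (I ι n) _ (instDecidableEqI ι n)

section fam
variable {L : Type} [Field L] {J : Type} (d : J → ℕ)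

abbrev Fam (L : Type) (n : ℕ) := ∀ j, M (I (Fin (d j)) n) L

structure IsHecke {ι : Type} [Fintype ι] [DecidableEq ι] (q : L) (R : M (ι × ι) L) : Prop where
  quad : R * R = (q - 1) • R + q • 1
  braid : F ι R * sM R * F ι R = sM R * F ι R * sM R

def famTower (q : L) (R : ∀ j, M (Fin (d j) × Fin (d j)) L) (hR : ∀ j, IsHecke q (R j)) :
    HTower L q (Fam d L) where
  s n := AlgHom.pi (A := fun j => M (I (Fin (d j)) (n+1)) L) fun j =>
    (sM : M (I (Fin (d j)) n) L →ₐ[L] M (Fin (d j) × I (Fin (d j)) n) L).comp (Pi.evalAlgHom L _ j)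
  T n j := (F (I (Fin (d j)) n) (R j) : M (Fin (d j) × Fin (d j) × I (Fin (d j)) n) L)
  comm n a := by
    funext j; exact F_comm (R j) (a j)
  quad n := by
    funext j
    have := congrArg (F (I (Fin (d j)) n)) (hR j).quad
    rw [F_mul, F_add, F_smul, F_smul, F_one] at this
    exact this
  braid n := by
    funext j; exact F_braid (R j) (hR j).braid
end fam

structure HRep {L : Type} [Field L] {q : L} {A : ℕ → Type} [∀ n, Ring (A n)]
    [∀ n, Algebra L (A n)] (t : HTower L q A) {ι : Type} [Fintype ι] [DecidableEq ι]
    (R : M (ι × ι) L) where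
  π : ∀ n, A n →ₐ[L] M (I ι n) L
  πs : ∀ n a, π (n+1) (t.s n a) = (sM (π n a) : M (ι × I ι n) L)
  πT : ∀ n, π (n+2) (t.T n) = (F (I ι n) R : M (ι × ι × I ι n) L)

def famHRep {L : Type} [Field L] {J : Type} (d : J → ℕ) 
    (q : L) (R : ∀ j, M (Fin (d j) × Fin (d j)) L) (hR : ∀ j, IsHecke q (R j)) (j : J) :
    HRep (famTower d q R hR) (R j) where
  π n := Pi.evalAlgHom L (fun j => M (I (Fin (d j)) n) L) j
  πs n a := rfl
  πT n := rfl

section bridge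
variable {L : Type} [Field L] {ι : Type} [Fintype ι] [DecidableEq ι] {n : ℕ}

def kr (a : M ι L) (X : M (I ι n) L) : M (I ι (n+1)) L := (a ⊗ₖ X : M (ι × I ι n) L)
def sI : M (I ι n) L →ₐ[L] M (I ι (n+1)) L := (sM : _ →ₐ[L] M (ι × I ι n) L)
def FI (n : ℕ) (R : M (ι × ι) L) : M (I ι (n+2)) L := (F (I ι n) R : M (ι × ι × I ι n) L)
def pt (Λ : M ι L) : M (I ι (n+1)) L →ₗ[L] M (I ι n) L := (ptr Λ : M (ι × I ι n) L →ₗ[L] _)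
def gp (g : M ι L) : ∀ n, M (I ι n) L
  | 0 => 1
  | n+1 => kr g (gp g n)

theorem kr_mul (a b : M ι L) (X Y : M (I ι n) L) : kr a X * kr b Y = kr (a * b) (X * Y) :=
  (mul_kronecker_mul a b X Y).symm
theorem sI_eq (X : M (I ι n) L) : sI X = kr 1 X := rfl
theorem kr_one : kr (1 : M ι L) (1 : M (I ι n) L) = 1 := one_kronecker_one
theorem kr_add (a : M ι L) (X Y : M (I ι n) L) : kr a (X + Y) = kr a X + kr a Y := kronecker_add a X Y
theorem add_kr (a b : M ι L) (X : M (I ι n) L) : kr (a + b) X = kr a X + kr b X := add_kronecker a b X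
theorem kr_smul (c : L) (a : M ι L) (X : M (I ι n) L) : kr a (c • X) = c • kr a X := kronecker_smul c a X
theorem smul_kr (c : L) (a : M ι L) (X : M (I ι n) L) : kr (c • a) X = c • kr a X := smul_kronecker c a X
theorem trace_kr (a : M ι L) (X : M (I ι n) L) : (kr a X).trace = a.trace * X.trace := trace_kronecker a X
theorem trace_kr_mul (Λ : M ι L) (Y : M (I ι n) L) (X : M (I ι (n+1)) L) :
    (kr Λ Y * X).trace = (Y * pt Λ X).trace := trace_kron_mul Λ Y X
theorem pt_sMul (Λ : M ι L) (a : M (I ι n) L) (X : M (I ι (n+1)) L) : pt Λ (sI a * X) = a * pt Λ X :=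
  ptr_sMul Λ a X
theorem pt_mul_s (Λ : M ι L) (a : M (I ι n) L) (X : M (I ι (n+1)) L) : pt Λ (X * sI a) = pt Λ X * a :=
  ptr_mul_s Λ a X
theorem pt_sI (Λ : M ι L) (X : M (I ι n) L) : pt Λ (sI X) = Λ.trace • X := ptr_sM Λ X
theorem pt_kr (Λ Y : M ι L) (X : M (I ι n) L) : pt Λ (kr Y X) = (Λ * Y).trace • X := ptr_kron Λ Y X
theorem pt_FI (Λ : M ι L) (R : M (ι × ι) L) : pt Λ (FI n R) = kr (hat R Λ) (1 : M (I ι n) L) :=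
  ptr_F Λ R
theorem pt_key (Λ : M ι L) (R : M (ι × ι) L) (a b : M (I ι (n+1)) L) :
    pt Λ (sI a * FI n R * sI b) = a * kr (hat R Λ) (1 : M (I ι n) L) * b := by
  rw [pt_mul_s, pt_sMul, pt_FI]
theorem FI_comm (R : M (ι × ι) L) (g : M ι L) (hg : R * (g ⊗ₖ g) = (g ⊗ₖ g) * R) (a : M (I ι n) L) :
    FI n R * kr g (kr g a) = kr g (kr g a) * FI n R := F_kron_comm R g hg a
theorem FI_one : FI n (1 : M (ι × ι) L) = 1 := F_one
theorem FI_mul (R R' : M (ι × ι) L) : FI n (R * R') = FI n R * FI n R' := F_mul R R'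
theorem kr_ind {P : M (I ι (n+1)) L → Prop} (h : ∀ (Y : M ι L) (X : M (I ι n) L), P (kr Y X))
    (hadd : ∀ x y, P x → P y → P (x + y)) (Z : M (I ι (n+1)) L) : P Z :=
  kron_ind (ι := ι) (κ := I ι n) (P := P) h hadd Z

theorem trace_one0 : (1 : M (I ι 0) L).trace = 1 := by
  show (1 : M Unit L).trace = 1
  simp

def W (g : M ι L) (R : M (ι × ι) L) : ℕ → M ι L
  | 0 => g
  | k+1 => hat R (W g R k) * g
end bridge

namespace HRep
variable {L : Type} [Field L] {q : L} {A : ℕ → Type} [∀ n, Ring (A n)]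
    [∀ n, Algebra L (A n)] {t : HTower L q A} {ι : Type} [Fintype ι] [DecidableEq ι]
    {R : M (ι × ι) L} (ρ : HRep t R)
include ρ

theorem pis (n : ℕ) (a : A n) : ρ.π (n+1) (t.s n a) = sI (ρ.π n a) := ρ.πs n a
theorem piT (n : ℕ) : ρ.π (n+2) (t.T n) = FI n R := ρ.πT n

theorem pisTs (n : ℕ) (a b : A (n+1)) : ρ.π (n+2) (t.s _ a * t.T n * t.s _ b) =
    sI (ρ.π _ a) * FI n R * sI (ρ.π _ b) := by
  rw [map_mul, map_mul, ρ.pis, ρ.pis, ρ.piT]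

theorem gp_comm (g : M ι L) (hg : R * (g ⊗ₖ g) = (g ⊗ₖ g) * R) :
    ∀ n, ∀ h ∈ t.H n, ρ.π n h * gp g n = gp g n * ρ.π n h
  | 0, h, hh => by simp [gp]
  | 1, h, hh => by
      obtain ⟨c, rfl⟩ := t.H_one hh
      rw [AlgHom.commutes, Algebra.commutes]
  | n+2, h, hh => by
      have hs : ∀ a ∈ t.H (n+1), sI (ρ.π (n+1) a) * gp g (n+2) = gp g (n+2) * sI (ρ.π (n+1) a) := by
        intro a ha
        rw [sI_eq, gp, kr_mul, kr_mul, gp_comm g hg (n+1) a ha, one_mul, mul_one]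
      refine t.H_ind (P := fun h => ρ.π _ h * gp g (n+2) = gp g (n+2) * ρ.π _ h) hh ?_ ?_ ?_ ?_
      · intro a ha
        rw [ρ.pis, hs a ha]
      · intro a ha b hb
        rw [ρ.pisTs, mul_assoc, hs b hb, ← mul_assoc, mul_assoc _ (FI n R)]
        rw [show FI n R * gp g (n+2) = gp g (n+2) * FI n R from FI_comm R g hg _, ← mul_assoc, hs a ha]
        simp only [mul_assoc]
      · intro x y hx hy
        rw [map_add, add_mul, mul_add, hx, hy]
      · intro c x hx
        rw [map_smul, smul_mul_assoc, hx, mul_smul_comm]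

def chi (g : M ι L) (k n : ℕ) (h : A (n+1)) : L := (kr (W g R k) (gp g n) * ρ.π _ h).trace
def phi (g : M ι L) (n : ℕ) (h : A n) : L := (gp g n * ρ.π _ h).trace

theorem chi_zero (g : M ι L) (n : ℕ) (h : A (n+1)) : ρ.chi g 0 n h = ρ.phi g (n+1) h := rfl
theorem chi_add (g : M ι L) (k n : ℕ) (h h' : A (n+1)) : ρ.chi g k n (h + h') = ρ.chi g k n h + ρ.chi g k n h' := by
  simp [chi, mul_add]
theorem chi_smul (g : M ι L) (k n : ℕ) (c : L) (h : A (n+1)) : ρ.chi g k n (c • h) = c * ρ.chi g k n h := by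
  simp [chi]
theorem phi_add (g : M ι L) (n : ℕ) (h h' : A n) : ρ.phi g n (h + h') = ρ.phi g n h + ρ.phi g n h' := by
  simp [phi, mul_add]
theorem phi_smul (g : M ι L) (n : ℕ) (c : L) (h : A n) : ρ.phi g n (c • h) = c * ρ.phi g n h := by
  simp [phi]

theorem chi_one (g : M ι L) (k : ℕ) : ρ.chi g k 0 1 = (W g R k).trace := by
  rw [chi, map_one, mul_one, trace_kr, gp, trace_one0, mul_one]

theorem chi_s (g : M ι L) (k n : ℕ) (a : A (n+1)) : ρ.chi g k (n+1) (t.s _ a) =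
    (W g R k).trace * ρ.chi g 0 n a := by
  rw [chi, ρ.pis, trace_kr_mul, pt_sI, mul_smul_comm, trace_smul, smul_eq_mul]; rfl

theorem chi_sTs (g : M ι L) (hg : R * (g ⊗ₖ g) = (g ⊗ₖ g) * R) (k n : ℕ) (a b : A (n+1))
    (hb : b ∈ t.H (n+1)) : ρ.chi g k (n+1) (t.s _ a * t.T n * t.s _ b) = ρ.chi g (k+1) n (b * a) := by
  rw [chi, ρ.pisTs, trace_kr_mul, pt_key]
  have h1 : gp g (n+1) * (ρ.π _ a * kr (hat R (W g R k)) 1 * ρ.π _ b) =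
    (gp g (n+1) * ρ.π _ a) * (kr (hat R (W g R k)) 1 * ρ.π _ b) := by simp only [mul_assoc]
  rw [h1, trace_mul_comm]
  have h2 : (kr (hat R (W g R k)) 1 * ρ.π _ b) * (gp g (n+1) * ρ.π _ a) = 
    kr (hat R (W g R k)) 1 * (ρ.π _ b * gp g (n+1)) * ρ.π _ a := by simp only [mul_assoc]
  rw [h2, ρ.gp_comm g hg _ b hb, gp, ← mul_assoc, kr_mul, one_mul, mul_assoc, ← map_mul]; rfl

theorem chi_D (g : M ι L) (hg : R * (g ⊗ₖ g) = (g ⊗ₖ g) * R) : ∀ k j, 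
    ρ.chi g j k (t.D k k) = (W g R (j+k)).trace
  | 0, j => ρ.chi_one g j
  | k+1, j => by
      have := ρ.chi_sTs g hg j k 1 (t.D k k) (t.D_mem k k)
      rw [map_one, one_mul, mul_one, chi_D g hg k (j+1)] at this
      rw [show j + (k+1) = j+1+k by omega, ← this]; rfl

section two
variable {ι' : Type} [Fintype ι'] [DecidableEq ι'] {R' : M (ι' × ι') L} (ρ' : HRep t R')

theorem chi_agree (g : M ι L) (hg : R * (g ⊗ₖ g) = (g ⊗ₖ g) * R)
    (g' : M ι' L) (hg' : R' * (g' ⊗ₖ g') = (g' ⊗ₖ g') * R')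
    (hc : ∀ k, (W g R k).trace = (W g' R' k).trace) :
    ∀ n, ∀ h ∈ t.H (n+1), ∀ k, ρ.chi g k n h = ρ'.chi g' k n h
  | 0, h, hh, k => by
      obtain ⟨c, rfl⟩ := t.H_one hh
      rw [Algebra.algebraMap_eq_smul_one, chi_smul, chi_smul, chi_one, chi_one, hc]
  | n+1, h, hh, k => by
      refine t.H_ind (P := fun h => ρ.chi g k (n+1) h = ρ'.chi g' k (n+1) h) hh ?_ ?_ ?_ ?_
      · intro a ha
        rw [chi_s, chi_s, hc, chi_agree g hg g' hg' hc n a ha]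
      · intro a ha b hb
        rw [ρ.chi_sTs g hg _ _ _ _ hb, ρ'.chi_sTs g' hg' _ _ _ _ hb, chi_agree g hg g' hg' hc n _
          ((t.H _).mul_mem hb ha)]
      · intro x y hx hy
        rw [chi_add, chi_add, hx, hy]
      · intro c x hx
        rw [chi_smul, chi_smul, hx]

theorem phi_algebraMap0 (g : M ι L) (c : L) : ρ.phi g 0 (algebraMap L _ c) = c := by
  rw [Algebra.algebraMap_eq_smul_one, phi_smul, phi, map_one, mul_one, gp, trace_one0, mul_one]

theorem phi_agree (g : M ι L) (hg : R * (g ⊗ₖ g) = (g ⊗ₖ g) * R)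
    (g' : M ι' L) (hg' : R' * (g' ⊗ₖ g') = (g' ⊗ₖ g') * R')
    (hc : ∀ k, (W g R k).trace = (W g' R' k).trace) :
    ∀ n, ∀ h ∈ t.H n, ρ.phi g n h = ρ'.phi g' n h
  | 0, h, hh => by
      obtain ⟨c, rfl⟩ := t.H_zero hh
      rw [phi_algebraMap0, phi_algebraMap0]
  | n+1, h, hh => ρ.chi_agree ρ' g hg g' hg' hc n h hh 0
end two
end HRep

variable {L : Type} [Field L] {ι : Type} [Fintype ι] [DecidableEq ι]

structure IsSym (q : L) (R S : M (ι × ι) L) : Prop extends IsHecke q R where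
  RS : R * S = 1
  SR : S * R = 1
  inj : ∀ Z, hat S Z = 0 → Z = 0

theorem IsSym.exists_C {q : L} {R S : M (ι × ι) L} (h : IsSym q R S) : ∃ C, hat S C = 1 := by
  have : Function.Injective (hat S) := by
    rw [← LinearMap.ker_eq_bot, LinearMap.ker_eq_bot']; exact h.inj
  exact (LinearMap.injective_iff_surjective.1 this) 1

theorem IsSym.R_eq {q : L} {R S : M (ι × ι) L} (h : IsSym q R S) : R = q • S + (q-1) • 1 := by
  have := congrArg (· * S) h.quad
  simp only [add_mul, smul_mul_assoc, one_mul, mul_assoc, h.RS, mul_one] at this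
  rw [this, add_comm]

theorem IsSym.hat_C {q : L} {R S : M (ι × ι) L} (h : IsSym q R S) {C : M ι L} (hC : hat S C = 1) :
    hat R C = (q + (q-1) * C.trace) • (1 : M ι L) := by
  have h1 : hat (1 : M (ι × ι) L) C = C.trace • (1 : M ι L) := by
    rw [hat_def, ← one_kronecker_one, ptr_kron, mul_one]
  rw [hat_def] at *
  rw [h.R_eq, map_add, map_smul, map_smul, hC, h1, add_smul, smul_smul]

theorem IsSym.ptr_one {q : L} {R S : M (ι × ι) L} (h : IsSym q R S) {C : M ι L} (hC : hat S C = 1) :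
    ptr C (F ι R * sM S * F ι S) = 1 := by
  have e1 : F ι R * F ι S = 1 := by rw [← F_mul, h.RS, F_one]
  have e2 : F ι S * F ι R = 1 := by rw [← F_mul, h.SR, F_one]
  have e3 : (sM R : M (ι × ι × ι) L) * sM S = 1 := by rw [← map_mul, h.RS, map_one]
  have e4 : (sM S : M (ι × ι × ι) L) * sM R = 1 := by rw [← map_mul, h.SR, map_one]
  have : F ι R * sM S * F ι S = sM S * F ι S * sM R := by
    have hb := h.braid
    -- F R sM R F R = sM R F R sM R ; multiply
    calc F ι R * sM S * F ι S = (sM S * F ι S) * (F ι R * sM R * F ι R) * sM S * F ι S := by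
          rw [← mul_assoc, ← mul_assoc, mul_assoc (sM S), e2, mul_one, e4, one_mul]
      _ = (sM S * F ι S) * (sM R * F ι R * sM R) * sM S * F ι S := by rw [hb]
      _ = (sM S * F ι S) * sM R * F ι R * (sM R * sM S) * F ι S := by simp only [mul_assoc]
      _ = (sM S * F ι S) * sM R * (F ι R * F ι S) := by rw [e3]; simp only [mul_assoc, mul_one, one_mul]
      _ = _ := by rw [e1, mul_one]
  rw [this, ptr_mul_s, ptr_sMul, ptr_F, hC, one_kronecker_one, mul_one, h.SR]

theorem sum5 (f : ι → ι → ι → ι → ι → L) : ∑ e, ∑ e', ∑ a, ∑ a1, ∑ a2, f e e' a a1 a2 =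
    ∑ a, ∑ a1, ∑ a2, ∑ e, ∑ e', f e e' a a1 a2 := by
  let E : ι × ι × ι × ι × ι ≃ ι × ι × ι × ι × ι :=
    ⟨fun p => (p.2.2.1, p.2.2.2.1, p.2.2.2.2, p.1, p.2.1), fun p => (p.2.2.2.1, p.2.2.2.2, p.1, p.2.1, p.2.2.1),
      fun p => rfl, fun p => rfl⟩
  have := Fintype.sum_equiv E (fun p => f p.1 p.2.1 p.2.2.1 p.2.2.2.1 p.2.2.2.2)
    (fun p => f p.2.2.2.1 p.2.2.2.2 p.1 p.2.1 p.2.2.1) (fun p => rfl)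
  simpa only [Fintype.sum_prod_type] using this

theorem IsSym.star_aux {q : L} {R S : M (ι × ι) L} (h : IsSym q R S) {C : M ι L} (hC : hat S C = 1)
    (b d e e' : ι) : ∑ a, ∑ a1, ∑ a2, C a a1 * R (a1, b) (a2, e') * S (a2, e) (a, d) =
      (1 : M ι L) b d * C e e' := by
  let N : M ι L := Matrix.of fun e e' => ∑ a, ∑ a1, ∑ a2, C a a1 * R (a1, b) (a2, e') * S (a2, e) (a, d)
  have : N - (1 : M ι L) b d • C = 0 := by
    apply h.inj
    rw [map_sub, map_smul, hC, sub_eq_zero]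
    ext f f'
    have h1 := congrFun (congrFun (h.ptr_one hC) (b, f)) (d, f')
    have h2 : (1 : M (ι × ι) L) (b, f) (d, f') = ((1 : M ι L) b d • (1 : M ι L)) f f' := by
      rw [← one_kronecker_one]; rfl
    rw [← h2, ← h1]
    simp only [hat_def, ptr_apply, N, of_apply, Matrix.mul_apply, Fintype.sum_prod_type, F_apply, sM_def,
      kronecker_apply, Finset.sum_mul, Finset.mul_sum, Matrix.one_apply, mul_ite, ite_mul, mul_one, mul_zero, one_mul,
      zero_mul, Finset.sum_ite_eq, Finset.sum_ite_eq', Finset.mem_univ, if_true, Finset.sum_ite_irrel, Finset.sum_const_zero]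
    rw [sum5]
    refine Finset.sum_congr rfl fun _ _ => Finset.sum_congr rfl fun _ _ => Finset.sum_congr rfl fun _ _ =>
      Finset.sum_congr rfl fun _ _ => Finset.sum_congr rfl fun _ _ => ?_
    ring
  have := congrFun (congrFun this e) e'
  simpa [N, sub_eq_zero] using this

theorem IsSym.star {q : L} {R S : M (ι × ι) L} (h : IsSym q R S) {C : M ι L} (hC : hat S C = 1)
    (X : M ι L) : ∃ Λ : M ι L, Λ.trace = X.trace ∧ hat R Λ = X * C := by
  refine ⟨Matrix.of fun a2 a1 => ∑ d, ∑ e, ∑ a, X d e * S (a2, e) (a, d) * C a a1, ?_, ?_⟩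
  · have h1 : ∀ e d, ∑ a, ∑ a1, C a a1 * S (a1, e) (a, d) = (1 : M ι L) e d := by
      intro e d; rw [← hC]; rfl
    have h2 : X.trace = ∑ d, ∑ e, X d e * (1 : M ι L) e d := by
      simp only [← Matrix.mul_apply, mul_one]; rfl
    rw [h2]
    simp only [← h1, Matrix.trace, diag_apply, of_apply, Finset.mul_sum]
    rw [Finset.sum_comm]
    refine Finset.sum_congr rfl fun d _ => ?_
    rw [Finset.sum_comm]
    refine Finset.sum_congr rfl fun e _ => ?_
    rw [Finset.sum_comm]
    refine Finset.sum_congr rfl fun a _ => Finset.sum_congr rfl fun a1 _ => ?_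
    ring
  · ext b e'
    have h2 : ∀ b e', (X * C) b e' = ∑ d, ∑ e, X d e * ((1 : M ι L) b d * C e e') := by
      intro b e'; simp [Matrix.mul_apply, Matrix.one_apply]
    rw [h2]
    simp only [← h.star_aux hC, hat_def, ptr_apply, of_apply, Finset.mul_sum, Finset.sum_mul]
    rw [Finset.sum_comm]
    -- ∑ a1 a2 d e a  vs ∑ d e a a1 a2
    rw [sum5 (fun a1 a2 d e a => X d e * S (a2, e) (a, d) * C a a1 * R (a1, b) (a2, e'))]
    refine Finset.sum_congr rfl fun _ _ => Finset.sum_congr rfl fun _ _ => Finset.sum_congr rfl fun _ _ =>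
      Finset.sum_congr rfl fun _ _ => Finset.sum_congr rfl fun _ _ => ?_
    ring

variable {L : Type} [Field L] {ι : Type} [Fintype ι] [LinearOrder ι]

namespace Std
variable (q : L) (ε : ι → L)

def al (i j : ι) : L := if i = j then ε i else if j < i then 0 else q - 1
def be (i j : ι) : L := if i = j then 0 else if j < i then 1 else q

def R : M (ι × ι) L := Matrix.of fun p p' =>
  al q ε p'.1 p'.2 * (if p = p' then 1 else 0) + be q p'.1 p'.2 * (if p = p'.swap then 1 else 0)

theorem R_single (i j : ι) : R q ε *ᵥ Pi.single (i, j) 1 =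
    al q ε i j • Pi.single (i, j) (1 : L) + be q i j • Pi.single (j, i) (1 : L) := by
  ext p
  simp [R, Pi.single_apply]

theorem FR_single (i j k : ι) : F ι (R q ε) *ᵥ Pi.single (i, j, k) 1 =
    al q ε i j • Pi.single (i, j, k) (1 : L) + be q i j • Pi.single (j, i, k) (1 : L) := by
  ext ⟨a, b, c⟩
  simp [R, Pi.single_apply, F_apply, Matrix.one_apply, add_mul, ite_and]
  split_ifs <;> simp_all

theorem sR_single (i j k : ι) : (sM (R q ε) : M (ι × ι × ι) L) *ᵥ Pi.single (i, j, k) 1 =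
    al q ε j k • Pi.single (i, j, k) (1 : L) + be q j k • Pi.single (i, k, j) (1 : L) := by
  ext ⟨a, b, c⟩
  simp [R, Pi.single_apply, sM_def, Matrix.one_apply, add_mul, ite_and]
  split_ifs <;> simp_all

variable (hε : ∀ i, ε i * ε i = (q - 1) * ε i + q)
include hε

theorem isHecke : IsHecke q (R q ε) where
  quad := by
    apply Matrix.ext_of_mulVec_single
    rintro ⟨i, j⟩
    have h1 : al q ε i j * al q ε i j + be q i j * be q j i = (q-1) * al q ε i j + q := by
      simp only [al, be]
      rcases lt_trichotomy i j with h | h | h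
      · simp [h.ne, h.ne', h.not_gt, h]
      · subst h; simp [hε]
      · simp [h.ne, h.ne', h.not_gt, h]
    have h2 : be q i j * (al q ε i j + al q ε j i - (q-1)) = 0 := by
      simp only [al, be]
      rcases lt_trichotomy i j with h | h | h
      · simp [h.ne, h.ne', h.not_gt, h]
      · subst h; simp
      · simp [h.ne, h.ne', h.not_gt, h]
    simp only [← mulVec_mulVec, R_single, mulVec_add, mulVec_smul, add_mulVec, smul_mulVec, one_mulVec]
    generalize (Pi.single (i, j) (1:L) : ι × ι → L) = u
    generalize (Pi.single (j, i) (1:L) : ι × ι → L) = v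
    linear_combination (norm := module) h1 • u + h2 • v
  braid := by
    apply Matrix.ext_of_mulVec_single
    rintro ⟨i, j, k⟩
    have h1 : al q ε i j * al q ε i j * al q ε j k + al q ε i k * be q i j * be q j i =
        al q ε j k * al q ε j k * al q ε i j + al q ε i k * be q j k * be q k j := by
      simp only [al, be]
      rcases lt_trichotomy i j with h | h | h <;> rcases lt_trichotomy j k with h' | h' | h' <;>
      rcases lt_trichotomy i k with h'' | h'' | h'' <;>
      first
      | (exfalso; order)
      | (simp [h, h', h'', h.ne, h'.ne, h''.ne, h.ne', h'.ne', h''.ne', not_lt_of_gt h, not_lt_of_gt h', not_lt_of_gt h'']; done)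
      | (simp [h, h', h'', h.ne, h'.ne, h''.ne, h.ne', h'.ne', h''.ne', not_lt_of_gt h, not_lt_of_gt h', not_lt_of_gt h'']; ring)
      | (subst h; simp [h', h'.ne, h'.ne', not_lt_of_gt h']; try linear_combination (q-1) * hε i)
      | (subst h'; simp [h, h.ne, h.ne', not_lt_of_gt h] <;> first | (right; ring) | linear_combination -(q-1) * hε j)
      | (subst h''; simp [h, h.ne, h.ne', not_lt_of_gt h]; try ring)
      | (subst h; subst h'; simp)
    have h2 : be q i j * (al q ε i j * al q ε j k + al q ε i k * al q ε j i - al q ε j k * al q ε i k) = 0 := by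
      simp only [al, be]
      rcases lt_trichotomy i j with h | h | h <;> rcases lt_trichotomy j k with h' | h' | h' <;>
      rcases lt_trichotomy i k with h'' | h'' | h'' <;>
      first
      | (exfalso; order)
      | (simp [h, h', h'', h.ne, h'.ne, h''.ne, h.ne', h'.ne', h''.ne', not_lt_of_gt h, not_lt_of_gt h', not_lt_of_gt h'']; done)
      | (simp [h, h', h'', h.ne, h'.ne, h''.ne, h.ne', h'.ne', h''.ne', not_lt_of_gt h, not_lt_of_gt h', not_lt_of_gt h'']; ring)
      | (subst h; simp [h', h'.ne, h'.ne', not_lt_of_gt h']; try linear_combination (q-1) * hε i)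
      | (subst h'; simp [h, h.ne, h.ne', not_lt_of_gt h] <;> first | (right; ring) | linear_combination -(q-1) * hε j)
      | (subst h''; simp [h, h.ne, h.ne', not_lt_of_gt h]; try ring)
      | (subst h; subst h'; simp)
    have h3 : be q j k * (al q ε i j * al q ε i k - al q ε i j * al q ε j k - al q ε i k * al q ε k j) = 0 := by
      simp only [al, be]
      rcases lt_trichotomy i j with h | h | h <;> rcases lt_trichotomy j k with h' | h' | h' <;>
      rcases lt_trichotomy i k with h'' | h'' | h'' <;>
      first
      | (exfalso; order)
      | (simp [h, h', h'', h.ne, h'.ne, h''.ne, h.ne', h'.ne', h''.ne', not_lt_of_gt h, not_lt_of_gt h', not_lt_of_gt h'']; done)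
      | (simp [h, h', h'', h.ne, h'.ne, h''.ne, h.ne', h'.ne', h''.ne', not_lt_of_gt h, not_lt_of_gt h', not_lt_of_gt h'']; ring)
      | (subst h; simp [h', h'.ne, h'.ne', not_lt_of_gt h']; try linear_combination (q-1) * hε i)
      | (subst h'; simp [h, h.ne, h.ne', not_lt_of_gt h] <;> first | (right; ring) | linear_combination -(q-1) * hε j)
      | (subst h''; simp [h, h.ne, h.ne', not_lt_of_gt h]; try ring)
      | (subst h; subst h'; simp)
    simp only [← mulVec_mulVec, FR_single, sR_single, mulVec_add, mulVec_smul]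
    generalize (Pi.single (i, j, k) (1:L) : ι × ι × ι → L) = u
    generalize (Pi.single (j, i, k) (1:L) : ι × ι × ι → L) = v
    generalize (Pi.single (i, k, j) (1:L) : ι × ι × ι → L) = w
    generalize (Pi.single (j, k, i) (1:L) : ι × ι × ι → L) = u2
    generalize (Pi.single (k, i, j) (1:L) : ι × ι × ι → L) = v2
    generalize (Pi.single (k, j, i) (1:L) : ι × ι × ι → L) = w2
    linear_combination (norm := module) h1 • u + h2 • v + h3 • w

omit hε
def S : M (ι × ι) L := q⁻¹ • (R q ε - (q-1) • 1)

theorem hat_R_ne (Z : M ι L) {b d : ι} (h : b ≠ d) : hat (R q ε) Z b d = Z b d * be q b d := by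
  simp only [hat_def, ptr_apply, R, of_apply, Prod.swap, Prod.mk.injEq, mul_add, Finset.sum_add_distrib]
  simp [ite_and, h]

theorem hat_R_eq (Z : M ι L) (b : ι) : hat (R q ε) Z b b = ∑ a, Z a a * al q ε a b := by
  simp only [hat_def, ptr_apply, R, of_apply, Prod.swap, Prod.mk.injEq, mul_add, Finset.sum_add_distrib]
  simp [ite_and, be]

theorem hat_one {ι : Type} [Fintype ι] [DecidableEq ι] (Z : M ι L) : hat (1 : M (ι × ι) L) Z = Z.trace • (1 : M ι L) := by
  rw [hat_def, ← one_kronecker_one, ptr_kron, mul_one]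

include hε
theorem isSym (hq : q ≠ 0) : IsSym q (R q ε) (S q ε) where
  toIsHecke := isHecke q ε hε
  RS := by
    rw [S, mul_smul_comm, mul_sub, (isHecke q ε hε).quad, mul_smul_comm, mul_one, add_sub_cancel_left, smul_smul,
      inv_mul_cancel₀ hq, one_smul]
  SR := by
    rw [S, smul_mul_assoc, sub_mul, (isHecke q ε hε).quad, smul_mul_assoc, one_mul, add_sub_cancel_left, smul_smul,
      inv_mul_cancel₀ hq, one_smul]
  inj := by
    intro Z hZ
    have hS : hat (S q ε) Z = q⁻¹ • (hat (R q ε) Z - ((q-1) * Z.trace) • (1 : M ι L)) := by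
      rw [← smul_smul, ← hat_one]
      simp only [hat_def, S, map_smul, map_sub]
    rw [hS, smul_eq_zero_iff_right (inv_ne_zero hq), sub_eq_zero] at hZ
    have hne : ∀ b d, b ≠ d → Z b d = 0 := by
      intro b d hbd
      have := congrFun (congrFun hZ b) d
      rw [hat_R_ne _ _ _ hbd] at this
      simp [Matrix.one_apply_ne hbd] at this
      refine this.resolve_right ?_
      simp only [be, if_neg hbd]; split_ifs <;> simp [hq]
    have hd : ∀ b, Z b b = 0 := by
      intro b
      induction b using WellFoundedGT.induction with
      | ind b ih =>
      have := congrFun (congrFun hZ b) b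
      rw [hat_R_eq] at this
      simp only [Matrix.smul_apply, Matrix.one_apply_eq, smul_eq_mul, mul_one, Matrix.trace, diag_apply] at this
      rw [Finset.mul_sum, ← sub_eq_zero, ← Finset.sum_sub_distrib, Finset.sum_eq_single b] at this
      · have h3 : Z b b * (ε b - (q-1)) = 0 := by
          rw [← this, al, if_pos rfl]; ring
        have h4 : ε b * (ε b - (q - 1)) = q := by linear_combination hε b
        refine (mul_eq_zero.1 h3).resolve_right fun h => hq ?_
        rw [← h4, h, mul_zero]
      · intro a _ hab
        rcases lt_or_gt_of_ne hab with h | h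
        · simp [al, hab, h.not_gt]; ring
        · simp [ih a h]
      · simp
    ext b d
    by_cases h : b = d
    · subst h; exact hd b
    · exact hne b d h

omit hε
theorem diag_comm (g : ι → L) : R q ε * (diagonal g ⊗ₖ diagonal g) = (diagonal g ⊗ₖ diagonal g) * R q ε := by
  rw [diagonal_kronecker_diagonal]
  ext ⟨a, b⟩ ⟨c, d⟩
  rw [Matrix.mul_diagonal, Matrix.diagonal_mul]
  simp only [R, of_apply, Prod.swap, Prod.mk.injEq]
  split_ifs with h1 h2 h2
  · obtain ⟨rfl, rfl⟩ := h1; ring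
  · obtain ⟨rfl, rfl⟩ := h1; ring
  · obtain ⟨rfl, rfl⟩ := h2; ring
  · ring

theorem hat_diag (v : ι → L) : hat (R q ε) (diagonal v) = diagonal fun b => ∑ a, v a * al q ε a b := by
  ext b d
  by_cases h : b = d
  · subst h; rw [hat_R_eq]; simp
  · rw [hat_R_ne _ _ _ h]; simp [h]

end Std

namespace Std
variable {L : Type} [Field L] 

theorem ps_lemma (A : Type) [CommRing A] (q X : A) : ∀ (r : ℕ) (ε g V : Fin r → A)
    (hV : ∀ i, V i = g i * (1 + X * (ε i * V i + (q-1) * ∑ a, if a < i then V a else 0))),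
    (1 + (q-1) * X * ∑ i, V i) * ∏ i, (1 - ε i * g i * X) = ∏ i, (1 - ε i * g i * X + (q-1) * g i * X)
  | 0, ε, g, V, _ => by simp
  | r+1, ε, g, V, hV => by
    have ih := ps_lemma A q X r (fun i => ε i.castSucc) (fun i => g i.castSucc) (fun i => V i.castSucc) (by
      intro i
      have h1 := hV i.castSucc
      simp only [Fin.sum_univ_castSucc (n := r), Fin.castSucc_lt_castSucc_iff] at h1
      have h0 : ¬ (Fin.last r < i.castSucc) := by simp [Fin.le_last]
      rw [if_neg h0, add_zero] at h1
      exact h1)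
    have hl := hV (Fin.last r)
    simp only [Fin.sum_univ_castSucc (n := r), Fin.castSucc_lt_last, if_true, lt_irrefl, if_false, add_zero] at hl
    rw [Fin.sum_univ_castSucc, Fin.prod_univ_castSucc, Fin.prod_univ_castSucc, ← ih]
    linear_combination (q-1) * X * (∏ i : Fin r, (1 - ε i.castSucc * g i.castSucc * X)) * hl

theorem std_series (q : L) (r : ℕ) (ε g : Fin r → L) :
    (1 + PowerSeries.C (q-1) * PowerSeries.X *
      PowerSeries.mk (fun k => (W (diagonal g) (R q ε) k).trace)) *
      ∏ i, (1 - PowerSeries.C (ε i * g i) * PowerSeries.X) =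
    ∏ i, (1 - PowerSeries.C (ε i * g i) * PowerSeries.X + PowerSeries.C ((q-1) * g i) * PowerSeries.X) := by
  obtain ⟨w, hw⟩ : ∃ w : ℕ → Fin r → L, ∀ k, W (diagonal g) (R q ε) k = diagonal (w k) := by
    have : ∀ k, ∃ w : Fin r → L, W (diagonal g) (R q ε) k = diagonal w := by
      intro k
      induction k with
      | zero => exact ⟨g, rfl⟩
      | succ k ih =>
        obtain ⟨w, hw⟩ := ih
        refine ⟨fun b => (∑ a, w a * al q ε a b) * g b, ?_⟩
        rw [W, hw, hat_diag, diagonal_mul_diagonal]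
    choose w hw using this
    exact ⟨w, hw⟩
  have hw0 : w 0 = g := diagonal_injective (hw 0).symm
  have hws : ∀ k b, w (k+1) b = (∑ a, w k a * al q ε a b) * g b := by
    intro k b
    have := hw (k+1)
    rw [W, hw, hat_diag, diagonal_mul_diagonal] at this
    exact (congrFun (diagonal_injective this) b).symm
  let V : Fin r → PowerSeries L := fun i => PowerSeries.mk fun k => w k i
  have hV : PowerSeries.mk (fun k => (W (diagonal g) (R q ε) k).trace) = ∑ i, V i := by
    ext k
    rw [map_sum]
    simp [hw, V, Matrix.trace_diagonal]
  rw [hV]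
  have := ps_lemma (PowerSeries L) (PowerSeries.C q) PowerSeries.X r (fun i => PowerSeries.C (ε i))
    (fun i => PowerSeries.C (g i)) V ?_
  · simpa only [map_sub, map_mul, map_one] using this
  · intro i
    have h1 : V i = PowerSeries.C (g i) * (1 + PowerSeries.X * ∑ a, PowerSeries.C (al q ε a i) * V a) := by
      ext k
      rw [PowerSeries.coeff_C_mul, map_add]
      cases k with
      | zero => simp [V, hw0]
      | succ k =>
        rw [PowerSeries.coeff_succ_X_mul, map_sum]
        simp [V, hws, PowerSeries.coeff_one, mul_comm]
    conv_lhs => rw [h1]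
    congr 3
    rw [← Finset.add_sum_erase _ _ (Finset.mem_univ i)]
    congr 1
    · simp [al]
    · rw [Finset.mul_sum, ← Finset.sum_erase (Finset.univ) (a := i) (by simp)]
      refine Finset.sum_congr rfl fun a ha => ?_
      have ha : a ≠ i := (Finset.mem_erase.1 ha).1
      simp only [al, if_neg ha]
      rcases lt_or_gt_of_ne ha with h | h
      · simp [h, h.not_gt]
      · simp [h, h.not_gt]
end Std

namespace Wr
variable {L : Type} [Field L] {q : L}

abbrev RW (q : L) (r : ℕ) : M (Fin (r+1) × Fin (r+1)) L := Std.R q (fun _ => q)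

def low (N : ℕ) {r : ℕ} : ∀ {n : ℕ}, I (Fin (r+1)) n → Prop
  | 0, _ => True
  | n+1, u => (u.1 : Fin (r+1)).val < N ∧ low N (n := n) u.2

def wd (r : ℕ) : ∀ n, I (Fin (r+1)) n
  | 0 => ()
  | n+1 => (Fin.ofNat (r+1) n, wd r n)

theorem wd_low (r : ℕ) : ∀ n N, n ≤ N → n ≤ r + 1 → low N (wd r n)
  | 0, N, _, _ => trivial
  | n+1, N, h, h' => ⟨by show n % (r+1) < N; rw [Nat.mod_eq_of_lt (by omega)]; omega, wd_low r n N (by omega) (by omega)⟩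

def Pres (N : ℕ) {r n : ℕ} (X : M (I (Fin (r+1)) n) L) : Prop := ∀ u v, low N v → ¬ low N u → X u v = 0

theorem Pres.mul {N r n : ℕ} {X Y : M (I (Fin (r+1)) n) L} (hX : Pres N X) (hY : Pres N Y) : Pres N (X * Y) := by
  intro u v hv hu
  rw [Matrix.mul_apply]
  refine Finset.sum_eq_zero fun x _ => ?_
  by_cases hx : low N x
  · rw [hX u x hx hu, zero_mul]
  · rw [hY x v hv hx, mul_zero]

theorem Pres.sI {N r n : ℕ} {X : M (I (Fin (r+1)) n) L} (hX : Pres N X) : Pres N (sI X) := by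
  rintro ⟨a, u⟩ ⟨b, v⟩ hv hu
  show (1 : M (Fin (r+1)) L) a b * X u v = 0
  by_cases h : a = b
  · subst h
    rw [hX u v hv.2 (fun h => hu ⟨hv.1, h⟩), mul_zero]
  · rw [Matrix.one_apply_ne h, zero_mul]

theorem Pres.FI (N r n : ℕ) : Pres N (FI n (RW q r)) := by
  rintro ⟨a, b, u⟩ ⟨a', b', v⟩ ⟨h1, h2, hv⟩ hu
  show RW q r (a, b) (a', b') * (1 : M (I (Fin (r+1)) n) L) u v = 0
  by_cases h : u = v
  · subst h
    simp only [RW, Std.R, Matrix.of_apply, Prod.swap]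
    rw [if_neg, if_neg]
    · simp
    · intro h; obtain ⟨rfl, rfl⟩ := Prod.mk.injEq .. ▸ h; exact hu ⟨h2, h1, hv⟩
    · intro h; obtain ⟨rfl, rfl⟩ := Prod.mk.injEq .. ▸ h; exact hu ⟨h1, h2, hv⟩
  · rw [Matrix.one_apply_ne h, mul_zero]

variable {A : ℕ → Type} [∀ n, Ring (A n)]
    [∀ n, Algebra L (A n)] {t : HTower L q A}

theorem Pres.scalar (N r n : ℕ) (c : L) : Pres N (algebraMap L (M (I (Fin (r+1)) n) L) c) := by
  intro u v hv hu
  have : u ≠ v := by rintro rfl; exact hu hv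
  rw [Matrix.algebraMap_matrix_apply, if_neg this]

theorem pres (r N : ℕ) (ρ : HRep t (RW q r)) : ∀ n, ∀ h ∈ t.H n, Pres N (ρ.π n h)
  | 0, h, hh => by
      obtain ⟨c, rfl⟩ := t.H_zero hh
      rw [AlgHom.commutes]; exact Pres.scalar _ _ _ _
  | 1, h, hh => by
      obtain ⟨c, rfl⟩ := t.H_one hh
      rw [AlgHom.commutes]; exact Pres.scalar _ _ _ _
  | n+2, h, hh => by
      refine t.H_ind (P := fun h => Pres N (ρ.π (n+2) h)) hh ?_ ?_ ?_ ?_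
      · intro a ha; rw [ρ.pis]; exact (pres r N ρ _ a ha).sI
      · intro a ha b hb
        rw [ρ.pisTs]
        exact ((pres r N ρ _ a ha).sI.mul (Pres.FI _ _ _)).mul (pres r N ρ _ b hb).sI
      · intro x y hx hy u v hu hv
        rw [map_add, Matrix.add_apply, hx u v hu hv, hy u v hu hv, add_zero]
      · intro c x hx u v hu hv
        rw [map_smul, Matrix.smul_apply, hx u v hu hv, smul_zero]

def tau (r : ℕ) (ρ : HRep t (RW q r)) (n : ℕ) : A n →ₗ[L] L :=
  (LinearMap.proj (wd r n)) ∘ₗ (LinearMap.proj (R := L) (φ := fun _ => I (Fin (r+1)) n → L) (wd r n)) ∘ₗ (ρ.π n).toLinearMap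

theorem tau_apply (r : ℕ) (ρ : HRep t (RW q r)) (n : ℕ) (a : A n) : tau r ρ n a = ρ.π n a (wd r n) (wd r n) := rfl

theorem entry_pt {r n : ℕ} (k : Fin (r+1)) (X : M (I (Fin (r+1)) (n+1)) L) (u v : I (Fin (r+1)) n) :
    X (k, u) (k, v) = pt (diagonal (Pi.single k 1)) X u v := by
  show _ = ∑ i, ∑ j, (diagonal (Pi.single k 1) : M (Fin (r+1)) L) i j * X (j, u) (i, v)
  rw [Finset.sum_eq_single k, Finset.sum_eq_single k]
  · simp
  · intro b _ hb; simp [Matrix.diagonal_apply, hb.symm]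
  · simp
  · intro b _ hb; refine Finset.sum_eq_zero fun j _ => ?_
    simp only [Matrix.diagonal_apply, Pi.single_apply, if_neg hb]; simp
  · simp

theorem tau_s (r : ℕ) (ρ : HRep t (RW q r)) (n : ℕ) (a : A n) : tau r ρ (n+1) (t.s n a) = tau r ρ n a := by
  rw [tau_apply, tau_apply, ρ.pis]
  refine (entry_pt (Fin.ofNat (r+1) n) (sI (ρ.π n a)) (wd r n) (wd r n)).trans ?_
  rw [pt_sI]
  simp [Matrix.trace_diagonal]

theorem tau_sTs (r : ℕ) (ρ : HRep t (RW q r)) (n : ℕ) (hn : n + 2 ≤ r + 1) (a b : A (n+1)) (hb : b ∈ t.H (n+1)) : 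
    tau r ρ (n+2) (t.s _ a * t.T n * t.s _ b) = 0 := by
  rw [tau_apply, ρ.pisTs]
  refine (entry_pt (Fin.ofNat (r+1) (n+1)) _ (wd r (n+1)) (wd r (n+1))).trans ?_
  rw [pt_key, Std.hat_diag, mul_assoc, Matrix.mul_apply]
  refine Finset.sum_eq_zero fun x _ => ?_
  refine mul_eq_zero_of_right _ ?_
  have hd : kr (diagonal fun b => ∑ a, (Pi.single (Fin.ofNat (r+1) (n+1)) 1 : Fin (r+1) → L) a * Std.al q (fun _ => q) a b) (1 : M (I (Fin (r+1)) n) L)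
      = diagonal (fun x : I (Fin (r+1)) (n+1) => Std.al q (fun _ => q) (Fin.ofNat (r+1) (n+1)) x.1) := by
    have h1 : ∀ b, ∑ a, (Pi.single (Fin.ofNat (r+1) (n+1)) 1 : Fin (r+1) → L) a * Std.al q (fun _ => q) a b = 
        Std.al q (fun _ => q) (Fin.ofNat (r+1) (n+1)) b := by
      intro b
      rw [Finset.sum_eq_single (Fin.ofNat (r+1) (n+1))]
      · simp
      · intro c _ hc; rw [Pi.single_eq_of_ne hc, zero_mul]
      · simp
    simp only [h1]
    show (diagonal _ ⊗ₖ (1 : M (I (Fin (r+1)) n) L) : M (Fin (r+1) × I (Fin (r+1)) n) L) = _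
    rw [← diagonal_one, diagonal_kronecker_diagonal]
    simp only [mul_one]; rfl
  rw [hd, Matrix.diagonal_mul]
  by_cases hx : low (n+1) x
  · obtain ⟨h1, -⟩ := hx
    have h2 : (Fin.ofNat (r+1) (n+1)).val = n + 1 := Nat.mod_eq_of_lt (by omega)
    have h3 : (x.1 : Fin (r+1)) < Fin.ofNat (r+1) (n+1) := by rw [Fin.lt_def, h2]; exact h1
    rw [Std.al, if_neg h3.ne', if_pos h3, zero_mul]
  · rw [pres r (n+1) ρ _ b hb x _ (wd_low r (n+1) (n+1) le_rfl (by omega)) hx, mul_zero]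

theorem tau_Q (r : ℕ) (ρ : HRep t (RW q r)) : ∀ (n : ℕ) (hn : n + 1 ≤ r + 1), ∀ p ∈ t.Q' n, tau r ρ (n+1) p = 0
  | 0, _, p, hp => by rw [(Submodule.mem_bot L).1 hp, map_zero]
  | n+1, hn, p, hp => by
    induction hp using Submodule.span_induction with
    | mem x hx => obtain ⟨a, ha, b, hb, rfl⟩ := hx; exact tau_sTs r ρ n (by omega) a b hb
    | zero => rw [map_zero]
    | add x y _ _ hx hy => rw [map_add, hx, hy, add_zero]
    | smul c x _ hx => rw [map_smul, hx, smul_zero]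

def gC (q : L) (r : ℕ) : M (Fin (r+1)) L := diagonal fun j => (q⁻¹) ^ (j.val + 1)

theorem hat_gC (hq : q ≠ 0) (r : ℕ) : hat (RW q r) (gC q r) = 1 := by
  rw [gC, Std.hat_diag, ← diagonal_one]
  congr 1; funext b
  have key : ∀ n : ℕ, (q - 1) * ∑ a ∈ Finset.range n, (q⁻¹) ^ (a+1) = 1 - q⁻¹ ^ n := by
    intro n
    induction n with
    | zero => simp
    | succ n ih => rw [Finset.sum_range_succ, mul_add, ih, pow_succ]; linear_combination (q⁻¹^n) * mul_inv_cancel₀ hq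
  have h1 : ∑ a : Fin (r+1), q⁻¹ ^ (a.val+1) * Std.al q (fun _ => q) a b =
      ∑ a ∈ Finset.range (r+1), (if a < b.val then q⁻¹ ^ (a+1) * (q-1) else if a = b.val then q⁻¹ ^ (a + 1) * q else 0) := by
    rw [Finset.sum_range]
    refine Finset.sum_congr rfl fun a _ => ?_
    simp only [Std.al, Fin.lt_def, Fin.ext_iff]
    split_ifs <;> first | rfl | omega | simp
  rw [h1, ← Finset.sum_range_add_sum_Ico _ (show b.val ≤ r + 1 by omega), Finset.sum_eq_sum_Ico_succ_bot (by omega)]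
  rw [Finset.sum_congr rfl (g := fun a => q⁻¹ ^ (a+1) * (q-1)) (fun a ha => if_pos (Finset.mem_range.1 ha)),
    ← Finset.sum_mul, mul_comm, key, if_neg (lt_irrefl _), if_pos rfl, Finset.sum_eq_zero]
  · rw [pow_succ, add_zero, mul_assoc, inv_mul_cancel₀ hq]; simp
  · intro a ha
    rw [Finset.mem_Ico] at ha
    rw [if_neg (by omega), if_neg (by omega)]

theorem gC_trace (hq : q ≠ 0) (r : ℕ) : (q-1) * (gC q r).trace = 1 - q⁻¹ ^ (r+1) := by
  have key : ∀ n : ℕ, (q - 1) * ∑ a ∈ Finset.range n, (q⁻¹) ^ (a+1) = 1 - q⁻¹ ^ n := by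
    intro n
    induction n with
    | zero => simp
    | succ n ih => rw [Finset.sum_range_succ, mul_add, ih, pow_succ]; linear_combination (q⁻¹^n) * mul_inv_cancel₀ hq
  rw [← key, gC, trace_diagonal, Finset.sum_range]

theorem gC_inj (hq : q ≠ 0) (hq1 : ∀ n : ℕ, n ≠ 0 → q ^ n ≠ 1) : Function.Injective fun r => (gC q r).trace := by
  intro r r' h
  have h2 : q⁻¹ ^ (r+1) = q⁻¹ ^ (r'+1) := by
    have := congrArg (fun x => (q-1) * x) h
    simp only [gC_trace hq] at this
    exact sub_right_injective this
  have hq' : ∀ n : ℕ, n ≠ 0 → q⁻¹ ^ n ≠ 1 := by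
    intro n hn h; rw [inv_pow, inv_eq_one] at h; exact hq1 n hn h
  wlog hlt : r < r' generalizing r r'
  · by_contra hne
    exact hne (this h.symm h2.symm (by omega)).symm
  · exfalso
    obtain ⟨k, rfl⟩ := Nat.exists_eq_add_of_lt hlt
    rw [show r + k + 1 + 1 = (r + 1) + (k+1) by omega, pow_add q⁻¹ (r+1) (k+1)] at h2
    refine hq' (k+1) (by omega) ?_
    have h3 : q⁻¹ ^ (r+1) ≠ 0 := pow_ne_zero _ (inv_ne_zero hq)
    exact mul_left_cancel₀ h3 (h2.symm.trans (mul_one _).symm)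

theorem poly (hq : q ≠ 0) (ρ : ∀ r, HRep t (RW q r)) : ∀ n, ∀ h ∈ t.H n, ∃ p : L[X],
    p.natDegree ≤ n ∧ (∀ r, (ρ r).phi (gC q r) n h = p.eval (gC q r).trace) ∧
      ∀ r, n ≤ r + 1 → tau r (ρ r) n h = p.coeff n
  | 0, h, hh => by
      obtain ⟨c, rfl⟩ := t.H_zero hh
      refine ⟨C c, by simp, fun r => by rw [HRep.phi_algebraMap0]; simp, fun r _ => ?_⟩
      rw [tau_apply, AlgHom.commutes, Matrix.algebraMap_matrix_apply, if_pos rfl]; simp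
  | 1, h, hh => by
      obtain ⟨c, rfl⟩ := t.H_one hh
      refine ⟨C c * X, (natDegree_C_mul_le _ _).trans natDegree_X_le, fun r => ?_, fun r _ => ?_⟩
      · rw [Algebra.algebraMap_eq_smul_one, HRep.phi_smul, ← HRep.chi_zero, HRep.chi_one]; simp [W]
      · rw [tau_apply, AlgHom.commutes, Matrix.algebraMap_matrix_apply, if_pos rfl]; simp
  | n+2, h, hh => by
      refine t.H_ind (P := fun h => ∃ p : L[X], p.natDegree ≤ n+2 ∧ 
        (∀ r, (ρ r).phi (gC q r) (n+2) h = p.eval (gC q r).trace) ∧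
        ∀ r, n + 2 ≤ r + 1 → tau r (ρ r) (n+2) h = p.coeff (n+2)) hh ?_ ?_ ?_ ?_
      · intro a ha
        obtain ⟨p, h1, h2, h3⟩ := poly hq ρ (n+1) a ha
        refine ⟨X * p, ?_, fun r => ?_, fun r hr => ?_⟩
        · refine natDegree_mul_le.trans ?_
          have := natDegree_X_le (R := L); omega
        · rw [← HRep.chi_zero, HRep.chi_s, HRep.chi_zero, h2]; simp [W]
        · rw [tau_s, h3 r (by omega), coeff_X_mul]
      · intro a ha b hb
        obtain ⟨p, h1, h2, h3⟩ := poly hq ρ (n+1) (a * b) ((t.H _).mul_mem ha hb)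
        refine ⟨p, by omega, fun r => ?_, fun r hr => ?_⟩
        · rw [← h2, HRep.phi, HRep.phi, HRep.pisTs, gp, trace_kr_mul, pt_key, hat_gC hq, kr_one, mul_one, map_mul]
        · rw [tau_sTs r _ n hr a b hb, coeff_eq_zero_of_natDegree_lt (by omega)]
      · rintro x y ⟨p, h1, h2, h3⟩ ⟨p', h1', h2', h3'⟩
        refine ⟨p + p', (natDegree_add_le _ _).trans (max_le h1 h1'), fun r => ?_, fun r hr => ?_⟩
        · rw [HRep.phi_add, h2, h2', eval_add]
        · rw [map_add, h3 r hr, h3' r hr, coeff_add]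
      · rintro c x ⟨p, h1, h2, h3⟩
        refine ⟨c • p, (natDegree_smul_le _ _).trans h1, fun r => ?_, fun r hr => ?_⟩
        · rw [HRep.phi_smul, h2, eval_smul, smul_eq_mul]
        · rw [map_smul, h3 r hr, coeff_smul]

theorem tau_eq_zero (hq : q ≠ 0) (hq1 : ∀ n : ℕ, n ≠ 0 → q ^ n ≠ 1) (ρ : ∀ r, HRep t (RW q r)) (n : ℕ) 
    (h : A n) (hh : h ∈ t.H n) (h0 : ∀ r, (ρ r).phi (gC q r) n h = 0) (r : ℕ) (hr : n ≤ r + 1) :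
    tau r (ρ r) n h = 0 := by
  obtain ⟨p, h1, h2, h3⟩ := poly hq ρ n h hh
  have : p = 0 := by
    apply Polynomial.eq_zero_of_infinite_isRoot
    refine Set.Infinite.mono ?_ (Set.infinite_range_of_injective (gC_inj hq hq1))
    rintro _ ⟨r, rfl⟩
    exact (h2 r).symm.trans (h0 r)
  rw [h3 r hr, this, coeff_zero]
end Wr

section idem
variable {L : Type} [Field L] [CharZero L] {κ : Type} [Fintype κ] [DecidableEq κ]

theorem trace_idem (e : M κ L) (he : e * e = e) : e.trace = (e.rank : L) := by
  have h1 : IsIdempotentElem (Matrix.toLin' e) := by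
    show _ * _ = _
    rw [Module.End.mul_eq_comp, ← Matrix.toLin'_mul, he]
  have h2 := LinearMap.IsProj.trace (LinearMap.isProj_range_iff_isIdempotentElem _ |>.2 h1)
  rw [Matrix.trace_toLin'_eq] at h2
  rw [h2, Matrix.rank_eq_finrank_range_toLin e (Pi.basisFun L κ) (Pi.basisFun L κ)]
  rfl

theorem rank_zero (e : M κ L) (h : e.rank = 0) : e = 0 := by
  rw [Matrix.rank, Submodule.finrank_eq_zero, LinearMap.range_eq_bot] at h
  ext u v
  have := congrFun (LinearMap.congr_fun h (Pi.single v 1)) u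
  simpa using this

theorem idem_zero (e : M κ L) (he : e * e = e) (h : e.trace = 0) : e = 0 := by
  rw [trace_idem e he] at h
  exact rank_zero e (by exact_mod_cast h)

theorem idem_zero' (f : ℝ →+* L) (w : κ → ℝ) (hw : ∀ u, 0 < w u) (e : M κ L) (he : e * e = e)
    (hc : e * diagonal (fun u => f (w u)) = diagonal (fun u => f (w u)) * e)
    (h : (diagonal (fun u => f (w u)) * e).trace = 0) : e = 0 := by
  classical
  have h1 : ∀ u v, w u ≠ w v → e u v = 0 := by
    intro u v huv
    have := congrFun (congrFun hc u) v
    rw [mul_diagonal, diagonal_mul, mul_comm] at this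
    by_contra h0
    exact huv (f.injective (mul_right_cancel₀ h0 this)).symm
  let P : ℝ → M κ L := fun l => diagonal (fun u => if w u = l then 1 else 0)
  have hPc : ∀ l, e * P l = P l * e := by
    intro l
    ext u v
    rw [mul_diagonal, diagonal_mul]
    by_cases huv : w u = w v
    · rw [huv, mul_comm]
    · rw [h1 u v huv]; simp
  have hPP : ∀ l, P l * P l = P l := by
    intro l; simp [P]
  have hPi : ∀ l, (P l * e) * (P l * e) = P l * e := by
    intro l
    rw [mul_assoc, ← mul_assoc e, hPc, mul_assoc, he, ← mul_assoc, hPP]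
  have h2 : (diagonal (fun u => f (w u)) * e).trace = ∑ l ∈ Finset.univ.image w, f l * (P l * e).trace := by
    simp only [Matrix.trace, diag_apply, diagonal_mul, P, Finset.mul_sum]
    rw [Finset.sum_comm]
    refine Finset.sum_congr rfl fun u _ => ?_
    rw [Finset.sum_eq_single (w u)]
    · simp
    · intro b _ hb; simp [hb.symm]
    · intro hu; exact absurd (Finset.mem_image_of_mem w (Finset.mem_univ u)) hu
  have h3 : f (∑ l ∈ Finset.univ.image w, l * ((P l * e).rank : ℝ)) = 0 := by
    rw [map_sum, ← h, h2]
    refine Finset.sum_congr rfl fun l _ => ?_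
    rw [trace_idem _ (hPi l), map_mul, map_natCast]
  have h4 := (map_eq_zero f).1 h3
  have h5 : ∀ l ∈ Finset.univ.image w, 0 < l := by
    intro l hl
    obtain ⟨u, -, rfl⟩ := Finset.mem_image.1 hl
    exact hw u
  rw [Finset.sum_eq_zero_iff_of_nonneg (fun l hl => mul_nonneg (h5 l hl).le (Nat.cast_nonneg _))] at h4
  ext u v
  have hu := Finset.mem_image_of_mem w (Finset.mem_univ u)
  have h6 := h4 (w u) hu
  have h7 : (P (w u) * e).rank = 0 := by
    rcases mul_eq_zero.1 h6 with h | h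
    · exact absurd h (h5 _ hu).ne'
    · exact_mod_cast h
  have h8 := congrFun (congrFun (rank_zero _ h7) u) v
  simpa [P, diagonal_mul] using h8

theorem gp_diag (f : ℝ →+* L) (γ : κ → ℝ) (hγ : ∀ i, 0 < γ i) : ∀ n, ∃ w : I κ n → ℝ, (∀ u, 0 < w u) ∧
    gp (diagonal fun i => f (γ i)) n = diagonal fun u => f (w u)
  | 0 => ⟨fun _ => 1, fun _ => one_pos, by simp [gp]⟩
  | n+1 => by
    obtain ⟨w, hw, h⟩ := gp_diag f γ hγ n
    refine ⟨fun u => γ u.1 * w u.2, fun u => mul_pos (hγ _) (hw _), ?_⟩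
    rw [gp, h]
    show (diagonal _ ⊗ₖ diagonal _ : M (κ × I κ n) L) = _
    rw [diagonal_kronecker_diagonal]
    simp only [map_mul]; rfl
end idem

/-- Data: a tower with two representations and the auxiliary family. -/
structure Ctx {L : Type} [Field L] [CharZero L] (q : L) {A : ℕ → Type} [∀ n, Ring (A n)]
    [∀ n, Algebra L (A n)] (t : HTower L q A) {ι ι' : Type} [Fintype ι] [DecidableEq ι] [Fintype ι']
    [LinearOrder ι'] (R : M (ι × ι) L) (ε : ι' → L) (f : ℝ →+* L) (γ : ι' → ℝ) where
  ρ : HRep t R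
  ρ' : HRep t (Std.R q ε)
  ρW : ∀ r, HRep t (Wr.RW q r)
  hq : q ≠ 0
  hq1 : ∀ n : ℕ, n ≠ 0 → q ^ n ≠ 1
  hγ : ∀ i, 0 < γ i
  hε : ∀ i, ε i * ε i = (q-1) * ε i + q
  hc : ∀ k, (W 1 R k).trace = (W (diagonal fun i => f (γ i)) (Std.R q ε) k).trace

namespace Ctx
variable {L : Type} [Field L] [CharZero L] {q : L} {A : ℕ → Type} [∀ n, Ring (A n)]
    [∀ n, Algebra L (A n)] {t : HTower L q A} {ι ι' : Type} [Fintype ι] [DecidableEq ι] [Fintype ι'] [LinearOrder ι']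
    {R : M (ι × ι) L} {ε : ι' → L} {f : ℝ →+* L} {γ : ι' → ℝ} (c : Ctx q t R ε f γ)

def dead (c : Ctx q t R ε f γ) {n : ℕ} (x : A n) : Prop := c.ρ.π n x = 0 ∧ c.ρ'.π n x = 0

theorem phi_eq (n : ℕ) (h : A n) (hh : h ∈ t.H n) :
    c.ρ.phi 1 n h = c.ρ'.phi (diagonal fun i => f (γ i)) n h :=
  c.ρ.phi_agree c.ρ' 1 (by simp) _ (Std.diag_comm q ε _) c.hc n h hh

theorem gp_one : ∀ n, gp (1 : M ι L) n = 1
  | 0 => rfl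
  | n+1 => by rw [gp, gp_one n, kr_one]

theorem algMap_zero {κ : Type} [DecidableEq κ] [Fintype κ] [Nonempty κ] (a : L) (h : algebraMap L (M κ L) a = 0) : a = 0 :=
  (algebraMap L (M κ L)).injective (by rw [h, map_zero])

theorem nilp (N : ℕ) (hker : ∀ x ∈ t.H N, c.dead x → x = 0) (u : A N) (hu : u ∈ t.H N)
    (h0 : ∀ x ∈ t.H N, c.ρ.phi 1 N (u * x) = 0) : IsNilpotent u := by
  have hmem : ∀ p : L[X], aeval u p ∈ t.H N := fun p => by
    have := (aeval (⟨u, hu⟩ : t.H N) p).2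
    rw [← Subalgebra.val_apply, ← Polynomial.aeval_algHom_apply] at this
    exact this
  set χ : L[X] := X * ((c.ρ.π N u).charpoly * (c.ρ'.π N u).charpoly) with hχ
  have hχ0 : χ ≠ 0 := mul_ne_zero X_ne_zero (mul_ne_zero (charpoly_monic _).ne_zero (charpoly_monic _).ne_zero)
  have hχu : aeval u χ = 0 := by
    apply hker _ (hmem _)
    constructor
    · rw [← aeval_algHom_apply, hχ, map_mul, map_mul, aeval_self_charpoly]; simp
    · rw [← aeval_algHom_apply, hχ, map_mul, map_mul, aeval_self_charpoly]; simp
  obtain ⟨v, hv, hnv⟩ := exists_eq_pow_rootMultiplicity_mul_and_not_dvd χ hχ0 0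
  have hm : 1 ≤ rootMultiplicity 0 χ := (le_rootMultiplicity_iff hχ0).2 (by simp [hχ])
  rw [map_zero, sub_zero] at hv hnv
  obtain ⟨m, hm'⟩ := Nat.exists_eq_add_of_le' hm
  rw [hm'] at hv
  obtain ⟨a, b, hab⟩ : IsCoprime (X ^ (m+1)) v := 
    IsCoprime.pow_left ((irreducible_X.coprime_iff_not_dvd).2 hnv)
  set e := aeval u (a * X ^ (m+1)) with he
  have hvu : aeval u (X ^ (m+1) * v) = 0 := by rw [← hv]; exact hχu
  have hee : e * e = e := by
    have : a * X ^ (m+1) * (a * X ^ (m+1)) = a * X ^ (m+1) - a * b * (X ^ (m+1) * v) := by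
      linear_combination (a * X ^ (m+1)) * hab
    rw [he, ← map_mul, this, map_sub, map_mul _ (a * b), hvu, mul_zero, sub_zero]
  have hphi : c.ρ.phi 1 N e = 0 := by
    have : a * X ^ (m+1) = X * (a * X ^ m) := by ring
    rw [he, this, map_mul, aeval_X]
    exact h0 _ (hmem _)
  have heH : e ∈ t.H N := hmem _
  have e0 : e = 0 := by
    apply hker _ heH
    constructor
    · apply idem_zero
      · rw [← map_mul, hee]
      · rw [HRep.phi, gp_one, one_mul] at hphi; exact hphi
    · obtain ⟨w, hw, hgw⟩ := gp_diag f γ c.hγ N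
      apply idem_zero' f w hw
      · rw [← map_mul, hee]
      · rw [← hgw]; exact c.ρ'.gp_comm _ (Std.diag_comm q ε _) N e heH
      · rw [← hgw, ← hphi, c.phi_eq N e heH]; rfl
  refine ⟨m+1, ?_⟩
  have h3 : X ^ (m+1) = X ^ (m+1) * (a * X ^ (m+1)) + b * (X ^ (m+1) * v) := by
    linear_combination (-X^(m+1)) * hab
  have h4 := congrArg (aeval u) h3
  rw [map_add, map_mul, ← he, e0, mul_zero, zero_add, map_mul, hvu, mul_zero, map_pow, aeval_X] at h4
  exact h4

theorem tau_one (r : ℕ) : Wr.tau r (c.ρW r) 0 1 = 1 := by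
  rw [Wr.tau_apply, map_one, Matrix.one_apply_eq]

theorem P3 (N : ℕ) (hker : ∀ x ∈ t.H N, c.dead x → x = 0) (h : A N) (hh : h ∈ t.H N)
    (h0 : ∀ x ∈ t.H N, c.ρ.phi 1 N (h * x) = 0) : h = 0 := by
  refine t.nondeg (Wr.tau N (c.ρW N)) (N+1) (fun n _ a _ => Wr.tau_s _ _ _ _) (Wr.tau_Q N (c.ρW N)) c.hq (c.tau_one N)
    N (by omega) h hh fun x hx => ?_
  have hu := mul_mem hh hx
  have hn := c.nilp N hker (h * x) hu fun y hy => by rw [mul_assoc]; exact h0 _ (mul_mem hx hy)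
  refine Wr.tau_eq_zero c.hq c.hq1 c.ρW N _ hu (fun r => ?_) N (by omega)
  have hcm : Commute (gp (Wr.gC q r) N) ((c.ρW r).π N (h * x)) :=
    ((c.ρW r).gp_comm _ (Std.diag_comm q _ _) N _ hu).symm
  have : IsNilpotent (gp (Wr.gC q r) N * (c.ρW r).π N (h * x)) :=
    hcm.isNilpotent_mul_left (hn.map ((c.ρW r).π N))
  exact (Matrix.isNilpotent_trace_of_isNilpotent this).eq_zero

theorem ker_step (hbad : ∀ N, ∀ h ∈ t.H N, ∀ p ∈ t.Q' N, c.dead (t.s _ h + p) → ∀ x ∈ t.H N, c.ρ.phi 1 N (h * x) = 0) :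
    ∀ N, ∀ x ∈ t.H N, c.dead x → x = 0
  | 0, x, hx, hd => by
    obtain ⟨a, rfl⟩ := t.H_zero hx
    have := hd.1
    rw [AlgHom.commutes] at this
    haveI hne : Nonempty (I ι 0) := ⟨()⟩
    have h3 : a = 0 := algMap_zero a this
    rw [h3, map_zero]
  | N+1, z, hz, hd => by
    obtain ⟨F, hF, hzF⟩ := t.expand N hz
    have key : ∀ k ≤ N, F k = 0 := by
      intro k hk
      apply c.P3 N (ker_step hbad N) _ (hF k)
      intro x hx
      choose! P hP hPD using fun j (hj : j ≤ N) => t.D_Ds N j k hj hk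
      have h1 : z * t.Ds N k = t.s _ (q ^ k • F k) + ∑ j ∈ Finset.range (N+1), t.s _ (F j) * P j := by
        rw [hzF, Finset.sum_mul]
        have : ∀ j ∈ Finset.range (N+1), t.s _ (F j) * t.D N j * t.Ds N k =
            t.s _ (F j) * ((if j = k then q ^ j else 0) • (1 : A (N+1))) + t.s _ (F j) * P j := by
          intro j hj
          rw [mul_assoc, hPD j (by rw [Finset.mem_range] at hj; omega), mul_add]
        rw [Finset.sum_congr rfl this, Finset.sum_add_distrib]
        congr 1
        rw [Finset.sum_eq_single k]
        · simp
        · intro j _ hj; simp [hj]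
        · intro h; simp at h; omega
      have h2 := hbad N (q ^ k • F k) ((t.H N).smul_mem (hF k) _) (∑ j ∈ Finset.range (N+1), t.s _ (F j) * P j)
        (Submodule.sum_mem _ fun j hj => t.mul_Q' (hP j (by rw [Finset.mem_range] at hj; omega)) (hF j)) 
        (by rw [← h1]; exact ⟨by rw [map_mul, hd.1, zero_mul], by rw [map_mul, hd.2, zero_mul]⟩) x hx
      rw [smul_mul_assoc, HRep.phi_smul] at h2
      exact (mul_eq_zero.1 h2).resolve_left (pow_ne_zero _ c.hq)
    rw [hzF]
    refine Finset.sum_eq_zero fun k hk => ?_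
    rw [key k (by rw [Finset.mem_range] at hk; omega), map_zero, zero_mul]

theorem card_I (κ : Type) [Fintype κ] : ∀ n, Fintype.card (I κ n) = Fintype.card κ ^ n
  | 0 => rfl
  | n+1 => by
    rw [show Fintype.card (I κ (n+1)) = Fintype.card (κ × I κ n) from rfl, Fintype.card_prod, card_I κ n, pow_succ']

theorem exists_ker : ∃ N, ∃ x ∈ t.H N, c.dead x ∧ x ≠ 0 := by
  by_contra hcon
  push Not at hcon
  have hb : ∀ N : ℕ, N.factorial ≤ (Fintype.card ι ^ 2) ^ N + (Fintype.card ι' ^ 2) ^ N := by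
    intro N
    obtain ⟨g, hg, hgH⟩ := t.big (Wr.tau N (c.ρW N)) (N+1) (fun n _ a _ => Wr.tau_s _ _ _ _) (Wr.tau_Q N (c.ρW N)) c.hq 
      (c.tau_one N) N (by omega)
    let G : (Fin N.factorial → L) →ₗ[L] (M (I ι N) L × M (I ι' N) L) :=
      ((c.ρ.π N).toLinearMap.comp g).prod ((c.ρ'.π N).toLinearMap.comp g)
    have hG : Function.Injective G := by
      rw [← LinearMap.ker_eq_bot, LinearMap.ker_eq_bot']
      intro x hx
      have h1 : g x = 0 := hcon N _ (hgH x) ⟨congrArg Prod.fst hx, congrArg Prod.snd hx⟩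
      exact hg (by rw [h1, map_zero])
    have := LinearMap.finrank_le_finrank_of_injective hG
    rw [Module.finrank_fin_fun, Module.finrank_prod, Module.finrank_matrix, Module.finrank_matrix, Module.finrank_self,
      card_I, card_I] at this
    calc _ ≤ _ := this
      _ = _ := by ring
  set B := Fintype.card ι ^ 2 + Fintype.card ι' ^ 2 with hB
  have hb2 : ∀ N : ℕ, (N.factorial : ℝ) ≤ 2 * (B : ℝ) ^ N := by
    intro N
    have h1 : (Fintype.card ι ^ 2) ^ N ≤ B ^ N := Nat.pow_le_pow_left (by omega) N
    have h2 : (Fintype.card ι' ^ 2) ^ N ≤ B ^ N := Nat.pow_le_pow_left (by omega) N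
    have h3 := hb N
    have : N.factorial ≤ 2 * B ^ N := by omega
    exact_mod_cast this
  have ht := FloorSemiring.tendsto_pow_div_factorial_atTop (B : ℝ)
  have := (ht.eventually (gt_mem_nhds (show (0:ℝ) < 1/2 by norm_num))).exists
  obtain ⟨N, hN⟩ := this
  rw [div_lt_iff₀ (by positivity)] at hN
  linarith [hb2 N]

theorem exists_good [Nonempty ι] : ∃ n, ∃ h ∈ t.H (n+1), ∃ p ∈ t.Q n, c.dead (t.s _ h + p) ∧ c.ρ.phi 1 _ h ≠ 0 := by
  by_contra hcon
  push Not at hcon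
  obtain ⟨N, x, hx, hd, hx0⟩ := c.exists_ker
  refine hx0 (c.ker_step ?_ N x hx hd)
  rintro (_ | n) h hh p hp hd x hx
  · rw [(Submodule.mem_bot L).1 hp, add_zero] at hd
    obtain ⟨a, rfl⟩ := t.H_zero hh
    have h1 := hd.1
    rw [AlgHom.commutes, AlgHom.commutes] at h1
    obtain ⟨i⟩ := ‹Nonempty ι›
    haveI : Nonempty (I ι (0+1)) := ⟨(i, ())⟩
    have h3 : a = 0 := algMap_zero a h1
    rw [h3, map_zero, zero_mul, HRep.phi, map_zero, mul_zero, trace_zero]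
  · refine hcon n (h * x) (mul_mem hh hx) (p * t.s _ x) (t.Q_mul hp hx) ?_
    rw [map_mul, ← add_mul]
    exact ⟨by rw [map_mul, hd.1, zero_mul], by rw [map_mul, hd.2, zero_mul]⟩
end Ctx

section emb
variable {L : Type} [Field L] {ι : Type} [Fintype ι] [DecidableEq ι]

def blk {κ κ' : Type} (φ : M κ L →ₗ[L] M κ' L) : M (ι × κ) L →ₗ[L] M (ι × κ') L where
  toFun X := Matrix.of fun u v => φ (Matrix.of fun a b => X (u.1, a) (v.1, b)) u.2 v.2
  map_add' X Y := by
    ext u v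
    exact congrFun (congrFun (map_add φ (Matrix.of fun a b => X (u.1, a) (v.1, b)) (Matrix.of fun a b => Y (u.1, a) (v.1, b))) u.2) v.2
  map_smul' c X := by
    ext u v
    exact congrFun (congrFun (map_smul φ c (Matrix.of fun a b => X (u.1, a) (v.1, b))) u.2) v.2

def emb : ∀ k N, M (I ι k) L →ₗ[L] M (I ι N) L
  | 0, N => (LinearMap.proj (R := L) (φ := fun _ : Unit => L) () ∘ₗ LinearMap.proj (R := L) (φ := fun _ : Unit => Unit → L) ()).smulRight (1 : M (I ι N) L)
  | k+1, 0 => 0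
  | k+1, N+1 => (blk (emb k N) : M (ι × I ι k) L →ₗ[L] M (ι × I ι N) L)

theorem emb_zero (N : ℕ) (X : M (I ι 0) L) : emb 0 N X = X.trace • (1 : M (I ι N) L) := by
  have : X.trace = X () () := by
    show (∑ i : Unit, X i i) = _
    simp
  rw [this]; rfl

theorem emb_kr (k N : ℕ) (a : M ι L) (X : M (I ι k) L) : emb (k+1) (N+1) (kr a X) = kr a (emb k N X) := by
  ext u v
  exact congrFun (congrFun (map_smul (emb k N) (a u.1 v.1) X) u.2) v.2

theorem emb_sI (k N : ℕ) (X : M (I ι k) L) : emb (k+1) (N+1) (sI X) = sI (emb k N X) := emb_kr k N 1 X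

theorem trace_mul0 (X Y : M (I ι 0) L) : (X * Y).trace = X.trace * Y.trace := by
  show (∑ i : Unit, (X * Y) i i) = (∑ i : Unit, X i i) * (∑ i : Unit, Y i i)
  simp only [Finset.univ_unique, Finset.sum_singleton]
  show (∑ i : Unit, X _ i * Y i _) = _
  simp

theorem emb_mul : ∀ k N (X Y : M (I ι k) L), emb k N (X * Y) = emb k N X * emb k N Y
  | 0, N, X, Y => by
    rw [emb_zero, emb_zero, emb_zero, trace_mul0, smul_mul_smul_comm, one_mul]
  | k+1, 0, X, Y => (zero_mul _).symm
  | k+1, N+1, X, Y => by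
    induction X using kr_ind with
    | h a X =>
      induction Y using kr_ind with
      | h b Y => rw [kr_mul, emb_kr, emb_kr, emb_kr, kr_mul, emb_mul]
      | hadd x y hx hy => rw [mul_add, map_add, map_add, hx, hy, mul_add]
    | hadd x y hx hy => rw [add_mul, map_add, map_add, hx, hy, add_mul]

theorem emb_one : ∀ k N, k ≤ N → emb k N (1 : M (I ι k) L) = 1
  | 0, N, _ => by rw [emb_zero, trace_one0, one_smul]
  | k+1, 0, h => absurd h (by omega)
  | k+1, N+1, h => by rw [← kr_one, emb_kr, emb_one k N (by omega), kr_one]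

theorem emb_FI (R : M (ι × ι) L) (k N : ℕ) (h : k ≤ N) : emb (k+2) (N+2) (FI k R) = FI N R := by
  ext u v
  have := congrFun (congrFun (map_smul (emb k N) (R (u.1, u.2.1) (v.1, v.2.1)) (1 : M (I ι k) L)) u.2.2) v.2.2
  rw [emb_one k N h] at this
  exact this

theorem emb_comm (N : ℕ) (Fm : ∀ n, M (I ι n) L) (hF : ∀ n, N ≤ n → Fm (n+1) = sI (Fm n)) :
    ∀ i (b : M (I ι i) L), emb i (N+i) b * Fm (N+i) = Fm (N+i) * emb i (N+i) b
  | 0, b => by rw [emb_zero, smul_mul_assoc, one_mul, mul_smul_comm, mul_one]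
  | i+1, b => by
    rw [show Fm (N+(i+1)) = sI (Fm (N+i)) from hF (N+i) (by omega)]
    induction b using kr_ind with
    | h a b => 
      rw [show emb (i+1) (N+(i+1)) (kr a b) = kr a (emb i (N+i) b) from emb_kr _ _ _ _, sI_eq]
      erw [kr_mul, kr_mul]
      rw [emb_comm N Fm hF i b, one_mul, mul_one]
    | hadd x y hx hy => rw [map_add, add_mul, mul_add, hx, hy]

theorem emb_trace (N : ℕ) (Fm : ∀ n, M (I ι n) L) (hF : ∀ n, N ≤ n → Fm (n+1) = sI (Fm n)) :
    ∀ i (b : M (I ι i) L), (emb i (N+i) b * Fm (N+i)).trace = b.trace * (Fm N).trace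
  | 0, b => by rw [emb_zero, smul_mul_assoc, one_mul, trace_smul]; rfl
  | i+1, b => by
    rw [show Fm (N+(i+1)) = sI (Fm (N+i)) from hF (N+i) (by omega)]
    induction b using kr_ind with
    | h a b => 
      rw [show emb (i+1) (N+(i+1)) (kr a b) = kr a (emb i (N+i) b) from emb_kr _ _ _ _, sI_eq]
      erw [kr_mul, trace_kr]
      rw [emb_trace N Fm hF i b, mul_one, trace_kr, mul_assoc]
    | hadd x y hx hy => rw [map_add, add_mul, trace_add, hx, hy, trace_add, add_mul]

def GM (C : M ι L) (k N : ℕ) (h : M (I ι N) L) {κ : Type} [Fintype κ] (a b : κ → M (I ι N) L) : Prop :=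
  ∀ (X : M (I ι k) L) (Y : M (I ι N) L), X.trace * (Y * h).trace = ∑ i, (Y * a i * emb k N (X * gp C k) * b i).trace

theorem GM_zero (C : M ι L) (N : ℕ) (h : M (I ι N) L) : GM C 0 N h (κ := Unit) (fun _ => h) (fun _ => 1) := by
  intro X Y
  simp [gp, emb_zero]

theorem S1 {q : L} {R S : M (ι × ι) L} (hs : IsSym q R S) {C : M ι L} (hC : hat S C = 1) (n N : ℕ) (hn : n ≤ N)
    {κ : Type} [Fintype κ] (x : M (I ι (n+1)) L) (a b : κ → M (I ι (n+1)) L)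
    (hz : sI x + ∑ i, sI (a i) * FI n R * sI (b i) = 0) (X : M ι L) (Y : M (I ι (N+1)) L) :
    X.trace * (Y * emb (n+1) (N+1) x).trace =
      ∑ i, (Y * emb (n+1) (N+1) (-a i) * kr (X * C) 1 * emb (n+1) (N+1) (b i)).trace := by
  obtain ⟨Λ, h1, h2⟩ := hs.star hC X
  have h3 := congrArg (emb (n+2) (N+2)) hz
  rw [map_add, map_sum, map_zero, emb_sI] at h3
  simp only [emb_mul, emb_sI, emb_FI R n N hn] at h3
  have h4 := congrArg (fun Z => (kr Λ Y * Z).trace) h3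
  simp only [trace_kr_mul, map_add, map_sum, pt_sI, pt_key, h1, h2, map_zero, mul_zero, trace_zero] at h4
  rw [mul_add, trace_add, mul_smul_comm, trace_smul, smul_eq_mul, Finset.mul_sum, trace_sum] at h4
  rw [eq_neg_of_add_eq_zero_left h4, ← Finset.sum_neg_distrib]
  refine Finset.sum_congr rfl fun i _ => ?_
  rw [map_neg, mul_neg, neg_mul, neg_mul, trace_neg]
  simp only [mul_assoc]

theorem GM_step (C : M ι L) (k N : ℕ) {κ κ' : Type} [Fintype κ] [Fintype κ'] (ex : M (I ι (N+1)) L)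
    (ea eb : κ → M (I ι (N+1)) L)
    (h1 : ∀ (X : M ι L) (Y : M (I ι (N+1)) L), X.trace * (Y * ex).trace = ∑ i, (Y * ea i * kr (X * C) 1 * eb i).trace)
    (h : M (I ι N) L) (a b : κ' → M (I ι N) L) (h2 : GM C k N h a b) (hcomm : ∀ i, eb i * sI h = sI h * eb i) :
    GM C (k+1) (N+1) (ex * sI h) (κ := κ × κ') (fun p => ea p.1 * sI (a p.2)) (fun p => sI (b p.2) * eb p.1) := by
  intro X Y
  induction X using kr_ind with
  | hadd x y hx hy => 
    rw [trace_add, add_mul, hx, hy, ← Finset.sum_add_distrib]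
    refine Finset.sum_congr rfl fun i _ => ?_
    rw [add_mul, map_add, mul_add, add_mul, trace_add]
  | h X1 X =>
    rw [trace_kr, gp, kr_mul, emb_kr, Fintype.sum_prod_type]
    calc _ = X.trace * (X1.trace * ((sI h * Y) * ex).trace) := by
          rw [← mul_assoc Y, Matrix.trace_mul_comm, ← mul_assoc]; ring
      _ = X.trace * ∑ i, (sI h * Y * ea i * kr (X1 * C) 1 * eb i).trace := by rw [h1]
      _ = X.trace * ∑ i, (kr 1 1 * (eb i * Y * ea i * kr (X1 * C) 1 * sI h)).trace := by
          congr 1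
          refine Finset.sum_congr rfl fun i _ => ?_
          have : sI h * Y * ea i * kr (X1 * C) 1 * eb i = sI h * (Y * ea i * kr (X1 * C) 1 * eb i) := by
            simp only [mul_assoc]
          rw [this, Matrix.trace_mul_comm, mul_assoc, hcomm, ← mul_assoc, Matrix.trace_mul_comm, kr_one, one_mul]
          simp only [mul_assoc]
      _ = ∑ i, X.trace * (pt 1 (eb i * Y * ea i * kr (X1 * C) 1) * h).trace := by
          rw [Finset.mul_sum]
          refine Finset.sum_congr rfl fun i _ => ?_
          rw [trace_kr_mul, one_mul, pt_mul_s]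
      _ = _ := by
          refine Finset.sum_congr rfl fun i _ => ?_
          rw [h2]
          refine Finset.sum_congr rfl fun j _ => ?_
          have e1 : pt 1 (eb i * Y * ea i * kr (X1 * C) 1) * a j * emb k N (X * gp C k) * b j =
              pt 1 (eb i * Y * ea i * kr (X1 * C) 1 * sI (a j * emb k N (X * gp C k) * b j)) := by
            rw [pt_mul_s]; simp only [mul_assoc]
          rw [e1, ← one_mul (pt 1 _), ← trace_kr_mul, kr_one, one_mul]
          have e2 : eb i * Y * ea i * kr (X1 * C) 1 * sI (a j * emb k N (X * gp C k) * b j) =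
              eb i * (Y * (ea i * sI (a j)) * kr (X1 * C) (emb k N (X * gp C k)) * sI (b j)) := by
            simp only [mul_assoc, sI_eq, kr_mul, one_mul, mul_one]
          rw [e2, Matrix.trace_mul_comm]
          simp only [mul_assoc]

def mix (C g : M ι L) : ∀ k N : ℕ, M (I ι N) L
  | 0, N => gp g N
  | k+1, 0 => 0
  | k+1, N+1 => kr C (mix C g k N)

theorem mix_eq (C g gi : M ι L) (hg : g * gi = 1) : ∀ k N, k ≤ N → ∀ Z : M (I ι k) L,
    gp g N * emb k N (gp gi k * Z * gp C k) = emb k N Z * mix C g k N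
  | 0, N, _, Z => by
    simp [gp, emb_zero, mix]
  | k+1, 0, h, _ => absurd h (by omega)
  | k+1, N+1, h, Z => by
    induction Z using kr_ind with
    | h z Z => 
      rw [gp, gp, gp, kr_mul, kr_mul, emb_kr, kr_mul, mix_eq C g gi hg k N (by omega), emb_kr, mix, kr_mul,
        ← mul_assoc, ← mul_assoc, hg, one_mul]
    | hadd x y hx hy => rw [mul_add, add_mul, map_add, mul_add, hx, hy, map_add, add_mul]

theorem fin_eq (C g gi : M ι L) (hg : g * gi = 1) (k N : ℕ) (hk : k ≤ N) (h : M (I ι N) L) {κ : Type} [Fintype κ]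
    (a b : κ → M (I ι N) L) (hG : GM C k N h a b) (w : M (I ι k) L) (hc : ∀ i, a i * gp g N = gp g N * a i) :
    (gp gi k * w).trace * (gp g N * h).trace = ∑ i, (mix C g k N * (b i * a i * emb k N w)).trace := by
  rw [hG]
  refine Finset.sum_congr rfl fun i _ => ?_
  rw [← hc, mul_assoc (a i), mix_eq C g gi hg k N hk w]
  rw [Matrix.trace_mul_comm, Matrix.trace_mul_comm (mix C g k N)]
  simp only [mul_assoc]
end emb

namespace HTower
variable {L : Type} [Field L] {q : L} {A : ℕ → Type} [∀ n, Ring (A n)]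
    [∀ n, Algebra L (A n)] (t : HTower L q A)

theorem Q_sum {n : ℕ} {p : A (n+2)} (hp : p ∈ t.Q n) : ∃ (κ : Type) (_ : Fintype κ) (a b : κ → A (n+1)),
    (∀ i, a i ∈ t.H (n+1)) ∧ (∀ i, b i ∈ t.H (n+1)) ∧ p = ∑ i, t.s _ (a i) * t.T n * t.s _ (b i) := by
  induction hp using Submodule.span_induction with
  | mem x hx => 
    obtain ⟨a, ha, b, hb, rfl⟩ := hx
    exact ⟨Unit, inferInstance, fun _ => a, fun _ => b, fun _ => ha, fun _ => hb, by simp⟩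
  | zero => exact ⟨Empty, inferInstance, fun i => i.elim, fun i => i.elim, fun i => i.elim, fun i => i.elim, by simp⟩
  | add x y _ _ hx hy =>
    obtain ⟨κ, _, a, b, ha, hb, rfl⟩ := hx
    obtain ⟨κ', _, a', b', ha', hb', rfl⟩ := hy
    refine ⟨κ ⊕ κ', inferInstance, Sum.elim a a', Sum.elim b b', ?_, ?_, by simp⟩
    · rintro (i | i); exacts [ha i, ha' i]
    · rintro (i | i); exacts [hb i, hb' i]
  | smul c x _ hx =>
    obtain ⟨κ, _, a, b, ha, hb, rfl⟩ := hx
    refine ⟨κ, inferInstance, fun i => c • a i, b, fun i => (t.H _).smul_mem (ha i) c, hb, ?_⟩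
    rw [Finset.smul_sum]
    refine Finset.sum_congr rfl fun i _ => ?_
    rw [map_smul, smul_mul_assoc, smul_mul_assoc]

open Classical in
/-- extension of `x : A n` to all sizes by shifting. -/
def ext (n : ℕ) (x : A n) : ∀ m, A m
  | 0 => if h : n = 0 then h ▸ x else 0
  | m+1 => if h : n = m+1 then h ▸ x else t.s m (ext n x m)

theorem ext_self (n : ℕ) (x : A n) : t.ext n x n = x := by
  cases n <;> simp [ext]

theorem ext_succ (n : ℕ) (x : A n) (m : ℕ) (h : n ≤ m) : t.ext n x (m+1) = t.s m (t.ext n x m) := by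
  rw [ext, dif_neg (by omega)]
end HTower

section
variable {L : Type} [Field L] {q : L} {A : ℕ → Type} [∀ n, Ring (A n)]
    [∀ n, Algebra L (A n)] {t : HTower L q A} {ι : Type} [Fintype ι] [DecidableEq ι]
    {R : M (ι × ι) L} (ρ : HRep t R) {S : M (ι × ι) L} (hS : IsSym q R S) {C : M ι L} (hC : hat S C = 1)
include hS hC

theorem claim_step (E : ∀ k N, A k → A N) (hEρ : ∀ k N a, ρ.π N (E k N a) = emb k N (ρ.π k a))
    (i N : ℕ) (F : ∀ m, A m) (hFs : ∀ m, N ≤ m → F (m+1) = t.s m (F m)) {κ : Type} [Fintype κ]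
    (x : A (i+1)) (a b : κ → A (i+1)) (hd : ρ.π (i+2) (t.s _ x + ∑ j, t.s _ (a j) * t.T i * t.s _ (b j)) = 0)
    (k : ℕ) {κ' : Type} [Fintype κ'] (a' b' : κ' → A (N+i)) 
    (hG : GM C k (N+i) (ρ.π (N+i) (F (N+i))) (fun j => ρ.π (N+i) (a' j)) (fun j => ρ.π (N+i) (b' j))) :
    GM C (k+1) (N+i+1) (ρ.π (N+i+1) (E (i+1) (N+i+1) x * F (N+i+1)))
      (fun p : κ × κ' => ρ.π (N+i+1) (E (i+1) (N+i+1) (-a p.1) * t.s (N+i) (a' p.2)))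
      (fun p => ρ.π (N+i+1) (t.s (N+i) (b' p.2) * E (i+1) (N+i+1) (b p.1))) := by
  rw [map_add, map_sum, ρ.pis] at hd
  simp only [ρ.pisTs] at hd
  have h1 := S1 hS hC i (N+i) (by omega) _ _ _ hd
  have h2 := GM_step C k (N+i) _ _ _ h1 _ _ _ hG (fun j => by
    have h3 := emb_comm N (fun m => ρ.π m (F m)) (fun m hm => by rw [hFs m hm, ρ.pis]) (i+1) (ρ.π _ (b j))
    have h4 : ρ.π (N+i+1) (F (N+i+1)) = sI (ρ.π (N+i) (F (N+i))) := by rw [hFs _ (by omega), ρ.pis]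
    rw [← h4]
    exact h3)
  rw [map_mul, hEρ, hFs _ (by omega), ρ.pis]
  have e1 : (fun p : κ × κ' => ρ.π (N+i+1) (E (i+1) (N+i+1) (-a p.1) * t.s (N+i) (a' p.2))) =
    fun p => emb (i+1) (N+i+1) (-(ρ.π (i+1) (a p.1))) * sI (ρ.π (N+i) (a' p.2)) := by
    funext p; rw [map_mul, hEρ, map_neg, ρ.pis]
  have e2 : (fun p : κ × κ' => ρ.π (N+i+1) (t.s (N+i) (b' p.2) * E (i+1) (N+i+1) (b p.1))) =
    fun p => sI (ρ.π (N+i) (b' p.2)) * emb (i+1) (N+i+1) (ρ.π (i+1) (b p.1)) := by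
    funext p; rw [map_mul, hEρ, ρ.pis]
  rw [e1, e2]
  exact h2
end

namespace Ctx
variable {L : Type} [Field L] [CharZero L] {q : L} {A : ℕ → Type} [∀ n, Ring (A n)]
    [∀ n, Algebra L (A n)] {t : HTower L q A} {ι ι' : Type} [Fintype ι] [DecidableEq ι] [Fintype ι'] [LinearOrder ι']
    {R : M (ι × ι) L} {ε : ι' → L} {f : ℝ →+* L} {γ : ι' → ℝ} (c : Ctx q t R ε f γ)

def Good (c : Ctx q t R ε f γ) (n : ℕ) (x : A (n+1)) : Prop := x ∈ t.H (n+1) ∧ ∃ p ∈ t.Q n, c.dead (t.s _ x + p)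

theorem Good.s {n : ℕ} {x : A (n+1)} (h : c.Good n x) : c.Good (n+1) (t.s _ x) := by
  obtain ⟨hx, p, hp, hd⟩ := h
  refine ⟨t.s_mem _ hx, q⁻¹ • (t.T (n+1) * t.s _ p * t.T (n+1)) - (q⁻¹ * (q-1)) • (t.T (n+1) * t.s _ p), ?_, ?_⟩
  · refine sub_mem (Submodule.smul_mem _ _ (t.TpT hp)) (Submodule.smul_mem _ _ ?_)
    have := t.mem_Q (one_mem (t.H (n+2))) (t.Q_le n hp)
    rwa [map_one, one_mul] at this
  · have : t.s _ (t.s _ x) + (q⁻¹ • (t.T (n+1) * t.s _ p * t.T (n+1)) - (q⁻¹ * (q-1)) • (t.T (n+1) * t.s _ p)) =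
        q⁻¹ • (t.T (n+1) * t.s _ (t.s _ x + p) * t.T (n+1)) - (q⁻¹ * (q-1)) • (t.T (n+1) * t.s _ (t.s _ x + p)) := by
      have h1 : t.T (n+1) * t.s _ (t.s _ x) * t.T (n+1) = (q-1) • (t.T (n+1) * t.s _ (t.s _ x)) + q • t.s _ (t.s _ x) := by
        rw [t.comm, mul_assoc, t.quad, mul_add, mul_smul_comm, mul_smul_comm, mul_one]
      rw [map_add, mul_add, add_mul, h1, smul_add, smul_add, smul_smul, smul_smul, inv_mul_cancel₀ c.hq, one_smul, smul_add]
      abel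
    rw [this]
    constructor
    · simp only [map_sub, map_smul, map_mul, c.ρ.pis, hd.1, map_zero]; simp
    · simp only [map_sub, map_smul, map_mul, c.ρ'.pis, hd.2, map_zero]; simp

theorem Good.ext {n : ℕ} {x : A (n+1)} (h : c.Good n x) (m : ℕ) (hm : n ≤ m) : c.Good m (t.ext (n+1) x (m+1)) := by
  induction m, hm using Nat.le_induction with
  | base => rwa [t.ext_self]
  | succ m hm ih => rw [t.ext_succ _ _ _ (by omega)]; exact Good.s c ih

variable {S : M (ι × ι) L} (hS : IsSym q R S) {C : M ι L} (hC : hat S C = 1)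
  {S' : M (ι' × ι') L} (hS' : IsSym q (Std.R q ε) S') {C' : M ι' L} (hC' : hat S' C' = 1)
include hS hC hS' hC'

theorem Good.delta {n : ℕ} {x : A (n+1)} (h : c.Good n x) (h0 : c.ρ.phi 1 _ x ≠ 0) : C.trace = C'.trace := by
  obtain ⟨hx, p, hp, hd⟩ := h
  obtain ⟨κ, _, a, b, ha, hb, rfl⟩ := t.Q_sum hp
  have e1 : C.trace * c.ρ.phi 1 _ x + (q + (q-1) * C.trace) * c.ρ.phi 1 _ (∑ i, a i * b i) = 0 := by
    have := congrArg (fun Z => (gp 1 (n+1) * pt C Z).trace) hd.1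
    simp only [map_add, map_sum, c.ρ.pis, c.ρ.pisTs, pt_sI, pt_key, hS.hat_C hC, map_zero, mul_zero, trace_zero] at this
    rw [HRep.phi, HRep.phi, ← this]
    simp only [mul_add, trace_add, smul_kr, kr_one, mul_smul_comm, smul_mul_assoc, mul_one, ← Finset.smul_sum, trace_smul,
      smul_eq_mul, map_sum, map_mul]
  have e2 : C'.trace * c.ρ.phi 1 _ x + (q + (q-1) * C'.trace) * c.ρ.phi 1 _ (∑ i, a i * b i) = 0 := by
    have := congrArg (fun Z => (gp (diagonal fun i => f (γ i)) (n+1) * pt C' Z).trace) hd.2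
    simp only [map_add, map_sum, c.ρ'.pis, c.ρ'.pisTs, pt_sI, pt_key, hS'.hat_C hC', map_zero, mul_zero, trace_zero] at this
    rw [c.phi_eq _ x hx, c.phi_eq _ _ (sum_mem fun i _ => mul_mem (ha i) (hb i)), HRep.phi, HRep.phi, ← this]
    simp only [mul_add, trace_add, smul_kr, kr_one, mul_smul_comm, smul_mul_assoc, mul_one, ← Finset.smul_sum, trace_smul,
      smul_eq_mul, map_sum, map_mul]
  set α := c.ρ.phi 1 _ x
  set β := c.ρ.phi 1 _ (∑ i, a i * b i)
  have h3 : α + (q-1) * β ≠ 0 := by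
    intro h3
    have h4 : q * β = 0 := by linear_combination e1 - C.trace * h3
    have h5 : β = 0 := (mul_eq_zero.1 h4).resolve_left c.hq
    rw [h5, mul_zero, add_zero] at h3
    exact h0 h3
  refine mul_right_cancel₀ h3 ?_
  linear_combination e1 - e2

theorem mix_agree (hδ : C.trace = C'.trace) : ∀ k N, k ≤ N → ∀ h ∈ t.H N,
    (mix C 1 k N * c.ρ.π N h).trace = (mix C' (diagonal fun i => f (γ i)) k N * c.ρ'.π N h).trace
  | 0, N, _, h, hh => c.phi_eq N h hh
  | k+1, 0, h, _, _ => absurd h (by omega)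
  | 1, 1, _, h, hh => by
    obtain ⟨a, rfl⟩ := t.H_one hh
    rw [AlgHom.commutes, AlgHom.commutes, Algebra.algebraMap_eq_smul_one, Algebra.algebraMap_eq_smul_one]
    simp only [mix, mul_smul_comm, mul_one, trace_smul, trace_kr, hδ, gp, trace_one0]
  | k+2, 1, h, _, _ => absurd h (by omega)
  | k+1, N+2, hk, h, hh => by
    refine t.H_ind (P := fun h => (mix C 1 (k+1) (N+2) * c.ρ.π (N+2) h).trace = 
      (mix C' (diagonal fun i => f (γ i)) (k+1) (N+2) * c.ρ'.π (N+2) h).trace) hh ?_ ?_ ?_ ?_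
    · intro a ha
      rw [mix, mix, c.ρ.pis, c.ρ'.pis, trace_kr_mul, trace_kr_mul, pt_sI, pt_sI, mul_smul_comm, mul_smul_comm, 
        trace_smul, trace_smul, hδ, mix_agree hδ k (N+1) (by omega) a ha]
    · intro a ha b hb
      rw [mix, mix, c.ρ.pisTs, c.ρ'.pisTs, trace_kr_mul, trace_kr_mul, pt_key, pt_key, hS.hat_C hC, hS'.hat_C hC',
        smul_kr, smul_kr, kr_one, kr_one, mul_smul_comm, mul_smul_comm, mul_one, mul_one, smul_mul_assoc, smul_mul_assoc,
        mul_smul_comm, mul_smul_comm, trace_smul, trace_smul, hδ, ← map_mul, ← map_mul,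
        mix_agree hδ k (N+1) (by omega) (a * b) (mul_mem ha hb)]
    · intro x y hx hy
      rw [map_add, map_add, mul_add, mul_add, trace_add, trace_add, hx, hy]
    · intro r x hx
      rw [map_smul, map_smul, mul_smul_comm, mul_smul_comm, trace_smul, trace_smul, hx]

variable (E : ∀ k N, A k → A N) (hE : ∀ k N a, k ≤ N → a ∈ t.H k → E k N a ∈ t.H N)
  (hEρ : ∀ k N a, c.ρ.π N (E k N a) = emb k N (c.ρ.π k a))
  (hEρ' : ∀ k N a, c.ρ'.π N (E k N a) = emb k N (c.ρ'.π k a))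
  (hEs : ∀ k N a, E (k+1) (N+1) (t.s k a) = t.s N (E k N a))
include hE hEρ hEρ' hEs

theorem claim {n : ℕ} {x : A (n+1)} (hx : c.Good n x) (h0 : c.ρ.phi 1 _ x ≠ 0) : ∀ k : ℕ,
    ∃ (N : ℕ) (F : ∀ m, A m), k ≤ N ∧ (∀ m, N ≤ m → F m ∈ t.H m) ∧ (∀ m, N ≤ m → F (m+1) = t.s m (F m)) ∧
      c.ρ.phi 1 N (F N) ≠ 0 ∧ ∀ m, N ≤ m → ∃ (κ : Type) (_ : Fintype κ) (a b : κ → A m), (∀ i, a i ∈ t.H m) ∧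
        (∀ i, b i ∈ t.H m) ∧ GM C k m (c.ρ.π m (F m)) (fun i => c.ρ.π m (a i)) (fun i => c.ρ.π m (b i)) ∧
        GM C' k m (c.ρ'.π m (F m)) (fun i => c.ρ'.π m (a i)) (fun i => c.ρ'.π m (b i))
  | 0 => by
    refine ⟨0, fun _ => 1, le_rfl, fun _ _ => one_mem _, fun _ _ => (map_one _).symm, ?_, fun m _ => 
      ⟨Unit, inferInstance, fun _ => 1, fun _ => 1, fun _ => one_mem _, fun _ => one_mem _, ?_, ?_⟩⟩
    · have := c.ρ.phi_algebraMap0 1 (1:L)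
      rw [map_one] at this
      show c.ρ.phi 1 0 1 ≠ 0
      rw [this]; exact one_ne_zero
    · simp only [map_one]; exact GM_zero _ _ _
    · simp only [map_one]; exact GM_zero _ _ _
  | k+1 => by
    obtain ⟨N, F, hkN, hFH, hFs, hF0, hG⟩ := claim hx h0 k
    let P : ∀ m i : ℕ, A m := fun m i => E i m (t.ext (n+1) x i) * F m
    have hP : ∀ i, P (N+i) (N+i-N) = P (N+i) i := fun i => by rw [Nat.add_sub_cancel_left]
    have hex : ∀ i, n + 1 ≤ i → t.ext (n+1) x i ∈ t.H i := by
      rintro (_ | i) hi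
      · omega
      · exact (Good.ext c hx i (by omega)).1
    have hPs : ∀ i, n + 1 ≤ i → P (N+(i+1)) (i+1) = t.s _ (P (N+i) i) := by
      intro i hi
      show E (i+1) (N+i+1) (t.ext (n+1) x (i+1)) * F (N+i+1) = t.s _ (E i (N+i) (t.ext (n+1) x i) * F (N+i))
      rw [t.ext_succ _ _ _ hi, hEs, hFs _ (by omega), map_mul]
    refine ⟨N+(n+1), fun m => P m (m-N), by omega, ?_, ?_, ?_, ?_⟩
    · intro m hm
      obtain ⟨i, rfl⟩ := Nat.exists_eq_add_of_le (show N ≤ m by omega)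
      show P (N+i) (N+i-N) ∈ _
      rw [hP]
      exact mul_mem (hE _ _ _ (by omega) (hex i (by omega))) (hFH _ (by omega))
    · intro m hm
      obtain ⟨i, rfl⟩ := Nat.exists_eq_add_of_le (show N ≤ m by omega)
      have := hP (i+1)
      show P (N+i+1) (N+i+1-N) = t.s _ (P (N+i) (N+i-N))
      rw [hP]
      exact this.trans (hPs i (by omega))
    · simp only
      rw [hP, HRep.phi, gp_one, one_mul, map_mul, hEρ, t.ext_self]
      rw [emb_trace N (fun m => c.ρ.π m (F m)) (fun m hm => by rw [hFs m hm, c.ρ.pis])]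
      rw [HRep.phi, gp_one, one_mul] at h0 hF0
      exact mul_ne_zero h0 hF0
    · intro m hm
      obtain ⟨m', rfl⟩ := Nat.exists_eq_add_of_le' (show 1 ≤ m by omega)
      obtain ⟨i, rfl⟩ := Nat.exists_eq_add_of_le (show N ≤ m' by omega)
      beta_reduce
      rw [show N + i + 1 - N = i + 1 by omega]
      obtain ⟨hxH, p, hp, hd⟩ := Good.ext c hx i (by omega)
      obtain ⟨κ, _, a, b, ha, hb, rfl⟩ := t.Q_sum hp
      obtain ⟨κ', _, a', b', ha', hb', hG1, hG2⟩ := hG (N+i) (by omega)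
      refine ⟨κ × κ', inferInstance, fun p => E (i+1) (N+i+1) (-a p.1) * t.s (N+i) (a' p.2),
        fun p => t.s (N+i) (b' p.2) * E (i+1) (N+i+1) (b p.1), fun p => ?_, fun p => ?_, ?_, ?_⟩
      · exact mul_mem (hE _ _ _ (by omega) (neg_mem (ha _))) (t.s_mem _ (ha' _))
      · exact mul_mem (t.s_mem _ (hb' _)) (hE _ _ _ (by omega) (hb _))
      · exact claim_step c.ρ hS hC E hEρ i N F hFs _ a b hd.1 k a' b' hG1
      · exact claim_step c.ρ' hS' hC' E hEρ' i N F hFs _ a b hd.2 k a' b' hG2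
end Ctx

namespace Ctx
variable {L : Type} [Field L] [CharZero L] {q : L} {A : ℕ → Type} [∀ n, Ring (A n)]
    [∀ n, Algebra L (A n)] {t : HTower L q A} {ι ι' : Type} [Fintype ι] [DecidableEq ι] [Fintype ι'] [LinearOrder ι']
    {R : M (ι × ι) L} {ε : ι' → L} {f : ℝ →+* L} {γ : ι' → ℝ} (c : Ctx q t R ε f γ)

theorem final {S : M (ι × ι) L} (hS : IsSym q R S) 
  {S' : M (ι' × ι') L} (hS' : IsSym q (Std.R q ε) S')
  (E : ∀ k N, A k → A N) (hE : ∀ k N a, k ≤ N → a ∈ t.H k → E k N a ∈ t.H N)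
  (hEρ : ∀ k N a, c.ρ.π N (E k N a) = emb k N (c.ρ.π k a))
  (hEρ' : ∀ k N a, c.ρ'.π N (E k N a) = emb k N (c.ρ'.π k a))
  (hEs : ∀ k N a, E (k+1) (N+1) (t.s k a) = t.s N (E k N a)) (k : ℕ) :
    (W 1 R k).trace = (W (diagonal fun i => f (γ i)⁻¹) (Std.R q ε) k).trace := by
  rcases isEmpty_or_nonempty ι with hι | hι
  · have h0 := c.hc 0
    rw [show (W 1 R 0).trace = 0 by simp [Matrix.trace], W, trace_diagonal, ← map_sum, eq_comm, map_eq_zero] at h0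
    have : IsEmpty ι' := by
      by_contra hne
      rw [not_isEmpty_iff] at hne
      exact (Finset.sum_pos (fun i _ => c.hγ i) Finset.univ_nonempty).ne' h0
    simp [Matrix.trace]
  · obtain ⟨C, hC⟩ := hS.exists_C
    obtain ⟨C', hC'⟩ := hS'.exists_C
    obtain ⟨n, x, hx, p, hp, hd, hx0⟩ := c.exists_good
    have hgood : c.Good n x := ⟨hx, p, hp, hd⟩
    have hδ := hgood.delta c hS hC hS' hC' hx0
    obtain ⟨N, F, hkN, hFH, hFs, hF0, hG⟩ := c.claim hS hC hS' hC' E hE hEρ hEρ' hEs hgood hx0 (k+1)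
    obtain ⟨κ, _, a, b, ha, hb, hG1, hG2⟩ := hG N le_rfl
    have hgg : (diagonal fun i => f (γ i)) * (diagonal fun i => f (γ i)⁻¹) = (1 : M ι' L) := by
      rw [diagonal_mul_diagonal, ← diagonal_one]
      congr 1; funext i
      rw [← map_mul, mul_inv_cancel₀ (c.hγ i).ne', map_one]
    have e1 := fin_eq C 1 1 (one_mul 1) (k+1) N hkN _ _ _ hG1 (c.ρ.π (k+1) (t.D k k)) (fun i => by
      rw [gp_one, mul_one, one_mul])
    have e2 := fin_eq C' _ _ hgg (k+1) N hkN _ _ _ hG2 (c.ρ'.π (k+1) (t.D k k)) (fun i => 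
      c.ρ'.gp_comm _ (Std.diag_comm q ε _) _ _ (ha i))
    have e3 : c.ρ.phi 1 N (F N) = (gp (diagonal fun i => f (γ i)) N * c.ρ'.π N (F N)).trace := c.phi_eq N _ (hFH N le_rfl)
    have e4 := c.ρ.chi_D 1 (by simp) k 0
    have e5 := c.ρ'.chi_D (diagonal fun i => f (γ i)⁻¹) (Std.diag_comm q ε _) k 0
    rw [zero_add] at e4 e5
    rw [← e4, ← e5]
    refine mul_right_cancel₀ hF0 ?_
    refine Eq.trans e1 (Eq.trans ?_ (Eq.trans e2.symm ?_))
    rotate_left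
    · rw [← e3]; rfl
    refine Finset.sum_congr rfl fun i _ => ?_
    rw [← hEρ, ← hEρ', ← map_mul, ← map_mul, ← map_mul, ← map_mul]
    exact mix_agree c hS hC hS' hC' hδ (k+1) N hkN _ 
      (mul_mem (mul_mem (hb i) (ha i)) (hE _ _ _ hkN (t.D_mem k k)))
end Ctx

section fam
variable {L : Type} [Field L] {J : Type} (d : J → ℕ) (q : L) (R : ∀ j, M (Fin (d j) × Fin (d j)) L) (hR : ∀ j, IsHecke q (R j))

def famE (k N : ℕ) (a : Fam d L k) : Fam d L N := fun j => emb k N (a j)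

theorem famE_alg (k N : ℕ) (h : k ≤ N) (c : L) : famE d k N (algebraMap L (Fam d L k) c) = algebraMap L _ c := by
  funext j
  rw [Algebra.algebraMap_eq_smul_one, Algebra.algebraMap_eq_smul_one]
  show emb k N (c • 1) = c • 1
  rw [map_smul, emb_one _ _ h]

theorem famE_s (k N : ℕ) (a : Fam d L k) : famE d (k+1) (N+1) ((famTower d q R hR).s k a) = 
    (famTower d q R hR).s N (famE d k N a) := by
  funext j
  exact emb_sI k N (a j)

theorem famE_mem : ∀ k N (a : Fam d L k), k ≤ N → a ∈ (famTower d q R hR).H k → famE d k N a ∈ (famTower d q R hR).H N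
  | 0, N, a, h, ha => by
    obtain ⟨c, rfl⟩ := (famTower d q R hR).H_zero ha
    rw [famE_alg d _ _ h]; exact Subalgebra.algebraMap_mem _ _
  | 1, N, a, h, ha => by
    obtain ⟨c, rfl⟩ := (famTower d q R hR).H_one ha
    rw [famE_alg d _ _ h]; exact Subalgebra.algebraMap_mem _ _
  | k+2, 0, a, h, ha => absurd h (by omega)
  | k+2, 1, a, h, ha => absurd h (by omega)
  | k+2, N+2, a, h, ha => by
    refine (famTower d q R hR).H_ind (P := fun a => famE d (k+2) (N+2) a ∈ (famTower d q R hR).H (N+2)) ha ?_ ?_ ?_ ?_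
    · intro a ha
      rw [famE_s]
      exact (famTower d q R hR).s_mem _ (famE_mem _ _ _ (by omega) ha)
    · intro a ha b hb
      have : famE d (k+2) (N+2) ((famTower d q R hR).s _ a * (famTower d q R hR).T k * (famTower d q R hR).s _ b) =
          (famTower d q R hR).s _ (famE d (k+1) (N+1) a) * (famTower d q R hR).T N * 
            (famTower d q R hR).s _ (famE d (k+1) (N+1) b) := by
        rw [← famE_s, ← famE_s]
        funext j
        refine (emb_mul _ _ _ _).trans ?_
        refine congrArg₂ (· * ·) ((emb_mul _ _ _ _).trans ?_) rfl
        exact congrArg₂ (· * ·) rfl (emb_FI (R j) k N (by omega))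
      rw [this]
      exact mul_mem (mul_mem ((famTower d q R hR).s_mem _ (famE_mem _ _ _ (by omega) ha)) ((famTower d q R hR).T_mem _))
        ((famTower d q R hR).s_mem _ (famE_mem _ _ _ (by omega) hb))
    · intro x y hx hy
      have : famE d (k+2) (N+2) (x + y) = famE d (k+2) (N+2) x + famE d (k+2) (N+2) y := by
        funext j; exact map_add _ _ _
      rw [this]; exact add_mem hx hy
    · intro c x hx
      have : famE d (k+2) (N+2) (c • x) = c • famE d (k+2) (N+2) x := by
        funext j; exact map_smul (emb (k+2) (N+2)) c (x j)
      rw [this]; exact Subalgebra.smul_mem _ hx _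
end fam

section core
variable {L : Type} [Field L] [CharZero L] (q : L) (d d' : ℕ) (R : M (Fin d × Fin d) L) (ε : Fin d' → L)

def fd : Option (Option ℕ) → ℕ
  | none => d
  | some none => d'
  | some (some r) => r+1

def fR : ∀ j, M (Fin (fd d d' j) × Fin (fd d d' j)) L
  | none => R
  | some none => Std.R q ε
  | some (some r) => Wr.RW q r

theorem core (S : M (Fin d × Fin d) L) (hS : IsSym q R S) (hq : q ≠ 0) (hq1 : ∀ n : ℕ, n ≠ 0 → q ^ n ≠ 1)
    (hε : ∀ i, ε i * ε i = (q-1) * ε i + q) (f : ℝ →+* L) (γ : Fin d' → ℝ) (hγ : ∀ i, 0 < γ i)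
    (hc : ∀ k, (W 1 R k).trace = (W (diagonal fun i => f (γ i)) (Std.R q ε) k).trace) (k : ℕ) :
    (W 1 R k).trace = (W (diagonal fun i => f (γ i)⁻¹) (Std.R q ε) k).trace := by
  have hR : ∀ j, IsHecke q (fR q d d' R ε j) := by
    rintro (_ | _ | r)
    · exact hS.toIsHecke
    · exact Std.isHecke q ε hε
    · exact Std.isHecke q _ (fun i => by ring)
  let c : Ctx q (famTower (fd d d') q (fR q d d' R ε) hR) R ε f γ :=
    { ρ := famHRep (fd d d') q (fR q d d' R ε) hR none
      ρ' := famHRep (fd d d') q (fR q d d' R ε) hR (some none)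
      ρW := fun r => famHRep (fd d d') q (fR q d d' R ε) hR (some (some r))
      hq := hq
      hq1 := hq1
      hγ := hγ
      hε := hε
      hc := hc }
  exact c.final hS (Std.isSym q ε hε hq) (famE _) (famE_mem _ _ _ _) (fun _ _ _ => rfl) (fun _ _ _ => rfl) (famE_s _ _ _ _) k
end core

namespace HTower
variable {L : Type} [Field L] {q : L} {A : ℕ → Type} [∀ n, Ring (A n)]
    [∀ n, Algebra L (A n)] (t : HTower L q A)

def qn (q : L) (n : ℕ) : L := ∑ i ∈ Finset.range n, q ^ i

theorem qn_succ (n : ℕ) : qn q (n+1) = qn q n + q ^ n := Finset.sum_range_succ _ _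
theorem qn_one : qn q 1 = 1 := by simp [qn]
theorem qn_mul (n : ℕ) : qn q n * (q - 1) = q ^ n - 1 := geom_sum_mul q n
theorem qn_ne (hq : ∀ n : ℕ, n ≠ 0 → q ^ n ≠ 1) (n : ℕ) (hn : n ≠ 0) : qn q n ≠ 0 := by
  intro h
  have := qn_mul (q := q) n
  rw [h, zero_mul] at this
  exact hq n hn (sub_eq_zero.1 this.symm)

def AA : ∀ n, A n
  | 0 => 1
  | 1 => 1
  | n+2 => (qn q (n+2))⁻¹ • (q^(n+1) • t.s _ (AA (n+1)) - qn q (n+1) • (t.s _ (AA (n+1)) * t.T n * t.s _ (AA (n+1))))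

variable (hq : ∀ n : ℕ, n ≠ 0 → q ^ n ≠ 1)
include hq

theorem AA_eq (n : ℕ) : qn q (n+2) • t.AA (n+2) = 
    q^(n+1) • t.s _ (t.AA (n+1)) - qn q (n+1) • (t.s _ (t.AA (n+1)) * t.T n * t.s _ (t.AA (n+1))) := by
  rw [AA, smul_smul, mul_inv_cancel₀ (qn_ne hq _ (by omega)), one_smul]

theorem AA_mem : ∀ n, t.AA n ∈ t.H n
  | 0 => one_mem _
  | 1 => one_mem _
  | n+2 => by
    rw [AA]
    refine Subalgebra.smul_mem _ (sub_mem (Subalgebra.smul_mem _ (t.s_mem _ (AA_mem _)) _) (Subalgebra.smul_mem _ ?_ _)) _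
    exact mul_mem (mul_mem (t.s_mem _ (AA_mem _)) (t.T_mem _)) (t.s_mem _ (AA_mem _))

theorem smul_cancel {n k : ℕ} (hn : n ≠ 0) {x y : A k} (h : qn q n • x = qn q n • y) : x = y := by
  have := congrArg ((qn q n)⁻¹ • ·) h
  simpa only [smul_smul, inv_mul_cancel₀ (qn_ne hq n hn), one_smul] using this

theorem AA_props : ∀ n, t.AA (n+1) * t.AA (n+1) = t.AA (n+1) ∧ t.AA (n+1) * t.s _ (t.AA n) = t.AA (n+1) ∧
    t.AA (n+2) * t.T n = - t.AA (n+2)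
  | 0 => by
    refine ⟨by simp [AA], by simp [AA], ?_⟩
    refine smul_cancel hq (n := 2) (by norm_num) ?_
    rw [← smul_mul_assoc, smul_neg, t.AA_eq hq 0]
    simp only [AA, map_one, one_mul, mul_one, sub_mul, smul_mul_assoc, t.quad, zero_add, pow_one, qn_one, one_smul, sub_smul]
    abel
  | n+1 => by
    obtain ⟨h1, h2, h3⟩ := AA_props n
    set P := t.AA (n+1) with hP
    have ha : t.AA (n+2) * t.s _ P = t.AA (n+2) := by
      refine smul_cancel hq (n := n+2) (by norm_num) ?_
      rw [← smul_mul_assoc, t.AA_eq hq n, sub_mul, smul_mul_assoc, smul_mul_assoc, mul_assoc (_ * _), ← map_mul, h1]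
    have hi : t.AA (n+2) * t.AA (n+2) = t.AA (n+2) := by
      refine smul_cancel hq (n := n+2) (by norm_num) ?_
      rw [← mul_smul_comm]
      conv_lhs => rw [t.AA_eq hq n]
      rw [mul_sub, mul_smul_comm, mul_smul_comm, ← mul_assoc, ← mul_assoc, ha, h3, neg_mul, ha,
        qn_succ (n+1), add_smul, smul_neg]
      abel
    refine ⟨hi, ha, ?_⟩
    refine smul_cancel hq (n := n+3) (by norm_num) ?_
    rw [← smul_mul_assoc, smul_neg, t.AA_eq hq (n+1)]
    set a := t.s _ (t.AA (n+2)) with hadef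
    set a' := t.s _ (t.s _ P) with hadef'
    set T := t.T (n+1)
    set T1 := t.s _ (t.T n) with hT1
    have k1 : a * a' = a := by rw [hadef, hadef', ← map_mul, ha]
    have k2 : a * T1 = - a := by rw [hadef, hT1, ← map_mul, h3, map_neg]
    have k3 : T * a' = a' * T := t.comm _ _
    have k4 : T * T = (q-1) • T + q • 1 := t.quad _
    have k5 : T * T1 * T = T1 * T * T1 := t.braid n
    have k6 : qn q (n+2) • a = q^(n+1) • a' - qn q (n+1) • (a' * T1 * a') := by
      rw [hadef, ← map_smul, t.AA_eq hq n, map_sub, map_smul, map_smul, map_mul, map_mul]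
    have k7 : qn q (n+2) • (a * T * a) = q^(n+1) • (a * T) - qn q (n+1) • (a * T * T1 * a') := by
      rw [← mul_smul_comm, k6, mul_sub, mul_smul_comm, mul_smul_comm]
      rw [mul_assoc a T a', k3, ← mul_assoc, k1]
      congr 2
      rw [← mul_assoc, ← mul_assoc, mul_assoc a T a', k3, ← mul_assoc, k1]
    have k8 : qn q (n+2) • (a * T * a * T) = (q^(n+1) * (q-1)) • (a * T) + (q^(n+1) * q) • a + qn q (n+1) • (a * T * T1 * a') := by
      rw [← smul_mul_assoc, k7, sub_mul, smul_mul_assoc, smul_mul_assoc]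
      rw [mul_assoc a T T, k4, mul_add, mul_smul_comm, mul_smul_comm, mul_one, smul_add, smul_smul, smul_smul]
      have : a * T * T1 * a' * T = - (a * T * T1 * a') := by
        rw [mul_assoc _ a' T, ← k3, ← mul_assoc, mul_assoc a T T1, mul_assoc a _ T, k5]
        simp only [← mul_assoc]
        rw [k2]
        simp only [neg_mul]
      rw [this, smul_neg, sub_neg_eq_add]
    rw [sub_mul, smul_mul_assoc, smul_mul_assoc, k8, k7]
    simp only [pow_succ, mul_sub, sub_smul, mul_one]
    abel

theorem AA_idem : ∀ n, t.AA n * t.AA n = t.AA n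
  | 0 => by simp [AA]
  | n+1 => (t.AA_props hq n).1
theorem AA_s (n : ℕ) : t.AA (n+1) * t.s _ (t.AA n) = t.AA (n+1) := (t.AA_props hq n).2.1
theorem AA_T (n : ℕ) : t.AA (n+2) * t.T n = - t.AA (n+2) := (t.AA_props hq n).2.2
end HTower

namespace HRep
open HTower
variable {L : Type} [Field L] {q : L} {A : ℕ → Type} [∀ n, Ring (A n)]
    [∀ n, Algebra L (A n)] {t : HTower L q A} {ι : Type} [Fintype ι] [DecidableEq ι]
    {R : M (ι × ι) L} (ρ : HRep t R) (hq : ∀ n : ℕ, n ≠ 0 → q ^ n ≠ 1)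
include ρ hq

def ak (ρ : HRep t R) (k : ℕ) : L := (ρ.π k (t.AA k)).trace

theorem gp_one : ∀ n, gp (1 : M ι L) n = 1
  | 0 => rfl
  | n+1 => by rw [gp, gp_one n, kr_one]

theorem ak_zero : ρ.ak 0 = 1 := by rw [ak, AA, map_one, trace_one0]
theorem ak_succ (k : ℕ) : ρ.ak (k+1) = ρ.chi 1 0 k (t.AA (k+1)) := by
  rw [chi_zero, phi, ρ.gp_one hq, one_mul, ak]

theorem newton_step (j k : ℕ) : qn q (k+2) * ρ.chi 1 j (k+1) (t.AA (k+2)) = 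
    q^(k+1) * ((W 1 R j).trace * ρ.ak (k+1)) - qn q (k+1) * ρ.chi 1 (j+1) k (t.AA (k+1)) := by
  rw [← chi_smul, t.AA_eq hq, sub_eq_add_neg, ← neg_smul, chi_add, chi_smul, chi_smul, chi_s, 
    ρ.chi_sTs 1 (by simp) _ _ _ _ (t.AA_mem hq _), t.AA_idem hq, ρ.ak_succ hq]
  ring

theorem newton_sum : ∀ k j : ℕ, qn q (k+1) * ρ.chi 1 j k (t.AA (k+1)) =
    ∑ p ∈ Finset.HasAntidiagonal.antidiagonal k, (-1)^p.1 * (W 1 R (j+p.1)).trace * (q^p.2 * ρ.ak p.2)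
  | 0, j => by simp [qn_one, AA, chi_one, ρ.ak_zero hq]
  | k+1, j => by
    rw [ρ.newton_step hq, newton_sum k (j+1), Finset.Nat.sum_antidiagonal_succ, sub_eq_add_neg, ← Finset.sum_neg_distrib]
    congr 1
    · simp; ring
    · refine Finset.sum_congr rfl fun p _ => ?_
      rw [show j + 1 + p.1 = j + (p.1+1) by omega, pow_succ]; ring

theorem newton : PowerSeries.mk ρ.ak = PowerSeries.rescale q (PowerSeries.mk ρ.ak) * 
    (1 - PowerSeries.C (q-1) * PowerSeries.X * PowerSeries.rescale (-1) (PowerSeries.mk fun k => (W 1 R k).trace)) := by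
  ext k
  rw [mul_sub, mul_one, map_sub]
  rcases k with _ | k
  · simp
  · rw [show ∀ a b : PowerSeries L, a * (PowerSeries.C (q-1) * PowerSeries.X * b) = PowerSeries.X * (PowerSeries.C (q-1) * (b * a)) by intros; ring,
      PowerSeries.coeff_succ_X_mul, PowerSeries.coeff_C_mul, PowerSeries.coeff_mul]
    simp only [PowerSeries.coeff_rescale, PowerSeries.coeff_mk]
    have := ρ.newton_sum hq k 0
    simp only [zero_add] at this
    rw [← this, ← ρ.ak_succ hq, ← mul_assoc, mul_comm (q-1), qn_mul]
    ring
end HRep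

namespace Dim
open HTower
variable {L : Type} [Field L] {q : L} {A : ℕ → Type} [∀ n, Ring (A n)]
    [∀ n, Algebra L (A n)] {t : HTower L q A} {ι : Type} [Fintype ι] [DecidableEq ι]
    {R : M (ι × ι) L} (ρ : HRep t R) (hq : ∀ n : ℕ, n ≠ 0 → q ^ n ≠ 1)
    {Λ : Type} [Ring Λ] [Algebra L Λ] (x : ι → Λ)

def wd : ∀ k, I ι k → Λ
  | 0, _ => 1
  | k+1, u => x u.1 * wd k u.2

def Th (k : ℕ) : M (I ι k) L →ₗ[L] (I ι k → Λ) where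
  toFun X u := ∑ v, X v u • wd x k v
  map_add' X Y := by
    funext u
    simp [add_smul, Finset.sum_add_distrib]
  map_smul' c X := by
    funext u
    simp [Finset.smul_sum, smul_smul]

theorem Th_apply (k : ℕ) (X : M (I ι k) L) (u : I ι k) : Th x k X u = ∑ v, X v u • wd x k v := rfl

theorem Th_mul (k : ℕ) (c : L) (X Y : M (I ι k) L) (h : Th x k X = c • wd x k) : Th x k (X * Y) = c • Th x k Y := by
  funext u
  have : ∀ z, ∑ v, X v z • wd x k v = c • wd x k z := fun z => congrFun h z
  rw [Pi.smul_apply, Th_apply, Th_apply, Finset.smul_sum]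
  simp only [Matrix.mul_apply, Finset.sum_smul]
  rw [Finset.sum_comm]
  refine Finset.sum_congr rfl fun z _ => ?_
  rw [smul_comm c, ← this z, Finset.smul_sum]
  refine Finset.sum_congr rfl fun v _ => ?_
  rw [smul_smul, mul_comm]

theorem Th_sI (k : ℕ) (X : M (I ι k) L) (h : Th x k X = wd x k) : Th x (k+1) (sI X) = wd x (k+1) := by
  funext u
  have : ∀ z, ∑ v, X v z • wd x k v = wd x k z := fun z => congrFun h z
  rw [Th_apply]
  show ∑ v : ι × I ι k, ((1 : M ι L) v.1 u.1 * X v.2 u.2) • (x v.1 * wd x k v.2) = x u.1 * wd x k u.2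
  rw [Fintype.sum_prod_type, ← this u.2, Finset.mul_sum]
  simp [Matrix.one_apply, ite_smul]

theorem Th_FI (hx : ∀ p' : ι × ι, ∑ p : ι × ι, R p p' • (x p.1 * x p.2) = - (x p'.1 * x p'.2)) (k : ℕ) :
    Th x (k+2) (FI k R) = (-1 : L) • wd x (k+2) := by
  funext u
  rw [Th_apply]
  show ∑ v : ι × ι × I ι k, (R (v.1, v.2.1) (u.1, u.2.1) * (1 : M (I ι k) L) v.2.2 u.2.2) • (x v.1 * (x v.2.1 * wd x k v.2.2)) = 
    (-1 : L) • (x u.1 * (x u.2.1 * wd x k u.2.2))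
  have := hx (u.1, u.2.1)
  rw [neg_smul, one_smul, ← mul_assoc, ← neg_mul, ← this, Fintype.sum_prod_type, Fintype.sum_prod_type, Finset.sum_mul]
  refine Finset.sum_congr rfl fun i _ => ?_
  rw [Fintype.sum_prod_type, Finset.sum_mul]
  refine Finset.sum_congr rfl fun j _ => ?_
  simp [Matrix.one_apply, ite_smul, mul_assoc]

include hq in
theorem Th_AA (hx : ∀ p' : ι × ι, ∑ p : ι × ι, R p p' • (x p.1 * x p.2) = - (x p'.1 * x p'.2)) :
    ∀ k, Th x k (ρ.π k (t.AA k)) = wd x k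
  | 0 => by
    funext u
    rw [Th_apply, AA, map_one]
    simp [Matrix.one_apply, ite_smul]
  | 1 => by
    funext u
    rw [Th_apply, AA, map_one]
    simp [Matrix.one_apply, ite_smul]
  | k+2 => by
    have h1 := Th_sI x (k+1) _ (Th_AA hx (k+1))
    have h2 := Th_FI x hx k
    have h3 := Th_mul x (k+2) 1 _ (FI k R) (by rw [one_smul]; exact h1)
    rw [h2, one_smul] at h3
    have h4 := Th_mul x (k+2) (-1) _ (sI (ρ.π (k+1) (t.AA (k+1)))) h3
    rw [h1] at h4
    rw [AA, map_smul, map_smul, map_sub, map_sub, map_smul, map_smul, map_smul, map_smul, ρ.pis, ρ.pisTs, h4, h1,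
      smul_smul, ← sub_smul, smul_smul, mul_neg_one, sub_neg_eq_add, add_comm (q ^ (k+1)), ← qn_succ, 
      inv_mul_cancel₀ (qn_ne hq _ (by omega)), one_smul]

def ten (k : ℕ) (i : ι) : (I ι k → L) →ₗ[L] (I ι (k+1) → L) :=
  LinearMap.pi (fun u : ι × I ι k => if u.1 = i then LinearMap.proj u.2 else 0)

theorem ten_apply (k : ℕ) (i : ι) (f : I ι k → L) : ten k i f = fun u : ι × I ι k => if u.1 = i then f u.2 else 0 := by
  funext u
  show (if u.1 = i then LinearMap.proj u.2 else 0 : (I ι k → L) →ₗ[L] L) f = _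
  split_ifs <;> rfl

theorem sI_ten (k : ℕ) (i : ι) (X : M (I ι k) L) (f : I ι k → L) : sI X *ᵥ ten k i f = ten k i (X *ᵥ f) := by
  rw [ten_apply, ten_apply]
  funext u
  show ∑ v : ι × I ι k, ((1 : M ι L) u.1 v.1 * X u.2 v.2) * (if v.1 = i then f v.2 else 0) = 
    if u.1 = i then ∑ w, X u.2 w * f w else 0
  rw [Fintype.sum_prod_type, Finset.sum_comm]
  split_ifs with h
  · refine Finset.sum_congr rfl fun w _ => ?_
    simp [Matrix.one_apply, h]
  · refine Finset.sum_eq_zero fun w _ => ?_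
    simp [Matrix.one_apply, h]

theorem FI_ten (k : ℕ) (p' : ι × ι) (f : I ι k → L) : FI k R *ᵥ ten (k+1) p'.1 (ten k p'.2 f) = 
    ∑ p : ι × ι, R p p' • ten (k+1) p.1 (ten k p.2 f) := by
  have h : ∀ i j : ι, ten (k+1) i (ten k j f) = 
      fun u : ι × ι × I ι k => if u.1 = i then (if u.2.1 = j then f u.2.2 else 0) else 0 := by
    intro i j
    rw [ten_apply (k+1) i (ten k j f), ten_apply k j f]
    rfl
  simp only [h]
  funext u
  rw [Finset.sum_apply]
  show ∑ v : ι × ι × I ι k, (R (u.1, u.2.1) (v.1, v.2.1) * (1 : M (I ι k) L) u.2.2 v.2.2) * 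
    (if v.1 = p'.1 then (if v.2.1 = p'.2 then f v.2.2 else 0) else 0) = 
    ∑ p : ι × ι, R p p' * (if u.1 = p.1 then (if u.2.1 = p.2 then f u.2.2 else 0) else 0)
  simp [Fintype.sum_prod_type, Matrix.one_apply]

def Lop (i : ι) : Module.End L (∀ l, I ι l → L) where
  toFun f
    | 0 => 0
    | l+1 => ρ.π (l+1) (t.AA (l+1)) *ᵥ ten l i (f l)
  map_add' f g := by
    funext l
    cases l with
    | zero => simp
    | succ l => simp [mulVec_add]
  map_smul' c f := by
    funext l
    cases l with
    | zero => simp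
    | succ l => simp [mulVec_smul]

theorem Lop_zero (i : ι) (f : ∀ l, I ι l → L) : Lop ρ i f 0 = 0 := rfl
theorem Lop_succ (i : ι) (f : ∀ l, I ι l → L) (l : ℕ) : Lop ρ i f (l+1) = ρ.π (l+1) (t.AA (l+1)) *ᵥ ten l i (f l) := rfl

include hq in
theorem Lop_Lop (i j : ι) (f : ∀ l, I ι l → L) (l : ℕ) : Lop ρ i (Lop ρ j f) (l+2) = 
    ρ.π (l+2) (t.AA (l+2)) *ᵥ ten (l+1) i (ten l j (f l)) := by
  rw [Lop_succ, Lop_succ, ← sI_ten, mulVec_mulVec, ← ρ.pis, ← map_mul, t.AA_s hq]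

include hq in
theorem Lop_rel (p' : ι × ι) : ∑ p : ι × ι, R p p' • (Lop ρ p.1 * Lop ρ p.2) = - (Lop ρ p'.1 * Lop ρ p'.2) := by
  refine LinearMap.ext fun f => funext fun l => ?_
  rw [LinearMap.sum_apply, Finset.sum_apply]
  simp only [LinearMap.smul_apply, LinearMap.neg_apply, Module.End.mul_apply, Pi.smul_apply, Pi.neg_apply]
  rcases l with _ | _ | l
  · simp [Lop_zero]
  · simp [Lop_succ, Lop_zero]
  · simp only [Lop_Lop ρ hq]
    simp only [← mulVec_smul]
    rw [← mulVec_sum, ← FI_ten, mulVec_mulVec, ← ρ.piT, ← map_mul, t.AA_T hq, map_neg, neg_mulVec]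

def vac : ∀ l, I ι l → L
  | 0 => fun _ => 1
  | _+1 => 0

include hq in
theorem act (Φ : Λ →ₐ[L] Module.End L (∀ l, I ι l → L)) (hΦ : ∀ i, Φ (x i) = Lop ρ i) : ∀ k (u : I ι k),
    Φ (wd x k u) vac k = ρ.π k (t.AA k) *ᵥ Pi.single u 1
  | 0, u => by
    rw [wd, map_one, AA, map_one, one_mulVec]
    funext v
    show 1 = (Pi.single () 1 : Unit → L) ()
    simp
  | k+1, u => by
    rw [wd, map_mul, hΦ, Module.End.mul_apply, Lop_succ, act Φ hΦ k u.2, ← sI_ten, mulVec_mulVec, ← ρ.pis, ← map_mul,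
      t.AA_s hq]
    congr 1
    rw [ten_apply]
    funext v
    show (if v.1 = u.1 then (Pi.single u.2 1 : I ι k → L) v.2 else 0) = (Pi.single u 1 : ι × I ι k → L) v
    rcases u with ⟨i, u⟩
    rcases v with ⟨j, v⟩
    simp only [Pi.single_apply, Prod.mk.injEq]
    split_ifs <;> simp_all

def theta (k : ℕ) : (I ι k → L) →ₗ[L] Λ := Fintype.linearCombination L (wd x k)

include hq in
theorem dim_eq (hx : ∀ p' : ι × ι, ∑ p : ι × ι, R p p' • (x p.1 * x p.2) = - (x p'.1 * x p'.2))
    (Φ : Λ →ₐ[L] Module.End L (∀ l, I ι l → L)) (hΦ : ∀ i, Φ (x i) = Lop ρ i) (k : ℕ) :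
    Module.finrank L (LinearMap.range (theta (L := L) x k)) = (ρ.π k (t.AA k)).rank := by
  have h1 : ∀ f, theta x k (ρ.π k (t.AA k) *ᵥ f) = theta x k f := by
    intro f
    have := Th_AA ρ hq x hx k
    rw [theta, Fintype.linearCombination_apply, Fintype.linearCombination_apply]
    conv_rhs => rw [← this]
    simp only [Th_apply, Finset.smul_sum, mulVec, dotProduct, Finset.sum_smul]
    rw [Finset.sum_comm]
    refine Finset.sum_congr rfl fun _ _ => Finset.sum_congr rfl fun _ _ => ?_
    rw [smul_smul, mul_comm]
  have h2 : ∀ f, Φ (theta x k f) vac k = ρ.π k (t.AA k) *ᵥ f := by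
    intro f
    rw [theta, Fintype.linearCombination_apply, map_sum, LinearMap.sum_apply, Finset.sum_apply]
    simp only [map_smul, LinearMap.smul_apply, Pi.smul_apply, act ρ hq x Φ hΦ, ← mulVec_smul]
    rw [← mulVec_sum]
    congr 1
    funext v
    simp [Finset.sum_apply, Pi.single_apply]
  have h3 : LinearMap.ker (theta (L := L) x k) = LinearMap.ker (ρ.π k (t.AA k)).mulVecLin := by
    ext f
    rw [LinearMap.mem_ker, LinearMap.mem_ker, mulVecLin_apply]
    constructor
    · intro h
      rw [← h2, h, map_zero]; rfl
    · intro h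
      rw [← h1, h, map_zero]
  have h4 := LinearMap.finrank_range_add_finrank_ker (theta (L := L) x k)
  have h5 := LinearMap.finrank_range_add_finrank_ker (ρ.π k (t.AA k)).mulVecLin
  rw [Matrix.rank]
  rw [h3] at h4
  omega
end Dim

section P1
variable {K : Type} [Field K] {V : Type} [AddCommGroup V] [Module K V]
  {ι : Type} [Fintype ι] [DecidableEq ι] (b : Module.Basis ι K V)
  {R : V ⊗[K] V →ₗ[K] V ⊗[K] V} {q : K}

abbrev S0 (R : V ⊗[K] V →ₗ[K] V ⊗[K] V) : M (ι × ι) K :=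
  LinearMap.toMatrix (b.tensorProduct b) (b.tensorProduct b) R

def Rm (q : K) (R : V ⊗[K] V →ₗ[K] V ⊗[K] V) : M (ι × ι) K := q⁻¹ • (S0 b R - (q-1) • 1)

theorem S0_quad (h : (R + LinearMap.id) ∘ₗ (R - q • LinearMap.id) = 0) :
    S0 b R * S0 b R = (q-1) • S0 b R + q • 1 := by
  have h1 := congrArg (LinearMap.toMatrix (b.tensorProduct b) (b.tensorProduct b)) h
  rw [LinearMap.toMatrix_comp _ (b.tensorProduct b)] at h1
  simp only [map_add, map_sub, map_smul, LinearMap.toMatrix_id, map_zero] at h1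
  have : S0 b R * S0 b R - ((q-1) • S0 b R + q • 1) = 0 := by
    rw [← h1]; simp [add_mul, mul_sub, sub_smul]; abel
  exact sub_eq_zero.1 this

theorem Rm_S0 (hq : q ≠ 0) (h : S0 b R * S0 b R = (q-1) • S0 b R + q • 1) : Rm b q R * S0 b R = 1 := by
  rw [Rm, smul_mul_assoc, sub_mul, h, smul_mul_assoc, one_mul, add_sub_cancel_left, smul_smul, inv_mul_cancel₀ hq, one_smul]
theorem S0_Rm (hq : q ≠ 0) (h : S0 b R * S0 b R = (q-1) • S0 b R + q • 1) : S0 b R * Rm b q R = 1 := by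
  rw [Rm, mul_smul_comm, mul_sub, h, mul_smul_comm, mul_one, add_sub_cancel_left, smul_smul, inv_mul_cancel₀ hq, one_smul]

theorem Rm_quad (hq : q ≠ 0) (h : S0 b R * S0 b R = (q-1) • S0 b R + q • 1) :
    Rm b q R * Rm b q R = (q⁻¹ - 1) • Rm b q R + q⁻¹ • 1 := by
  have h1 := S0_Rm b hq h
  have : S0 b R = q • Rm b q R + (q-1) • 1 := by
    rw [Rm, smul_smul, mul_inv_cancel₀ hq, one_smul]; abel
  rw [this, add_mul, smul_mul_assoc, smul_mul_assoc, one_mul] at h1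
  have h2 : q • (Rm b q R * Rm b q R) = 1 - (q-1) • Rm b q R := by rw [← h1]; abel
  have h3 := congrArg (fun z => q⁻¹ • z) h2
  simp only [smul_smul, inv_mul_cancel₀ hq, one_smul] at h3
  rw [h3, smul_sub, smul_smul, mul_sub, inv_mul_cancel₀ hq, mul_one, sub_smul, sub_smul]; abel

theorem toMatrix_conj : LinearMap.toMatrix ((b.tensorProduct b).tensorProduct b) ((b.tensorProduct b).tensorProduct b)
   ((TensorProduct.assoc K V V V).symm.toLinearMap ∘ₗ
        TensorProduct.map LinearMap.id R ∘ₗ (TensorProduct.assoc K V V V).toLinearMap) =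
   (Matrix.reindexAlgEquiv K K (Equiv.prodAssoc ι ι ι)).symm (sM (S0 b R)) := by
  have hB : b.tensorProduct (b.tensorProduct b) = (((b.tensorProduct b).tensorProduct b).map (TensorProduct.assoc K V V V)).reindex (Equiv.prodAssoc ι ι ι) := by
    apply Module.Basis.eq_of_apply_eq
    rintro ⟨i, j, k⟩; simp
  rw [sM_def, S0, ← LinearMap.toMatrix_id b, ← TensorProduct.toMatrix_map, hB]
  ext ⟨⟨i, j⟩, k⟩ ⟨⟨i', j'⟩, k'⟩
  simp [LinearMap.toMatrix_apply]

theorem S0_braid (h : (TensorProduct.map R LinearMap.id ∘ₗ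
      ((TensorProduct.assoc K V V V).symm.toLinearMap ∘ₗ
        TensorProduct.map LinearMap.id R ∘ₗ (TensorProduct.assoc K V V V).toLinearMap) ∘ₗ
      TensorProduct.map R LinearMap.id =
    ((TensorProduct.assoc K V V V).symm.toLinearMap ∘ₗ
        TensorProduct.map LinearMap.id R ∘ₗ (TensorProduct.assoc K V V V).toLinearMap) ∘ₗ
      TensorProduct.map R LinearMap.id ∘ₗ
      ((TensorProduct.assoc K V V V).symm.toLinearMap ∘ₗ
        TensorProduct.map LinearMap.id R ∘ₗ (TensorProduct.assoc K V V V).toLinearMap))) :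
    F ι (S0 b R) * sM (S0 b R) * F ι (S0 b R) = sM (S0 b R) * F ι (S0 b R) * sM (S0 b R) := by
  have hB := toMatrix_conj b (R := R)
  generalize ((TensorProduct.assoc K V V V).symm.toLinearMap ∘ₗ
        TensorProduct.map LinearMap.id R ∘ₗ (TensorProduct.assoc K V V V).toLinearMap) = Y at h hB
  have h1 := congrArg (LinearMap.toMatrix ((b.tensorProduct b).tensorProduct b) ((b.tensorProduct b).tensorProduct b)) h
  simp only [LinearMap.toMatrix_comp _ ((b.tensorProduct b).tensorProduct b), hB, TensorProduct.toMatrix_map, LinearMap.toMatrix_id] at h1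
  have h2 := congrArg (Matrix.reindexAlgEquiv K K (Equiv.prodAssoc ι ι ι)) h1
  simp only [map_mul, AlgEquiv.apply_symm_apply] at h2
  rw [mul_assoc, mul_assoc]; exact h2

theorem braid_inv {A : Type} [Ring A] {a b a' b' : A} (h : a * b * a = b * a * b) (ha : a * a' = 1) (ha' : a' * a = 1)
    (hb : b * b' = 1) (hb' : b' * b = 1) : a' * b' * a' = b' * a' * b' := by
  have h1 : (a' * b' * a') * (a * b * a) = 1 := by
    rw [show (a' * b' * a') * (a * b * a) = a' * (b' * ((a' * a) * b)) * a by noncomm_ring, ha', one_mul, hb', mul_one, ha']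
  have h2 : (b * a * b) * (b' * a' * b') = 1 := by
    rw [show (b * a * b) * (b' * a' * b') = b * (a * ((b * b') * a')) * b' by noncomm_ring, hb, one_mul, ha, mul_one, hb]
  rw [h] at h1
  exact left_inv_eq_right_inv h1 h2

theorem S0_inj [FiniteDimensional K V] (Rs : Module.Dual K V ⊗[K] V →ₗ[K] V ⊗[K] Module.Dual K V)
    (hbij : Function.Bijective Rs)
    (h : ∀ (ξ : Module.Dual K V) (v w : V),
      dualTensorHom K V V ((TensorProduct.comm K V (Module.Dual K V)) (Rs (ξ ⊗ₜ[K] v))) w =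
        TensorProduct.lid K V (TensorProduct.map ξ LinearMap.id (R (v ⊗ₜ[K] w))))
    (Z : M ι K) (hZ : hat (S0 b R) Z = 0) : Z = 0 := by
  let z : Module.Dual K V ⊗[K] V := ∑ a, ∑ a', Z a a' • (b.dualBasis a' ⊗ₜ b a)
  have key : ∀ w, dualTensorHom K V V ((TensorProduct.comm K V (Module.Dual K V)) (Rs z)) w = 0 := by
    intro w
    have hR : ∀ p, R (b p.1 ⊗ₜ b p.2) = ∑ p' : ι × ι, S0 b R p' p • (b p'.1 ⊗ₜ[K] b p'.2) := by
      intro p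
      have := LinearMap.toMatrix_mulVec_repr (b.tensorProduct b) (b.tensorProduct b) R (b p.1 ⊗ₜ b p.2)
      rw [← (b.tensorProduct b).sum_repr (R (b p.1 ⊗ₜ b p.2))]
      simp only [Module.Basis.tensorProduct_apply']
      refine Finset.sum_congr rfl fun p' _ => ?_
      simp [LinearMap.toMatrix_apply, Module.Basis.tensorProduct_apply']
    have : ∀ j, dualTensorHom K V V ((TensorProduct.comm K V (Module.Dual K V)) (Rs z)) (b j) = 0 := by
      intro j
      simp only [z, map_sum, map_smul, LinearMap.sum_apply, LinearMap.smul_apply, h]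
      apply b.repr.injective
      ext c
      have hc := congrFun (congrFun hZ c) j
      rw [hat_def, ptr_apply] at hc
      simp only [Matrix.zero_apply] at hc
      rw [map_zero, Finsupp.zero_apply, ← hc]
      simp only [map_sum, map_smul, Finsupp.coe_finset_sum, Finset.sum_apply, Finsupp.smul_apply, Finsupp.coe_smul, Pi.smul_apply]
      refine Finset.sum_congr rfl fun a _ => Finset.sum_congr rfl fun a' _ => ?_
      rw [smul_eq_mul, hR (a, j)]
      congr 1
      simp [Fintype.sum_prod_type, Finsupp.single_apply]
    have h0 : dualTensorHom K V V ((TensorProduct.comm K V (Module.Dual K V)) (Rs z)) = 0 := b.ext (by simpa using this)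
    rw [h0]; rfl
  have hz : z = 0 := by
    apply hbij.1
    rw [map_zero]
    apply (TensorProduct.comm K V (Module.Dual K V)).injective
    rw [map_zero]
    have hinj : Function.Injective (dualTensorHom K V V) := by
      have := (dualTensorHomEquivOfBasis b (N := V) ).injective
      intro u v huv
      exact this (by simpa [dualTensorHomEquivOfBasis_apply] using huv)
    apply hinj
    rw [map_zero]; exact LinearMap.ext key
  ext a a'
  have := congrArg (fun u => (b.dualBasis.tensorProduct b).repr u (a', a)) hz
  simpa [z, Finsupp.single_apply, -Module.Basis.coe_dualBasis] using this

theorem isSym_of [FiniteDimensional K V] (hq : q ≠ 0) (hR : IsHeckeSymmetry K V q R) : IsSym q⁻¹ (Rm b q R) (S0 b R) := by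
  obtain ⟨h1, h2, h3, Rs, h4, h5⟩ := hR
  have hS := S0_quad b h3
  have e1 := Rm_S0 b hq hS
  have e2 := S0_Rm b hq hS
  refine { quad := Rm_quad b hq hS, braid := ?_, RS := e1, SR := e2, inj := S0_inj b Rs h4 h5 }
  apply braid_inv (S0_braid b h2)
  · rw [← F_mul, e2, F_one]
  · rw [← F_mul, e1, F_one]
  · rw [← map_mul, e2, map_one]
  · rw [← map_mul, e1, map_one]
end P1

section P2
variable {K : Type} [Field K] {V : Type} [AddCommGroup V] [Module K V]
  {ι : Type} [Fintype ι] [DecidableEq ι] (b : Module.Basis ι K V)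
  {R : V ⊗[K] V →ₗ[K] V ⊗[K] V} {q : K}

theorem R_bb (p : ι × ι) : R (b p.1 ⊗ₜ b p.2) = ∑ p' : ι × ι, S0 b R p' p • (b p'.1 ⊗ₜ[K] b p'.2) := by
  rw [← (b.tensorProduct b).sum_repr (R (b p.1 ⊗ₜ b p.2))]
  simp only [Module.Basis.tensorProduct_apply']
  refine Finset.sum_congr rfl fun p' _ => ?_
  simp [LinearMap.toMatrix_apply, Module.Basis.tensorProduct_apply']

/-- swap a matrix relation -/
theorem mat_swap {X : Type} [AddCommGroup X] [Module K X] {κ : Type} [Fintype κ] [DecidableEq κ]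
    (A B : M κ K) (hAB : A * B = 1) (f g : κ → X)
    (h : ∀ p', ∑ p, A p p' • f p = g p') (r : κ) : f r = ∑ p, B p r • g p := by
  simp only [← h, Finset.smul_sum, smul_smul]
  rw [Finset.sum_comm]
  simp only [← Finset.sum_smul]
  have : ∀ p, ∑ i, B i r * A p i = (1 : M κ K) p r := by
    intro p; rw [← hAB, Matrix.mul_apply]; exact Finset.sum_congr rfl fun _ _ => mul_comm _ _
  simp [this, Matrix.one_apply, ite_smul]

def xg (R : V ⊗[K] V →ₗ[K] V ⊗[K] V) (i : ι) : RingQuot (lambdaRel K V R) :=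
  RingQuot.mkAlgHom K (lambdaRel K V R) (TensorAlgebra.ι K (b i))

theorem mulTwo_tmul (v w : V) : mulTwo K V (v ⊗ₜ w) = TensorAlgebra.ι K v * TensorAlgebra.ι K w := by
  simp [mulTwo]

theorem xg_rel0 (p : ι × ι) : ∑ p', S0 b R p' p • (xg b R p'.1 * xg b R p'.2) = - (xg b R p.1 * xg b R p.2) := by
  have h : RingQuot.mkAlgHom K (lambdaRel K V R) (mulTwo K V ((R + (LinearMap.id : V ⊗[K] V →ₗ[K] V ⊗[K] V)) (b p.1 ⊗ₜ b p.2))) = 0 := by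
    rw [← map_zero (RingQuot.mkAlgHom K (lambdaRel K V R))]
    exact RingQuot.mkAlgHom_rel K ⟨rfl, _, rfl⟩
  rw [LinearMap.add_apply, R_bb b, LinearMap.id_apply] at h
  simp only [map_add, map_sum, map_smul, mulTwo_tmul, map_mul] at h
  exact eq_neg_of_add_eq_zero_left h

theorem xg_rel (T : M (ι × ι) K) (hT : S0 b R * T = 1) (p : ι × ι) :
    ∑ p', T p' p • (xg b R p'.1 * xg b R p'.2) = - (xg b R p.1 * xg b R p.2) := by
  have := mat_swap (S0 b R) T hT (fun p => xg b R p.1 * xg b R p.2) _ (xg_rel0 b) p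
  rw [this]; simp

variable {E : Type} [AddCommGroup E] [Module K E] (l : ι → Module.End K E)

theorem exists_Phi (T : M (ι × ι) K) (hT : T * S0 b R = 1)
    (hl : ∀ p', ∑ p : ι × ι, T p p' • (l p.1 * l p.2) = - (l p'.1 * l p'.2)) :
    ∃ Φ : RingQuot (lambdaRel K V R) →ₐ[K] Module.End K E, ∀ i, Φ (xg b R i) = l i := by
  let φ : TensorAlgebra K V →ₐ[K] Module.End K E := TensorAlgebra.lift K (b.constr K l)
  have hφ : ∀ i, φ (TensorAlgebra.ι K (b i)) = l i := by intro i; simp [φ]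
  have h0 : (φ.toLinearMap ∘ₗ mulTwo K V) ∘ₗ (R + (LinearMap.id : V ⊗[K] V →ₗ[K] V ⊗[K] V)) = 0 := by
    apply (b.tensorProduct b).ext
    intro p
    have := mat_swap T (S0 b R) hT (fun p => l p.1 * l p.2) _ hl p
    rw [Module.Basis.tensorProduct_apply', LinearMap.comp_apply, LinearMap.add_apply, R_bb b, LinearMap.id_apply]
    simp only [map_add, map_sum, map_smul, LinearMap.comp_apply, mulTwo_tmul, AlgHom.toLinearMap_apply, map_mul, hφ]
    rw [this]; simp
  refine ⟨RingQuot.liftAlgHom K ⟨φ, ?_⟩, ?_⟩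
  · rintro a c ⟨rfl, u, rfl⟩
    rw [map_zero]
    exact LinearMap.congr_fun h0 u
  · intro i
    rw [xg, RingQuot.liftAlgHom_mkAlgHom_apply, hφ]

theorem range_theta (k : ℕ) : LinearMap.range (Dim.theta (L := K) (xg b R) k) = lambdaGrade K V R k := by
  have h1 : Submodule.map (RingQuot.mkAlgHom K (lambdaRel K V R)).toLinearMap
    (LinearMap.range (TensorAlgebra.ι K : V →ₗ[K] TensorAlgebra K V)) = Submodule.span K (Set.range (xg b R)) := by
    rw [← LinearMap.range_comp, ← Submodule.map_top, ← b.span_eq, Submodule.map_span, ← Set.range_comp]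
    rfl
  rw [lambdaGrade, Submodule.map_pow, h1, Dim.theta, Fintype.range_linearCombination]
  induction k with
  | zero =>
    rw [pow_zero, Submodule.one_eq_span]
    congr 1
    show Set.range (fun _ : Unit => (1 : RingQuot (lambdaRel K V R))) = _
    simp
  | succ k ih =>
    rw [pow_succ', ← ih, Submodule.span_mul_span]
    congr 1
    ext z
    simp only [Set.mem_range, Set.mem_mul]
    constructor
    · rintro ⟨u, rfl⟩
      exact ⟨_, ⟨u.1, rfl⟩, _, ⟨u.2, rfl⟩, rfl⟩
    · rintro ⟨_, ⟨i, rfl⟩, _, ⟨u, rfl⟩, rfl⟩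
      exact ⟨(i, u), rfl⟩

end P2

theorem dims {K : Type} [Field K] [CharZero K] {V : Type} [AddCommGroup V] [Module K V] [FiniteDimensional K V]
    {R : V ⊗[K] V →ₗ[K] V ⊗[K] V} {q : K} (hq0 : q ≠ 0) (hq : ∀ n : ℕ, 1 < n → q ^ n ≠ 1) (hR : IsHeckeSymmetry K V q R) :
    ∃ (d : ℕ) (T S : M (Fin d × Fin d) K), IsSym q⁻¹ T S ∧ 
      PowerSeries.mk (fun k => (Module.finrank K (lambdaGrade K V R k) : K)) = PowerSeries.rescale q⁻¹ (PowerSeries.mk (fun k => (Module.finrank K (lambdaGrade K V R k) : K))) * 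
    (1 - PowerSeries.C (q⁻¹-1) * PowerSeries.X * PowerSeries.rescale (-1) (PowerSeries.mk fun k => (W 1 T k).trace)) := by
  have hq1 : ∀ n : ℕ, n ≠ 0 → q⁻¹ ^ n ≠ 1 := by
    intro n hn h
    rw [inv_pow, inv_eq_one] at h
    refine hq (2 * n) (by omega) ?_
    rw [mul_comm, pow_mul, h, one_pow]
  let b := Module.finBasis K V
  have hs := isSym_of b hq0 hR
  refine ⟨_, Rm b q R, S0 b R, hs, ?_⟩
  let ρ := famHRep (J := Unit) (fun _ => Module.finrank K V) q⁻¹ (fun _ => Rm b q R) (fun _ => hs.toIsHecke) ()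
  have h := ρ.newton hq1
  have hk : ∀ k, ρ.ak k = (Module.finrank K (lambdaGrade K V R k) : K) := by
    intro k
    obtain ⟨Φ, hΦ⟩ := exists_Phi b (Dim.Lop ρ) (Rm b q R) hs.RS (Dim.Lop_rel ρ hq1)
    rw [← range_theta b, Dim.dim_eq ρ hq1 (xg b R) (xg_rel b _ hs.SR) Φ hΦ k, ← trace_idem, HRep.ak]
    rw [← map_mul, HTower.AA_idem _ hq1]
  have hk' : ρ.ak = fun k => (Module.finrank K (lambdaGrade K V R k) : K) := funext hk
  rw [hk'] at h
  exact h

theorem common_field (K : Type) [Field K] [CharZero K] :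
    ∃ (L : Type) (_ : Field L) (_ : CharZero L), Nonempty (K →+* L) ∧ Nonempty (ℝ →+* L) := by
  haveI : Nontrivial (K ⊗[ℚ] ℝ) := inferInstance
  obtain ⟨I, hI⟩ := Ideal.exists_maximal (K ⊗[ℚ] ℝ)
  letI : Field ((K ⊗[ℚ] ℝ) ⧸ I) := Ideal.Quotient.field I
  let f : ℝ →+* ((K ⊗[ℚ] ℝ) ⧸ I) := (Ideal.Quotient.mk I).comp (Algebra.TensorProduct.includeRight : ℝ →ₐ[ℚ] K ⊗[ℚ] ℝ).toRingHom
  let g : K →+* ((K ⊗[ℚ] ℝ) ⧸ I) := (Ideal.Quotient.mk I).comp (Algebra.TensorProduct.includeLeft : K →ₐ[ℚ] K ⊗[ℚ] ℝ).toRingHom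
  exact ⟨(K ⊗[ℚ] ℝ) ⧸ I, inferInstance, charZero_of_injective_ringHom f.injective, ⟨g⟩, ⟨f⟩⟩

section bc
variable {K L : Type} [Field K] [Field L] (φ : K →+* L) {ι κ : Type} [Fintype ι] [DecidableEq ι] [Fintype κ] [DecidableEq κ]

theorem hat_map (S : M (ι × ι) K) (Z : M ι K) : hat (φ.mapMatrix S) (φ.mapMatrix Z) = φ.mapMatrix (hat S Z) := by
  ext i j
  simp [hat_def, ptr_apply]

theorem F_map (S : M (ι × ι) K) : F κ (φ.mapMatrix S) = φ.mapMatrix (F κ S) := by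
  ext ⟨i, j, k⟩ ⟨i', j', k'⟩
  rw [RingHom.mapMatrix_apply, RingHom.mapMatrix_apply, Matrix.map_apply, F_apply, F_apply, map_mul]
  simp [Matrix.one_apply, apply_ite φ]

theorem sM_map (S : M κ K) : (sM (φ.mapMatrix S) : M (ι × κ) L) = φ.mapMatrix (sM S) := by
  ext ⟨i, k⟩ ⟨i', k'⟩
  simp [sM_def, Matrix.one_apply, apply_ite φ]

theorem mapM_smul (c : K) (X : M κ K) : φ.mapMatrix (c • X) = φ c • φ.mapMatrix X := by
  ext i j; simp

theorem W_map (R : M (ι × ι) K) (k : ℕ) : W 1 (φ.mapMatrix R) k = φ.mapMatrix (W 1 R k) := by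
  induction k with
  | zero => simp [W]
  | succ k ih => rw [W, W, ih, hat_map, map_mul, map_one]

theorem trace_W_map (R : M (ι × ι) K) (k : ℕ) : (W 1 (φ.mapMatrix R) k).trace = φ (W 1 R k).trace := by
  rw [W_map]; simp [Matrix.trace]

theorem IsSym.map {q : K} {R S : M (ι × ι) K} (h : IsSym q R S) : IsSym (φ q) (φ.mapMatrix R) (φ.mapMatrix S) where
  quad := by
    rw [← map_mul, h.quad, map_add, mapM_smul, mapM_smul, map_sub, map_one, map_one]
  braid := by
    rw [F_map, sM_map, ← map_mul, ← map_mul, h.braid, map_mul, map_mul]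
  RS := by rw [← map_mul, h.RS, map_one]
  SR := by rw [← map_mul, h.SR, map_one]
  inj := by
    have h1 : Function.Surjective (hat S) := LinearMap.surjective_of_injective
      ((injective_iff_map_eq_zero _).2 h.inj)
    have h2 : Function.Surjective (hat (φ.mapMatrix S)) := by
      rw [← LinearMap.range_eq_top, eq_top_iff]
      rintro Z -
      rw [Matrix.matrix_eq_sum_single Z]
      refine Submodule.sum_mem _ fun i _ => Submodule.sum_mem _ fun j _ => ?_
      obtain ⟨C, hC⟩ := h1 (Matrix.single i j 1)
      refine ⟨Z i j • φ.mapMatrix C, ?_⟩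
      rw [map_smul, hat_map, hC]
      ext a b
      simp [Matrix.single_apply, apply_ite φ]
    exact (injective_iff_map_eq_zero _).1 (LinearMap.injective_iff_surjective.2 h2)
end bc

section fin
variable {L : Type} [Field L]

def PN {m : ℕ} (x : Fin m → L) : PowerSeries L := ∏ i, (1 + PowerSeries.C (x i) * PowerSeries.X)
def PD {m : ℕ} (y : Fin m → L) : PowerSeries L := ∏ i, (1 - PowerSeries.C (y i) * PowerSeries.X)

def Us (q : L) (c : ℕ → L) : PowerSeries L := 
  1 - PowerSeries.C (q-1) * PowerSeries.X * PowerSeries.rescale (-1) (PowerSeries.mk c)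

theorem resc_C (a r : L) : PowerSeries.rescale a (PowerSeries.C r) = PowerSeries.C r := by
  ext n; rw [PowerSeries.coeff_rescale, PowerSeries.coeff_C]; split_ifs with h <;> simp [h]

theorem std_pm (q : L) (m n : ℕ) (x : Fin m → L) (y : Fin n → L) :
    Us q (fun k => (W (diagonal (Fin.append x y)) (Std.R q (Fin.append (fun _ : Fin m => q) (fun _ : Fin n => (-1 : L)))) k).trace)
      * (PowerSeries.rescale q (PN x) * PD y) = PN x * PowerSeries.rescale q (PD y) := by
  have h := congrArg (PowerSeries.rescale (-1 : L)) (Std.std_series q (m+n) (Fin.append (fun _ : Fin m => q) (fun _ : Fin n => (-1 : L))) (Fin.append x y))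
  rw [Fin.prod_univ_add, Fin.prod_univ_add] at h
  simp only [Fin.append_left, Fin.append_right, map_mul, map_add, map_sub, map_one, map_prod, resc_C, PowerSeries.rescale_X, map_neg] at h
  simp only [Us, PN, PD, map_prod, map_add, map_sub, map_mul, map_one, resc_C, PowerSeries.rescale_X]
  convert h using 1
  · congr 1
    · ring
    · congr 1 <;> exact Finset.prod_congr rfl fun _ _ => by ring
  · congr 1 <;> exact Finset.prod_congr rfl fun _ _ => by ring

theorem PN_const {m : ℕ} (x : Fin m → L) : PowerSeries.constantCoeff (PN x) = 1 := by simp [PN, map_prod]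
theorem PD_const {m : ℕ} (x : Fin m → L) : PowerSeries.constantCoeff (PD x) = 1 := by simp [PD, map_prod]

theorem ne_of_const {A : PowerSeries L} (h : PowerSeries.constantCoeff A = 1) : A ≠ 0 := by
  rintro rfl; simp at h

theorem resc_const (q : L) {A : PowerSeries L} (h : PowerSeries.constantCoeff A = 1) : 
    PowerSeries.constantCoeff (PowerSeries.rescale q A) = 1 := by
  rw [← h, ← PowerSeries.coeff_zero_eq_constantCoeff_apply, PowerSeries.coeff_rescale]; simp

theorem eq_of_resc (q : L) (hq : ∀ n : ℕ, n ≠ 0 → q ^ n ≠ 1) (A B : PowerSeries L) 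
    (hA : PowerSeries.constantCoeff A = 1) (hB : PowerSeries.constantCoeff B = 1)
    (h : A * PowerSeries.rescale q B = B * PowerSeries.rescale q A) : A = B := by
  obtain ⟨H, hH⟩ : ∃ H, A = B * H := ⟨B⁻¹ * A, by rw [← mul_assoc, PowerSeries.mul_inv_cancel _ (by simp [hB]), one_mul]⟩
  have hc : PowerSeries.constantCoeff H = 1 := by
    have := congrArg PowerSeries.constantCoeff hH
    rw [map_mul, hA, hB, one_mul] at this; exact this.symm
  rw [hH, map_mul] at h
  have h2 : H = PowerSeries.rescale q H := by
    apply mul_left_cancel₀ (mul_ne_zero (ne_of_const hB) (ne_of_const (resc_const q hB)))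
    linear_combination h
  have h3 : H = 1 := by
    ext n
    by_cases hn : n = 0
    · subst hn; simpa using hc
    · have := congrArg (PowerSeries.coeff n) h2
      rw [PowerSeries.coeff_rescale] at this
      have h5 : (q^n - 1) * PowerSeries.coeff n H = 0 := by linear_combination -this
      rw [PowerSeries.coeff_one, if_neg hn]
      exact (mul_eq_zero.1 h5).resolve_left (sub_ne_zero.2 (hq n hn))
  rw [hH, h3, mul_one]

theorem Us_inj (q : L) (hq : q ≠ 1) (c c' : ℕ → L) (h : Us q c = Us q c') (k : ℕ) : c k = c' k := by
  have := congrArg (PowerSeries.coeff (k+1)) h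
  have e : ∀ c : ℕ → L, PowerSeries.coeff (k+1) (Us q c) = PowerSeries.coeff (k+1) (1 : PowerSeries L) - (q-1) * ((-1)^k * c k) := by
    intro c
    rw [Us, mul_assoc, map_sub]
    congr 1
    rw [PowerSeries.coeff_C_mul, PowerSeries.coeff_succ_X_mul, PowerSeries.coeff_rescale, PowerSeries.coeff_mk]
  rw [e, e] at this
  have h2 : (q-1) * ((-1)^k * c k) = (q-1) * ((-1)^k * c' k) := by linear_combination -this
  have h3 := mul_left_cancel₀ (sub_ne_zero.2 hq) h2
  exact mul_left_cancel₀ (pow_ne_zero _ (by simp)) h3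

theorem PN_map {L' : Type} [Field L'] (f : L →+* L') {m : ℕ} (x : Fin m → L) : PowerSeries.map f (PN x) = PN fun i => f (x i) := by
  simp [PN, map_prod]
theorem PD_map {L' : Type} [Field L'] (f : L →+* L') {m : ℕ} (x : Fin m → L) : PowerSeries.map f (PD x) = PD fun i => f (x i) := by
  simp [PD, map_prod]

theorem coe_PN {m : ℕ} (x : Fin m → L) : ((∏ i : Fin m, (1 + Polynomial.C (x i) * Polynomial.X) : Polynomial L) :
          PowerSeries L) = PN x := by
  rw [← Polynomial.coeToPowerSeries.ringHom_apply, map_prod]; simp [PN]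
theorem coe_PD {m : ℕ} (x : Fin m → L) : ((∏ i : Fin m, (1 - Polynomial.C (x i) * Polynomial.X) : Polynomial L) :
          PowerSeries L) = PD x := by
  rw [← Polynomial.coeToPowerSeries.ringHom_apply, map_prod]; simp [PD]
end fin

theorem roots_lin (a : ℝ) (ha : a ≠ 0) : (1 + Polynomial.C a * Polynomial.X : ℝ[X]).roots = {-a⁻¹} := by
  rw [add_comm, ← Polynomial.C_1, Polynomial.roots_C_mul_X_add_C 1 ha]; simp

theorem lin_ne (a : ℝ) : (1 + Polynomial.C a * Polynomial.X : ℝ[X]) ≠ 0 := by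
  intro h
  have := congrArg (Polynomial.eval 0) h
  simp at this

theorem roots_prod_lin {m : ℕ} (x : Fin m → ℝ) (hx : ∀ i, x i ≠ 0) : 
    (∏ i : Fin m, (1 + Polynomial.C (x i) * Polynomial.X) : ℝ[X]).roots = Multiset.map (fun i => -(x i)⁻¹) Finset.univ.val := by
  rw [Polynomial.roots_prod _ _ (Finset.prod_ne_zero_iff.2 fun i _ => lin_ne _)]
  simp only [roots_lin _ (hx _)]
  exact Multiset.bind_singleton _ _

theorem prod_lin_ne {m : ℕ} (x : Fin m → ℝ) : (∏ i : Fin m, (1 + Polynomial.C (x i) * Polynomial.X) : ℝ[X]) ≠ 0 :=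
  Finset.prod_ne_zero_iff.2 fun i _ => lin_ne _

theorem multi {m n : ℕ} (x : Fin m → ℝ) (y : Fin n → ℝ) (hx : ∀ i, 0 < x i) (hy : ∀ j, 0 < y j)
    (h : PN x * PD (fun j => (y j)⁻¹) = PN (fun i => (x i)⁻¹) * PD y) : 
    Multiset.map x Finset.univ.val = Multiset.map (fun i => (x i)⁻¹) Finset.univ.val ∧
    Multiset.map y Finset.univ.val = Multiset.map (fun j => (y j)⁻¹) Finset.univ.val := by
  rw [← coe_PN, ← coe_PN, ← coe_PD, ← coe_PD, ← Polynomial.coe_mul, ← Polynomial.coe_mul, Polynomial.coe_inj] at h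
  have e : ∀ z : Fin n → ℝ, (∏ j : Fin n, (1 - Polynomial.C (z j) * Polynomial.X) : ℝ[X]) = ∏ j : Fin n, (1 + Polynomial.C (-z j) * Polynomial.X) := by
    intro z; refine Finset.prod_congr rfl fun _ _ => ?_; rw [map_neg]; ring
  rw [e, e] at h
  have h2 := congrArg Polynomial.roots h
  rw [Polynomial.roots_mul (mul_ne_zero (prod_lin_ne _) (prod_lin_ne _)), Polynomial.roots_mul (mul_ne_zero (prod_lin_ne _) (prod_lin_ne _)),
    roots_prod_lin _ (fun i => (hx i).ne'), roots_prod_lin _ (fun i => (inv_pos.2 (hx i)).ne'), 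
    roots_prod_lin _ (fun i => by simpa using (hy i).ne'), roots_prod_lin _ (fun i => by simpa using (hy i).ne')] at h2
  simp only [inv_neg, neg_neg, inv_inv] at h2
  have hp : ∀ (r : ℕ) (z : Fin r → ℝ), (∀ i, 0 < z i) → Multiset.filter (0 < ·) (Multiset.map z Finset.univ.val) = Multiset.map z Finset.univ.val := by
    intro r z hz; rw [Multiset.filter_eq_self]; intro a ha
    obtain ⟨i, -, rfl⟩ := Multiset.mem_map.1 ha; exact hz i
  have hn : ∀ (r : ℕ) (z : Fin r → ℝ), (∀ i, z i < 0) → Multiset.filter (0 < ·) (Multiset.map z Finset.univ.val) = 0 := by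
    intro r z hz; rw [Multiset.filter_eq_nil]; intro a ha
    obtain ⟨i, -, rfl⟩ := Multiset.mem_map.1 ha; exact (hz i).le.not_gt
  have h3 := congrArg (Multiset.filter (0 < ·)) h2
  rw [Multiset.filter_add, Multiset.filter_add, hp _ _ (fun i => hy i), hp _ _ (fun i => inv_pos.2 (hy i)),
    hn _ _ (fun i => by simpa using hx i), hn _ _ (fun i => by simpa using hx i), zero_add, zero_add] at h3
  refine ⟨?_, h3⟩
  rw [h3] at h2
  have h4 := congrArg (Multiset.map (fun a : ℝ => -a)) (add_right_cancel h2)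
  simp only [Multiset.map_map, Function.comp_def, neg_neg] at h4
  exact h4.symm

theorem main_thm
    (K : Type) [Field K] [CharZero K]
    (V : Type) [AddCommGroup V] [Module K V] [FiniteDimensional K V]
    (q : K) (hq0 : q ≠ 0) (hq : ∀ n : ℕ, 1 < n → q ^ n ≠ 1)
    (R : V ⊗[K] V →ₗ[K] V ⊗[K] V) (hR : IsHeckeSymmetry K V q R)
    (m n : ℕ) (x : Fin m → ℝ) (y : Fin n → ℝ)
    (hx : ∀ i, 0 < x i) (hy : ∀ j, 0 < y j)
    (heq : poincareLambda K V R *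
        ((∏ j : Fin n, (1 - Polynomial.C (y j) * Polynomial.X) : Polynomial ℝ) :
          PowerSeries ℝ) =
      ((∏ i : Fin m, (1 + Polynomial.C (x i) * Polynomial.X) : Polynomial ℝ) :
        PowerSeries ℝ)) :
    Multiset.map x Finset.univ.val = Multiset.map (fun i => (x i)⁻¹) Finset.univ.val ∧
    Multiset.map y Finset.univ.val = Multiset.map (fun j => (y j)⁻¹) Finset.univ.val := by
  obtain ⟨d, T, S, hs, hnew⟩ := dims hq0 hq hR
  obtain ⟨L, _, _, ⟨φ⟩, ⟨f⟩⟩ := common_field K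
  rw [coe_PN, coe_PD] at heq
  set Q : L := φ q⁻¹ with hQ
  have hQ0 : Q ≠ 0 := by rw [hQ, Ne, map_eq_zero]; exact inv_ne_zero hq0
  have hQ1 : ∀ n : ℕ, n ≠ 0 → Q ^ n ≠ 1 := by
    intro n hn h
    rw [hQ, ← map_pow, ← map_one φ] at h
    have h := φ.injective h
    rw [inv_pow, inv_eq_one] at h
    refine hq (2 * n) (by omega) ?_
    rw [mul_comm, pow_mul, h, one_pow]
  have hQne : Q ≠ 1 := by simpa using hQ1 1 one_ne_zero
  set T' := φ.mapMatrix T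
  have hs' : IsSym Q T' (φ.mapMatrix S) := hs.map φ
  let E : PowerSeries L := PowerSeries.mk (fun k => (Module.finrank K (lambdaGrade K V R k) : L))
  have hE1 : PowerSeries.map f (poincareLambda K V R) = E := by
    ext k; simp [poincareLambda, E]
  have hED : E * PD (fun j => f (y j)) = PN (fun i => f (x i)) := by
    rw [← hE1, ← PD_map, ← PN_map, ← map_mul, heq]
  have hE2 : E = PowerSeries.rescale Q E * Us Q (fun k => (W 1 T' k).trace) := by
    have h := congrArg (PowerSeries.map φ) hnew
    have e1 : PowerSeries.map φ (PowerSeries.mk (fun k => (Module.finrank K (lambdaGrade K V R k) : K))) = E := by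
      ext k; simp [E]
    have e2 : PowerSeries.map φ (PowerSeries.rescale q⁻¹ (PowerSeries.mk (fun k => (Module.finrank K (lambdaGrade K V R k) : K)))) = PowerSeries.rescale Q E := by
      ext k; simp [E, hQ]
    have e3 : PowerSeries.map φ (1 - PowerSeries.C (q⁻¹-1) * PowerSeries.X * PowerSeries.rescale (-1) (PowerSeries.mk fun k => (W 1 T k).trace)) = Us Q (fun k => (W 1 T' k).trace) := by
      have e4 : PowerSeries.map φ (PowerSeries.rescale (-1) (PowerSeries.mk fun k => (W 1 T k).trace)) = PowerSeries.rescale (-1) (PowerSeries.mk fun k => (W 1 T' k).trace) := by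
        ext k
        simp only [PowerSeries.coeff_map, PowerSeries.coeff_rescale, PowerSeries.coeff_mk, map_mul, map_pow, map_neg, map_one, T', trace_W_map]
      rw [map_sub, map_mul, map_mul, e4, PowerSeries.map_C, PowerSeries.map_X, map_one, map_sub, map_one, Us]
    rw [map_mul, e1, e2, e3] at h
    exact h
  set N := PN (fun i => f (x i))
  set D := PD (fun j => f (y j))
  set N' := PN (fun i => f (x i)⁻¹)
  set D' := PD (fun j => f (y j)⁻¹)
  set U := Us Q (fun k => (W 1 T' k).trace)
  have hU : U * (PowerSeries.rescale Q N * D) = N * PowerSeries.rescale Q D := by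
    rw [← hED, map_mul]
    linear_combination -(D * PowerSeries.rescale Q D) * hE2
  have hN : N ≠ 0 := ne_of_const (PN_const _)
  have hD : D ≠ 0 := ne_of_const (PD_const _)
  have hNQ : PowerSeries.rescale Q N ≠ 0 := ne_of_const (resc_const Q (PN_const _))
  have hDQ : PowerSeries.rescale Q D ≠ 0 := ne_of_const (resc_const Q (PD_const _))
  let ε : Fin (m+n) → L := Fin.append (fun _ : Fin m => Q) (fun _ : Fin n => (-1 : L))
  let γ : Fin (m+n) → ℝ := Fin.append x y
  have hfγ : (fun i => f (γ i)) = Fin.append (fun i => f (x i)) (fun j => f (y j)) := by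
    funext i; refine Fin.addCases (fun i => ?_) (fun j => ?_) i <;> simp [γ]
  have hfγ' : (fun i => f (γ i)⁻¹) = Fin.append (fun i => f (x i)⁻¹) (fun j => f (y j)⁻¹) := by
    funext i; refine Fin.addCases (fun i => ?_) (fun j => ?_) i <;> simp [γ]
  have hst := std_pm Q m n (fun i => f (x i)) (fun j => f (y j))
  have hst' := std_pm Q m n (fun i => f (x i)⁻¹) (fun j => f (y j)⁻¹)
  rw [← hfγ] at hst
  rw [← hfγ'] at hst'
  have hc : ∀ k, (W 1 T' k).trace = (W (diagonal fun i => f (γ i)) (Std.R Q ε) k).trace := by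
    apply Us_inj Q hQne
    apply mul_right_cancel₀ (mul_ne_zero hNQ hD)
    exact hU.trans hst.symm
  have hcore := core Q d (m+n) T' ε (φ.mapMatrix S) hs' hQ0 hQ1 (by
    intro i; refine Fin.addCases (fun i => ?_) (fun j => ?_) i <;> simp [ε] <;> ring) f γ (by
    intro i; refine Fin.addCases (fun i => ?_) (fun j => ?_) i <;> simp [γ, hx, hy]) hc
  have hU' : U * (PowerSeries.rescale Q N' * D') = N' * PowerSeries.rescale Q D' := by
    rw [← hst']
    congr 1
    exact congrArg (Us Q) (_root_.funext hcore)
  have hU0 : U ≠ 0 := by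
    intro h0
    rw [h0, zero_mul] at hU
    exact mul_ne_zero hN hDQ hU.symm
  have hfin : N * D' = N' * D := by
    apply eq_of_resc Q hQ1
    · rw [map_mul, PN_const, PD_const, one_mul]
    · rw [map_mul, PN_const, PD_const, one_mul]
    · rw [map_mul, map_mul]
      apply mul_left_cancel₀ hU0
      linear_combination (N * PowerSeries.rescale Q D) * hU' - (N' * PowerSeries.rescale Q D') * hU
  apply multi x y hx hy
  apply PowerSeries.map_injective f f.injective
  rw [map_mul, map_mul, PN_map, PN_map, PD_map, PD_map]
  exact hfin

end hsmain

end HS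

/-- If `P_Λ(t) · ∏ (1 - yⱼ t) = ∏ (1 + xᵢ t)` with `xᵢ, yⱼ > 0`, then the multiset
`{x₁, …, x_m}` equals `{x₁⁻¹, …, x_m⁻¹}` and `{y₁, …, yₙ}` equals `{y₁⁻¹, …, yₙ⁻¹}`. -/
theorem poincare_series_lambda_roots_inv_invariant
    (K : Type) [Field K] [CharZero K]
    (V : Type) [AddCommGroup V] [Module K V] [FiniteDimensional K V]
    (q : K) (hq0 : q ≠ 0) (hq : ∀ n : ℕ, 1 < n → q ^ n ≠ 1)
    (R : V ⊗[K] V →ₗ[K] V ⊗[K] V) (hR : IsHeckeSymmetry K V q R)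
    (m n : ℕ) (x : Fin m → ℝ) (y : Fin n → ℝ)
    (hx : ∀ i, 0 < x i) (hy : ∀ j, 0 < y j)
    (heq : poincareLambda K V R *
        ((∏ j : Fin n, (1 - Polynomial.C (y j) * Polynomial.X) : Polynomial ℝ) :
          PowerSeries ℝ) =
      ((∏ i : Fin m, (1 + Polynomial.C (x i) * Polynomial.X) : Polynomial ℝ) :
        PowerSeries ℝ)) :
    Multiset.map x Finset.univ.val = Multiset.map (fun i => (x i)⁻¹) Finset.univ.val ∧
    Multiset.map y Finset.univ.val = Multiset.map (fun j => (y j)⁻¹) Finset.univ.val := by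
  exact HS.main_thm K V q hq0 hq R hR m n x y hx hy heq

end
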